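/- Krivine-Stengle Positivstellensatz for trace polynomials, vanishing case: Let S ∪ {a} be a finite subset of Sym TT_n. Then a(X) = 0 for every X ∈ K_S if and only if there exists k ∈ ℕ such that −a^{2k} ∈ T_S^tr. -/

import Mathlib

noncomputable section

open Matrix

/-- The polynomial ring ℝ[ξ] in the g·n² commuting variables ξ_{jıȷ}. -/
abbrev PolyRing (n g : ℕ) : Type := MvPolynomial (Fin g × Fin n × Fin n) ℝ

/-- n×n matrices over ℝ[ξ]. -/
abbrev MatP (n g : ℕ) : Type := Matrix (Fin n) (Fin n) (PolyRing n g)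

/-- The generic matrices Ξ_j = (ξ_{jıȷ})_{ıȷ}. -/
def genMat (n g : ℕ) (j : Fin g) : MatP n g :=
  Matrix.of fun a b => MvPolynomial.X (j, a, b)

/-- The set of generic matrices together with their transposes. -/
def genSet (n g : ℕ) : Set (MatP n g) :=
  Set.range (genMat n g) ∪ Set.range (fun j => (genMat n g j)ᵀ)

/-- The trace ring TT_n: the ℝ-subalgebra of M_n(ℝ[ξ]) generated by the Ξ_j, their
transposes, and the scalar matrices tr(w)·1 for all products w of the Ξ_j, Ξ_jᵀ. -/
def traceRing (n g : ℕ) : Subalgebra ℝ (MatP n g) :=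
  Algebra.adjoin ℝ
    (genSet n g ∪
      {m | ∃ w ∈ Submonoid.closure (genSet n g), m = (Matrix.trace w) • (1 : MatP n g)})

/-- The center C_n of the trace ring: the scalar matrices in TT_n. -/
def centerSet (n g : ℕ) : Set (MatP n g) :=
  {c | c ∈ traceRing n g ∧ ∃ p : PolyRing n g, c = p • (1 : MatP n g)}

/-- Evaluation of a matrix of polynomials at a g-tuple X of n×n real matrices. -/
def evalMat (n g : ℕ) (X : Fin g → Matrix (Fin n) (Fin n) ℝ) (h : MatP n g) :
    Matrix (Fin n) (Fin n) ℝ :=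
  h.map (MvPolynomial.eval fun v => X v.1 v.2.1 v.2.2)

/-- The semialgebraic set K_S determined by S. -/
def KSet (n g : ℕ) (S : Set (MatP n g)) : Set (Fin g → Matrix (Fin n) (Fin n) ℝ) :=
  {X | ∀ s ∈ S, (evalMat n g X s).PosSemidef}

/-- Cyclic quadratic module in Sym TT_n. -/
def IsCyclicQM (n g : ℕ) (Q : Set (MatP n g)) : Prop :=
  (∀ q ∈ Q, q ∈ traceRing n g ∧ qᵀ = q) ∧
  (1 : MatP n g) ∈ Q ∧
  (∀ a ∈ Q, ∀ b ∈ Q, a + b ∈ Q) ∧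
  (∀ h ∈ traceRing n g, ∀ q ∈ Q, h * q * hᵀ ∈ Q) ∧
  (∀ q ∈ Q, (Matrix.trace q) • (1 : MatP n g) ∈ Q)

/-- Cyclic preordering: a cyclic quadratic module whose intersection with the center
is closed under multiplication. -/
def IsCyclicPreordering (n g : ℕ) (T : Set (MatP n g)) : Prop :=
  IsCyclicQM n g T ∧
  ∀ a ∈ T ∩ centerSet n g, ∀ b ∈ T ∩ centerSet n g, a * b ∈ T

/-- The smallest cyclic preordering T_S^tr containing S. -/
def TtrS (n g : ℕ) (S : Set (MatP n g)) : Set (MatP n g) :=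
  {a | ∀ T : Set (MatP n g), IsCyclicPreordering n g T → S ⊆ T → a ∈ T}

open Polynomial in
/-- Polynomials over `R` have the intermediate value property. -/
def PolyIVT (R : Type*) [Field R] [LinearOrder R] : Prop :=
  ∀ (p : R[X]) (a b : R), a ≤ b → p.eval a * p.eval b ≤ 0 → ∃ c, a ≤ c ∧ c ≤ b ∧ p.eval c = 0

namespace PolyIVT

open Polynomial

variable {R : Type*} [Field R] [LinearOrder R]

theorem exists_root_Ioo (h : PolyIVT R) {p : R[X]} {a b : R} (hab : a ≤ b)
    (hp : p.eval a * p.eval b < 0) : ∃ c, a < c ∧ c < b ∧ p.eval c = 0 := by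
  obtain ⟨c, h1, h2, h3⟩ := h p a b hab hp.le
  refine ⟨c, lt_of_le_of_ne h1 ?_, lt_of_le_of_ne h2 ?_, h3⟩
  · rintro rfl; simp [h3] at hp
  · rintro rfl; simp [h3] at hp

theorem eval_mul_eval_pos (h : PolyIVT R) {p : R[X]} {a b : R} (hab : a ≤ b)
    (hp : ∀ c, a ≤ c → c ≤ b → p.eval c ≠ 0) : 0 < p.eval a * p.eval b := by
  by_contra! hc
  obtain ⟨c, h1, h2, h3⟩ := h p a b hab hc
  exact hp c h1 h2 h3

variable [IsStrictOrderedRing R]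

theorem rolle_of_no_root (h : PolyIVT R) {p : R[X]} {a b : R} (hab : a < b) (hp0 : p ≠ 0)
    (ha : p.eval a = 0) (hb : p.eval b = 0) (hno : ∀ c, a < c → c < b → p.eval c ≠ 0) :
    ∃ c, a < c ∧ c < b ∧ p.derivative.eval c = 0 := by
  obtain ⟨q, hq, hqa⟩ := p.exists_eq_pow_rootMultiplicity_mul_and_not_dvd hp0 a
  have hm : p.rootMultiplicity a ≠ 0 := by
    rw [← Nat.pos_iff_ne_zero, rootMultiplicity_pos hp0]; exact ha
  obtain ⟨m, hm⟩ := Nat.exists_eq_succ_of_ne_zero hm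
  rw [hm] at hq
  have hq0 : q ≠ 0 := by rintro rfl; exact hqa (dvd_zero _)
  obtain ⟨g, hg, hgb⟩ := q.exists_eq_pow_rootMultiplicity_mul_and_not_dvd hq0 b
  have hqb : q.eval b = 0 := by
    rw [hq] at hb
    simpa [sub_eq_zero, hab.ne'] using hb
  have hk : q.rootMultiplicity b ≠ 0 := by
    rw [← Nat.pos_iff_ne_zero, rootMultiplicity_pos hq0]; exact hqb
  obtain ⟨k, hk⟩ := Nat.exists_eq_succ_of_ne_zero hk
  rw [hk] at hg
  rw [dvd_iff_isRoot] at hqa hgb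
  have hga : g.eval a ≠ 0 := by
    intro h0; apply hqa; rw [hg]; simp [h0]
  have hgpos : 0 < g.eval a * g.eval b := by
    refine h.eval_mul_eval_pos hab.le fun c h1 h2 h3 => ?_
    rcases h1.eq_or_lt with rfl | h1
    · exact hga h3
    rcases h2.eq_or_lt with rfl | h2
    · exact hgb h3
    · exact hno c h1 h2 (by rw [hq, hg]; simp [h3])
  set r : R[X] := C ((m : R) + 1) * (X - C b) * g + C ((k : R) + 1) * (X - C a) * g
    + (X - C a) * (X - C b) * derivative g with hr
  have hd : derivative p = (X - C a) ^ m * (X - C b) ^ k * r := by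
    rw [hq, hg, hr]
    simp only [derivative_mul, derivative_X_sub_C_pow, Nat.succ_eq_add_one, Nat.add_sub_cancel]
    simp only [Nat.cast_add, Nat.cast_one, C_add, C_1, map_natCast]
    ring
  have hra : r.eval a * r.eval b < 0 := by
    have e : r.eval a * r.eval b =
        -(((m : R) + 1) * ((k : R) + 1) * (b - a) ^ 2 * (g.eval a * g.eval b)) := by
      rw [hr]; simp; ring
    rw [e, neg_lt_zero]
    have := sub_pos.2 hab
    positivity
  obtain ⟨c, h1, h2, h3⟩ := h.exists_root_Ioo hab.le hra
  exact ⟨c, h1, h2, by rw [hd]; simp [h3]⟩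

theorem rolle (h : PolyIVT R) {p : R[X]} {a b : R} (hab : a < b)
    (hpab : p.eval a = p.eval b) : ∃ c, a < c ∧ c < b ∧ p.derivative.eval c = 0 := by
  classical
  set q := p - C (p.eval a) with hq
  have hd : q.derivative = p.derivative := by simp [hq]
  by_cases hq0 : q = 0
  · obtain ⟨c, h1, h2⟩ := exists_between hab
    exact ⟨c, h1, h2, by rw [← hd, hq0]; simp⟩
  have hb : b ∈ q.roots.toFinset.filter (a < ·) := by
    simp only [Finset.mem_filter, Multiset.mem_toFinset, mem_roots hq0, IsRoot.def]
    exact ⟨by simp [hq, hpab], hab⟩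
  obtain ⟨b', hb', hmin⟩ := Finset.exists_min_image _ id ⟨b, hb⟩
  simp only [Finset.mem_filter, Multiset.mem_toFinset, mem_roots hq0, IsRoot.def, id] at hb' hmin hb
  rw [← hd]
  obtain ⟨c, h1, h2, h3⟩ := h.rolle_of_no_root hb'.2 hq0 (by simp [hq]) hb'.1
    (fun c h1 h2 h3 => (hmin c ⟨h3, h1⟩).not_gt h2)
  exact ⟨c, h1, h2.trans_le (hmin b hb), h3⟩

theorem eq_of_eval_eq (h : PolyIVT R) {p : R[X]} {l u : R}
    (hd : ∀ c, l < c → c < u → p.derivative.eval c ≠ 0) {x y : R} (hx : l ≤ x) (hx' : x ≤ u)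
    (hy : l ≤ y) (hy' : y ≤ u) (hxy : p.eval x = p.eval y) : x = y := by
  rcases lt_trichotomy x y with hlt | rfl | hlt
  · obtain ⟨c, h1, h2, h3⟩ := h.rolle hlt hxy
    exact absurd h3 (hd c (hx.trans_lt h1) (h2.trans_le hy'))
  · rfl
  · obtain ⟨c, h1, h2, h3⟩ := h.rolle hlt hxy.symm
    exact absurd h3 (hd c (hy.trans_lt h1) (h2.trans_le hx'))

theorem eval_mul_eval_neg_of_root (h : PolyIVT R) {p : R[X]} {l u a : R}
    (hd : ∀ c, l < c → c < u → p.derivative.eval c ≠ 0) (hl : l < a) (hu : a < u)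
    (ha : p.eval a = 0) : p.eval l * p.eval u < 0 := by
  have inj := fun x y hx hx' hy hy' => h.eq_of_eval_eq (x := x) (y := y) hd hx hx' hy hy'
  have key : ∀ q : R[X], (∀ x y, l ≤ x → x ≤ u → l ≤ y → y ≤ u → q.eval x = q.eval y → x = y) →
      q.eval a = 0 → 0 < q.eval l → 0 < q.eval u → False := by
    intro q inj ha h1 h2
    rcases le_total (q.eval l) (q.eval u) with hle | hle
    · obtain ⟨c, c1, c2, c3⟩ := h (q - C (q.eval l)) a u hu.le (by
        simp only [eval_sub, eval_C, ha]; nlinarith)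
      have := inj c l (hl.le.trans c1) c2 le_rfl (hl.trans hu).le
        (by simpa [sub_eq_zero] using c3)
      exact absurd c1 (by rw [this]; exact hl.not_ge)
    · obtain ⟨c, c1, c2, c3⟩ := h (q - C (q.eval u)) l a hl.le (by
        simp only [eval_sub, eval_C, ha]; nlinarith)
      have := inj c u c1 (c2.trans hu.le) (hl.trans hu).le le_rfl
        (by simpa [sub_eq_zero] using c3)
      exact absurd c2 (by rw [this]; exact hu.not_ge)
  have hl0 : p.eval l ≠ 0 := fun h0 =>
    hl.ne (inj l a le_rfl (hl.trans hu).le hl.le hu.le (by rw [h0, ha]))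
  have hu0 : p.eval u ≠ 0 := fun h0 =>
    hu.ne' (inj u a (hl.trans hu).le le_rfl hl.le hu.le (by rw [h0, ha]))
  rcases lt_or_gt_of_ne hl0 with h1 | h1 <;> rcases lt_or_gt_of_ne hu0 with h2 | h2
  · exact (key (-p) (fun x y a b c d e => inj x y a b c d (by simpa using e)) (by simp [ha])
      (by simpa using h1) (by simpa using h2)).elim
  · exact mul_neg_of_neg_of_pos h1 h2
  · exact mul_neg_of_pos_of_neg h1 h2
  · exact (key p inj ha h1 h2).elim

/-- Nonnegative elements have square roots. -/
theorem exists_sq_eq (h : PolyIVT R) {a : R} (ha : 0 ≤ a) : ∃ r, 0 ≤ r ∧ r ^ 2 = a := by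
  obtain ⟨c, h1, -, h3⟩ := h (X ^ 2 - C a) 0 (a + 1) (by linarith) (by
    simp only [eval_sub, eval_pow, eval_X, eval_C]
    nlinarith [mul_nonneg ha ha, mul_nonneg ha (mul_nonneg ha ha)])
  exact ⟨c, h1, by simpa [sub_eq_zero] using h3⟩

end PolyIVT

section PartialIsomorphism

open Polynomial

/-- Every root of `g` under `i` comes from the base field. -/
def RootsIn {E R : Type*} [Field E] [Field R] (i : E →+* R) (g : E[X]) : Prop :=
  ∀ x, (g.map i).eval x = 0 → ∃ e, i e = x

theorem Polynomial.Monic.abs_root_lt {R : Type*} [Field R] [LinearOrder R]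
    [IsStrictOrderedRing R] {p : R[X]} (hp : p.Monic) {x : R} (hx : p.eval x = 0) :
    |x| < 1 + ∑ i ∈ Finset.range p.natDegree, (1 + p.coeff i ^ 2) := by
  by_contra! hB
  set s := ∑ i ∈ Finset.range p.natDegree, (1 + p.coeff i ^ 2) with hs
  have hs0 : 0 ≤ s := Finset.sum_nonneg fun i _ => by positivity
  have hx1 : 1 ≤ |x| := by linarith
  have e : x ^ p.natDegree = - ∑ i ∈ Finset.range p.natDegree, p.coeff i * x ^ i := by
    have := hx
    rw [hp.as_sum] at this
    simp only [eval_add, eval_pow, eval_X, eval_finsetSum, eval_mul, eval_C] at this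
    linarith
  have hd : p.natDegree ≠ 0 := by
    intro h0
    rw [hp.natDegree_eq_zero] at h0
    simp [h0] at hx
  obtain ⟨d, hd⟩ := Nat.exists_eq_succ_of_ne_zero hd
  have h1 : |x| ^ p.natDegree ≤ s * |x| ^ d := by
    rw [← abs_pow, e, abs_neg, hs, Finset.sum_mul]
    refine (Finset.abs_sum_le_sum_abs _ _).trans (Finset.sum_le_sum fun i hi => ?_)
    rw [abs_mul, abs_pow]
    have h2 : |p.coeff i| ≤ 1 + p.coeff i ^ 2 := by
      rw [← sq_abs (p.coeff i)]; nlinarith [sq_nonneg (|p.coeff i| - 1)]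
    have h3 : |x| ^ i ≤ |x| ^ d := by
      refine pow_le_pow_right₀ hx1 ?_
      have := Finset.mem_range.1 hi
      omega
    gcongr
  rw [hd, pow_succ] at h1
  have : 0 < |x| ^ d := by positivity
  nlinarith

variable {E R₁ R₂ : Type*} [Field E]
  [Field R₁] [LinearOrder R₁] [IsStrictOrderedRing R₁]
  [Field R₂] [LinearOrder R₂] [IsStrictOrderedRing R₂]
  {i₁ : E →+* R₁} {i₂ : E →+* R₂}

theorem lt_iff_of_sign (hs : ∀ e, 0 < i₁ e ↔ 0 < i₂ e) (a b : E) :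
    i₁ a < i₁ b ↔ i₂ a < i₂ b := by
  have := hs (b - a)
  simpa using this

theorem le_iff_of_sign (hs : ∀ e, 0 < i₁ e ↔ 0 < i₂ e) (a b : E) :
    i₁ a ≤ i₁ b ↔ i₂ a ≤ i₂ b := by
  rw [← not_lt, ← not_lt, lt_iff_of_sign hs]

theorem eval_map_pos_iff_of_cut (h₁ : PolyIVT R₁) (h₂ : PolyIVT R₂)
    (hs : ∀ e, 0 < i₁ e ↔ 0 < i₂ e) {α : R₁} {β : R₂} (hα : ∀ e, i₁ e ≠ α)
    (hlt : ∀ e, i₁ e < α → i₂ e < β) (hgt : ∀ e, α < i₁ e → β < i₂ e)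
    {g : E[X]} (hg : g ≠ 0) (r₁ : RootsIn i₁ g) (r₂ : RootsIn i₂ g) :
    0 < (g.map i₁).eval α ↔ 0 < (g.map i₂).eval β := by
  classical
  have hg₁ : g.map i₁ ≠ 0 := (Polynomial.map_ne_zero_iff i₁.injective).2 hg
  obtain ⟨m, hm⟩ : ∃ m : E, ∀ e : E, g.eval e = 0 →
      (i₁ e < α → i₁ e < i₁ m) ∧ (α < i₁ e → i₁ m < i₁ e) := by
    let Z : Finset i₁.fieldRange := (g.map i₁).roots.toFinset.subtype (· ∈ i₁.fieldRange)
    obtain ⟨⟨_, m, rfl⟩, hm1, hm2⟩ := Order.exists_between_finsets (α := i₁.fieldRange)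
      (Z.filter fun z => (z : R₁) < α) (Z.filter fun z => α < (z : R₁)) (by
        intro x hx y hy
        have : (x : R₁) < (y : R₁) := (Finset.mem_filter.1 hx).2.trans (Finset.mem_filter.1 hy).2
        exact this)
    refine ⟨m, fun e he => ?_⟩
    have hz : (⟨i₁ e, e, rfl⟩ : i₁.fieldRange) ∈ Z := by
      simp only [Z, Finset.mem_subtype, Multiset.mem_toFinset, mem_roots hg₁, IsRoot.def,
        eval_map, eval₂_at_apply, he, map_zero]
    exact ⟨fun h => hm1 ⟨i₁ e, e, rfl⟩ (Finset.mem_filter.2 ⟨hz, h⟩),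
      fun h => hm2 ⟨i₁ e, e, rfl⟩ (Finset.mem_filter.2 ⟨hz, h⟩)⟩
  have ev₁ : ∀ e, (g.map i₁).eval (i₁ e) = i₁ (g.eval e) := fun e => by
    rw [eval_map, eval₂_at_apply]
  have ev₂ : ∀ e, (g.map i₂).eval (i₂ e) = i₂ (g.eval e) := fun e => by
    rw [eval_map, eval₂_at_apply]
  have k₁ : 0 < (g.map i₁).eval (i₁ m) * (g.map i₁).eval α := by
    rcases lt_or_gt_of_ne (hα m) with h | h
    · refine h₁.eval_mul_eval_pos h.le fun c c1 c2 c3 => ?_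
      obtain ⟨e, rfl⟩ := r₁ c c3
      rw [ev₁, map_eq_zero] at c3
      exact ((hm e c3).1 (lt_of_le_of_ne c2 (hα e))).not_ge c1
    · rw [mul_comm]
      refine h₁.eval_mul_eval_pos h.le fun c c1 c2 c3 => ?_
      obtain ⟨e, rfl⟩ := r₁ c c3
      rw [ev₁, map_eq_zero] at c3
      exact ((hm e c3).2 (lt_of_le_of_ne c1 (hα e).symm)).not_ge c2
  have k₂ : 0 < (g.map i₂).eval (i₂ m) * (g.map i₂).eval β := by
    rcases lt_or_gt_of_ne (hα m) with h | h
    · refine h₂.eval_mul_eval_pos (hlt m h).le fun c c1 c2 c3 => ?_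
      obtain ⟨e, rfl⟩ := r₂ c c3
      rw [ev₂, map_eq_zero] at c3
      rw [← le_iff_of_sign hs] at c1
      rcases lt_or_gt_of_ne (hα e) with h' | h'
      · exact ((hm e c3).1 h').not_ge c1
      · exact (hgt e h').not_ge c2
    · rw [mul_comm]
      refine h₂.eval_mul_eval_pos (hgt m h).le fun c c1 c2 c3 => ?_
      obtain ⟨e, rfl⟩ := r₂ c c3
      rw [ev₂, map_eq_zero] at c3
      rw [← le_iff_of_sign hs] at c2
      rcases lt_or_gt_of_ne (hα e) with h' | h'
      · exact (hlt e h').not_ge c1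
      · exact ((hm e c3).2 h').not_ge c2
  rw [ev₁] at k₁
  rw [ev₂] at k₂
  constructor
  · intro h
    exact (pos_iff_pos_of_mul_pos k₂).1 ((hs _).1 ((pos_iff_pos_of_mul_pos k₁).2 h))
  · intro h
    exact (pos_iff_pos_of_mul_pos k₁).1 ((hs _).2 ((pos_iff_pos_of_mul_pos k₂).2 h))

theorem rootsIn_of_natDegree_lt (h₁ : PolyIVT R₁) (h₂ : PolyIVT R₂)
    (hs : ∀ e, 0 < i₁ e ↔ 0 < i₂ e)
    (hmax : ∀ α β, (∀ g : E[X], 0 < (g.map i₁).eval α ↔ 0 < (g.map i₂).eval β) →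
      ∃ e, i₁ e = α ∧ i₂ e = β) {f : E[X]} (hf : f.Monic)
    (ih : ∀ g : E[X], g ≠ 0 → g.natDegree < f.natDegree → RootsIn i₁ g ∧ RootsIn i₂ g) :
    RootsIn i₁ f := by
  classical
  have : CharZero E := i₁.charZero
  intro α hα
  by_contra! hαE
  have hf0 : f.natDegree ≠ 0 := by
    intro h0
    rw [hf.natDegree_eq_zero] at h0
    simp [h0] at hα
  have hd0 : derivative f ≠ 0 := fun h0 => hf0 (derivative_eq_zero.1 h0)
  obtain ⟨d₁, d₂⟩ := ih _ hd0 (natDegree_derivative_lt hf0)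
  have hd₁ : (derivative f).map i₁ ≠ 0 := (Polynomial.map_ne_zero_iff i₁.injective).2 hd0
  set b : E := 1 + ∑ i ∈ Finset.range f.natDegree, (1 + f.coeff i ^ 2) with hb
  have hab : |α| < i₁ b := by
    have := (hf.map i₁).abs_root_lt hα
    simpa [hb, natDegree_map] using this
  obtain ⟨hab1, hab2⟩ := abs_lt.1 hab
  have ev₁ : ∀ (g : E[X]) e, (g.map i₁).eval (i₁ e) = i₁ (g.eval e) := fun g e => by
    rw [eval_map, eval₂_at_apply]
  have ev₂ : ∀ (g : E[X]) e, (g.map i₂).eval (i₂ e) = i₂ (g.eval e) := fun g e => by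
    rw [eval_map, eval₂_at_apply]
  let Z : Finset R₁ := ((derivative f).map i₁).roots.toFinset ∪ {i₁ b, i₁ (-b)}
  have hZ : ∀ z ∈ Z, ∃ e, i₁ e = z := by
    intro z hz
    simp only [Z, Finset.mem_union, Multiset.mem_toFinset, mem_roots hd₁, IsRoot.def,
      Finset.mem_insert, Finset.mem_singleton] at hz
    rcases hz with hz | rfl | rfl
    · exact d₁ z hz
    · exact ⟨_, rfl⟩
    · exact ⟨_, rfl⟩
  obtain ⟨l, hl, hlmax⟩ := Finset.exists_max_image (Z.filter (· < α)) id
    ⟨i₁ (-b), by simp [Z]; linarith⟩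
  obtain ⟨u, hu, humin⟩ := Finset.exists_min_image (Z.filter (α < ·)) id
    ⟨i₁ b, by simp [Z]; linarith⟩
  obtain ⟨hlZ, hlα⟩ := Finset.mem_filter.1 hl
  obtain ⟨huZ, huα⟩ := Finset.mem_filter.1 hu
  obtain ⟨l, rfl⟩ := hZ l hlZ
  obtain ⟨u, rfl⟩ := hZ u huZ
  have nd₁ : ∀ c, i₁ l < c → c < i₁ u → (derivative (f.map i₁)).eval c ≠ 0 := by
    intro c c1 c2 c3
    rw [derivative_map] at c3
    have hcZ : c ∈ Z := by
      simp only [Z, Finset.mem_union, Multiset.mem_toFinset, mem_roots hd₁, IsRoot.def]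
      exact Or.inl c3
    obtain ⟨e, rfl⟩ := d₁ c c3
    rcases lt_or_gt_of_ne (hαE e) with h | h
    · exact (hlmax _ (Finset.mem_filter.2 ⟨hcZ, h⟩)).not_gt c1
    · exact (humin _ (Finset.mem_filter.2 ⟨hcZ, h⟩)).not_gt c2
  have nd₂ : ∀ c, i₂ l < c → c < i₂ u → (derivative (f.map i₂)).eval c ≠ 0 := by
    intro c c1 c2 c3
    rw [derivative_map] at c3
    obtain ⟨e, rfl⟩ := d₂ c c3
    rw [← lt_iff_of_sign hs] at c1 c2
    refine nd₁ _ c1 c2 ?_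
    rw [ev₂, map_eq_zero] at c3
    rw [derivative_map, ev₁, c3, map_zero]
  have neg_iff : ∀ x y : E, (f.map i₁).eval (i₁ x) * (f.map i₁).eval (i₁ y) < 0 →
      (f.map i₂).eval (i₂ x) * (f.map i₂).eval (i₂ y) < 0 := by
    intro x y h
    have := lt_iff_of_sign hs (f.eval x * f.eval y) 0
    simp only [map_mul, map_zero] at this
    rw [ev₁, ev₁] at h
    rw [ev₂, ev₂]
    exact this.1 h
  have hlu : i₂ l < i₂ u := (lt_iff_of_sign hs _ _).1 (hlα.trans huα)
  obtain ⟨β, hβl, hβu, hβ⟩ := h₂.exists_root_Ioo hlu.le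
    (neg_iff l u (h₁.eval_mul_eval_neg_of_root nd₁ hlα huα hα))
  have uniq : ∀ γ, i₂ l ≤ γ → γ ≤ i₂ u → (f.map i₂).eval γ = 0 → γ = β := fun γ g1 g2 g3 =>
    h₂.eq_of_eval_eq nd₂ g1 g2 hβl.le hβu.le (by rw [g3, hβ])
  have hlt : ∀ e, i₁ e < α → i₂ e < β := by
    intro e he
    rcases le_or_gt (i₁ e) (i₁ l) with h | h
    · exact ((le_iff_of_sign hs _ _).1 h).trans_lt hβl
    · have := neg_iff e u (h₁.eval_mul_eval_neg_of_root
        (fun c c1 c2 => nd₁ c (h.trans c1) c2) he huα hα)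
      obtain ⟨γ, g1, g2, g3⟩ := h₂.exists_root_Ioo
        ((lt_iff_of_sign hs _ _).1 (he.trans huα)).le this
      rwa [← uniq γ (((lt_iff_of_sign hs _ _).1 h).trans g1).le g2.le g3]
  have hgt : ∀ e, α < i₁ e → β < i₂ e := by
    intro e he
    rcases le_or_gt (i₁ u) (i₁ e) with h | h
    · exact hβu.trans_le ((le_iff_of_sign hs _ _).1 h)
    · have := neg_iff l e (h₁.eval_mul_eval_neg_of_root
        (fun c c1 c2 => nd₁ c c1 (c2.trans h)) hlα he hα)
      obtain ⟨γ, g1, g2, g3⟩ := h₂.exists_root_Ioo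
        ((lt_iff_of_sign hs _ _).1 (hlα.trans he)).le this
      rwa [← uniq γ g1.le (g2.trans ((lt_iff_of_sign hs _ _).1 h)).le g3]
  obtain ⟨e, he, -⟩ := hmax α β (by
    intro g
    have e₁ : (g.map i₁).eval α = ((g %ₘ f).map i₁).eval α := by
      conv_lhs => rw [← modByMonic_add_div g f]
      simp [hα]
    have e₂ : (g.map i₂).eval β = ((g %ₘ f).map i₂).eval β := by
      conv_lhs => rw [← modByMonic_add_div g f]
      simp [hβ]
    rw [e₁, e₂]
    by_cases hr : g %ₘ f = 0
    · simp [hr]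
    · obtain ⟨r₁, r₂⟩ := ih _ hr (natDegree_modByMonic_lt g hf (by rintro rfl; simp at hf0))
      exact eval_map_pos_iff_of_cut h₁ h₂ hs hαE hlt hgt hr r₁ r₂)
  exact hαE e he

theorem rootsIn_of_maximal (h₁ : PolyIVT R₁) (h₂ : PolyIVT R₂)
    (hs : ∀ e, 0 < i₁ e ↔ 0 < i₂ e)
    (hmax : ∀ α β, (∀ g : E[X], 0 < (g.map i₁).eval α ↔ 0 < (g.map i₂).eval β) →
      ∃ e, i₁ e = α ∧ i₂ e = β) (f : E[X]) (hf : f ≠ 0) : RootsIn i₁ f ∧ RootsIn i₂ f := by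
  induction hd : f.natDegree using Nat.strong_induction_on generalizing f with
  | _ d ih =>
    subst hd
    have hm := monic_mul_leadingCoeff_inv hf
    have hlc : f.leadingCoeff⁻¹ ≠ 0 := inv_ne_zero (leadingCoeff_ne_zero.2 hf)
    have hdeg : (f * C f.leadingCoeff⁻¹).natDegree = f.natDegree := natDegree_mul_C hlc
    have ih' : ∀ g : E[X], g ≠ 0 → g.natDegree < (f * C f.leadingCoeff⁻¹).natDegree →
        RootsIn i₁ g ∧ RootsIn i₂ g := fun g hg hlt => ih _ (hdeg ▸ hlt) g hg rfl
    have a₁ := rootsIn_of_natDegree_lt h₁ h₂ hs hmax hm ih'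
    have a₂ := rootsIn_of_natDegree_lt h₂ h₁ (fun e => (hs e).symm)
      (fun α β h => (hmax β α fun g => (h g).symm).imp fun _ he => he.symm) hm
      (fun g hg hlt => (ih' g hg hlt).symm)
    exact ⟨fun x hx => a₁ x (by simp [hx]), fun x hx => a₂ x (by simp [hx])⟩

/-- Countable cuts are realized. -/
def CountablySaturated (R : Type*) [LinearOrder R] : Prop :=
  ∀ A B : Set R, A.Countable → B.Countable → (∀ a ∈ A, ∀ b ∈ B, a < b) →
    ∃ x, (∀ a ∈ A, a < x) ∧ ∀ b ∈ B, x < b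

theorem surjective_of_maximal (h₁ : PolyIVT R₁) (h₂ : PolyIVT R₂) [Countable E]
    (hsat : CountablySaturated R₂) (hs : ∀ e, 0 < i₁ e ↔ 0 < i₂ e)
    (hmax : ∀ α β, (∀ g : E[X], 0 < (g.map i₁).eval α ↔ 0 < (g.map i₂).eval β) →
      ∃ e, i₁ e = α ∧ i₂ e = β) : Function.Surjective i₁ := by
  intro α
  by_contra! hα
  obtain ⟨β, hlt, hgt⟩ := hsat (i₂ '' {e | i₁ e < α}) (i₂ '' {e | α < i₁ e})
    ((Set.to_countable _).image _) ((Set.to_countable _).image _) (by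
      rintro _ ⟨a, ha, rfl⟩ _ ⟨b, hb, rfl⟩
      exact (lt_iff_of_sign hs _ _).1 (lt_trans ha hb))
  obtain ⟨e, he, -⟩ := hmax α β fun g => by
    by_cases hg : g = 0
    · simp [hg]
    obtain ⟨r₁, r₂⟩ := rootsIn_of_maximal h₁ h₂ hs hmax g hg
    exact eval_map_pos_iff_of_cut h₁ h₂ hs hα (fun e he => hlt _ ⟨e, he, rfl⟩)
      (fun e he => hgt _ ⟨e, he, rfl⟩) hg r₁ r₂
  exact hα e he

/-- Sign agreement of the two coordinates on a subring of a product. -/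
def SignAgree (Γ : Subring (R₁ × R₂)) : Prop := ∀ z ∈ Γ, 0 < z.1 ↔ 0 < z.2

omit [IsStrictOrderedRing R₁] [IsStrictOrderedRing R₂] in
theorem exists_maximal_signAgree {Γ₀ : Subring (R₁ × R₂)} (h₀ : SignAgree Γ₀) :
    ∃ Γ, Γ₀ ≤ Γ ∧ Maximal SignAgree Γ := by
  refine zorn_le_nonempty₀ {Γ | SignAgree Γ} (fun c hc hchain y hy => ?_) Γ₀ h₀
  refine ⟨sSup c, fun z hz => ?_, fun z hz => le_sSup hz⟩
  obtain ⟨Γ, hΓ, hzΓ⟩ := (Subring.mem_sSup_of_directedOn ⟨y, hy⟩ hchain.directedOn).1 hz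
  exact hc hΓ z hzΓ

theorem SignAgree.eq_zero_iff {Γ : Subring (R₁ × R₂)} (h : SignAgree Γ) {z : R₁ × R₂}
    (hz : z ∈ Γ) : z.1 = 0 ↔ z.2 = 0 := by
  have h1 := h z hz
  have h2 := h (-z) (neg_mem hz)
  simp only [Prod.fst_neg, Prod.snd_neg, Left.neg_pos_iff] at h2
  constructor
  · intro h0
    exact le_antisymm (not_lt.1 fun h => (h1.2 h).ne' h0) (not_lt.1 fun h => (h2.2 h).ne h0)
  · intro h0
    exact le_antisymm (not_lt.1 fun h => (h1.1 h).ne' h0) (not_lt.1 fun h => (h2.1 h).ne h0)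

/-- The pairs that become members of `Γ` after multiplication by a nonzero member. -/
def fractionSubring (Γ : Subring (R₁ × R₂)) : Subring (R₁ × R₂) where
  carrier := {z | ∃ b ∈ Γ, b.1 ≠ 0 ∧ z * b ∈ Γ}
  mul_mem' := by
    rintro x y ⟨b, hb, hb0, hxb⟩ ⟨c, hc, hc0, hyc⟩
    refine ⟨b * c, mul_mem hb hc, mul_ne_zero hb0 hc0, ?_⟩
    rw [mul_mul_mul_comm]
    exact mul_mem hxb hyc
  one_mem' := ⟨1, one_mem _, one_ne_zero, by simp⟩
  add_mem' := by
    rintro x y ⟨b, hb, hb0, hxb⟩ ⟨c, hc, hc0, hyc⟩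
    refine ⟨b * c, mul_mem hb hc, mul_ne_zero hb0 hc0, ?_⟩
    have : (x + y) * (b * c) = (x * b) * c + (y * c) * b := by ring
    rw [this]
    exact add_mem (mul_mem hxb hc) (mul_mem hyc hb)
  zero_mem' := ⟨1, one_mem _, one_ne_zero, by simp⟩
  neg_mem' := by
    rintro x ⟨b, hb, hb0, hxb⟩
    exact ⟨b, hb, hb0, by rw [neg_mul]; exact neg_mem hxb⟩

theorem SignAgree.fractionSubring {Γ : Subring (R₁ × R₂)} (h : SignAgree Γ) :
    SignAgree (fractionSubring Γ) := by
  rintro z ⟨b, hb, hb0, hzb⟩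
  have hb2 : b.2 ≠ 0 := fun h0 => hb0 ((h.eq_zero_iff hb).2 h0)
  have := h (z * b * b) (mul_mem hzb hb)
  have p1 : 0 < b.1 * b.1 := mul_self_pos.2 hb0
  have p2 : 0 < b.2 * b.2 := mul_self_pos.2 hb2
  simp only [Prod.fst_mul, Prod.snd_mul, mul_assoc] at this
  rwa [mul_pos_iff_of_pos_right p1, mul_pos_iff_of_pos_right p2] at this

/-- An order embedding of a subfield extends to a countable field with the intermediate value
property, if the target is countably saturated. -/
theorem exists_ringHom_extension (h₁ : PolyIVT R₁) (h₂ : PolyIVT R₂) [Countable R₁]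
    (hsat : CountablySaturated R₂) {k : Type*} [Field k] (j₁ : k →+* R₁) (j₂ : k →+* R₂)
    (hj : ∀ c, 0 < j₁ c ↔ 0 < j₂ c) : ∃ Φ : R₁ →+* R₂, ∀ c, Φ (j₁ c) = j₂ c := by
  obtain ⟨Γ, hΓ₀, hΓ, hmax⟩ := exists_maximal_signAgree (Γ₀ := (j₁.prod j₂).range) (by
    rintro _ ⟨c, rfl⟩; exact hj c)
  have hfield : IsField Γ := by
    refine ⟨⟨0, 1, zero_ne_one⟩, fun a b => mul_comm a b, ?_⟩
    rintro ⟨z, hz⟩ hz0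
    have hz1 : z.1 ≠ 0 := fun h0 => hz0 (Subtype.ext (Prod.ext h0 ((hΓ.eq_zero_iff hz).1 h0)))
    have hz2 : z.2 ≠ 0 := fun h0 => hz1 ((hΓ.eq_zero_iff hz).2 h0)
    have hw : ((z.1⁻¹, z.2⁻¹) : R₁ × R₂) * z = 1 :=
      Prod.ext (inv_mul_cancel₀ hz1) (inv_mul_cancel₀ hz2)
    have hle : Γ ≤ fractionSubring Γ := fun y hy => ⟨1, one_mem _, one_ne_zero, by simpa using hy⟩
    have : ((z.1⁻¹, z.2⁻¹) : R₁ × R₂) ∈ Γ :=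
      hmax hΓ.fractionSubring hle ⟨z, hz, hz1, by rw [hw]; exact one_mem _⟩
    exact ⟨⟨_, this⟩, Subtype.ext (by rw [mul_comm] at hw; exact hw)⟩
  let _ : Field Γ := hfield.toField
  let i₁ : Γ →+* R₁ := (RingHom.fst R₁ R₂).comp Γ.subtype
  let i₂ : Γ →+* R₂ := (RingHom.snd R₁ R₂).comp Γ.subtype
  have : Countable Γ := i₁.injective.countable
  have hsurj : Function.Surjective i₁ := by
    refine surjective_of_maximal (i₂ := i₂) h₁ h₂ hsat (fun e => hΓ e.1 e.2) fun α β hαβ => ?_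
    have hle : Γ ≤ (eval₂RingHom Γ.subtype (α, β)).range := fun z hz =>
      ⟨C ⟨z, hz⟩, by simp⟩
    have hmem : ((α, β) : R₁ × R₂) ∈ Γ := by
      refine hmax ?_ hle ⟨X, by simp⟩
      rintro _ ⟨g, rfl⟩
      have e1 : (eval₂ Γ.subtype (α, β) g).1 = (g.map i₁).eval α := by
        rw [eval_map]; exact hom_eval₂ g Γ.subtype (RingHom.fst R₁ R₂) (α, β)
      have e2 : (eval₂ Γ.subtype (α, β) g).2 = (g.map i₂).eval β := by
        rw [eval_map]; exact hom_eval₂ g Γ.subtype (RingHom.snd R₁ R₂) (α, β)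
      have := hαβ g
      rw [← e1, ← e2] at this
      exact this
    exact ⟨⟨_, hmem⟩, rfl, rfl⟩
  let eqv := RingEquiv.ofBijective i₁ ⟨i₁.injective, hsurj⟩
  refine ⟨i₂.comp (eqv.symm : R₁ →+* Γ), fun c => ?_⟩
  have hc : eqv.symm (j₁ c) = ⟨(j₁ c, j₂ c), hΓ₀ ⟨c, rfl⟩⟩ := by
    rw [RingEquiv.symm_apply_eq]; rfl
  change i₂ (eqv.symm (j₁ c)) = _
  rw [hc]; rfl

end PartialIsomorphism

section Transfer

open Polynomial Filter

theorem polyIVT_real : PolyIVT ℝ := by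
  intro p a b hab h
  have hc : ContinuousOn (fun x => p.eval x) (Set.uIcc a b) := p.continuous.continuousOn
  have h0 : (0 : ℝ) ∈ Set.uIcc (p.eval a) (p.eval b) := by
    rw [Set.mem_uIcc]
    rcases mul_nonpos_iff.1 h with ⟨h1, h2⟩ | ⟨h1, h2⟩
    · exact Or.inr ⟨h2, h1⟩
    · exact Or.inl ⟨h1, h2⟩
  obtain ⟨c, hc1, hc2⟩ := intermediate_value_uIcc hc h0
  rw [Set.uIcc_of_le hab] at hc1
  exact ⟨c, hc1.1, hc1.2, hc2⟩

/-- The ultrapower of the reals along a nonprincipal ultrafilter on the natural numbers. -/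
abbrev RealGerm : Type := Germ (hyperfilter ℕ : Filter ℕ) ℝ

theorem eval_coe_germ (P : (ℕ → ℝ)[X]) (x : ℕ → ℝ) :
    (P.map (Germ.coeRingHom (hyperfilter ℕ : Filter ℕ))).eval (x : RealGerm) =
      ((fun n => (P.map (Pi.evalRingHom (fun _ => ℝ) n)).eval (x n) : ℕ → ℝ) : RealGerm) := by
  have h1 : (P.map (Germ.coeRingHom (hyperfilter ℕ : Filter ℕ))).eval (x : RealGerm) =
      ((P.eval x : ℕ → ℝ) : RealGerm) := by
    rw [eval_map]
    exact eval₂_at_apply (Germ.coeRingHom (hyperfilter ℕ : Filter ℕ)) x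
  rw [h1]
  congr 1
  funext n
  rw [eval_map]
  exact (eval₂_at_apply (Pi.evalRingHom (fun _ => ℝ) n) x).symm

theorem polyIVT_realGerm : PolyIVT RealGerm := by
  intro p a b hab h
  obtain ⟨P, rfl⟩ := Polynomial.map_surjective (Germ.coeRingHom (hyperfilter ℕ : Filter ℕ))
    (fun x => Germ.inductionOn x fun f => ⟨f, rfl⟩) p
  induction a using Germ.inductionOn with | _ a
  induction b using Germ.inductionOn with | _ b
  rw [eval_coe_germ, eval_coe_germ, ← Germ.coe_mul] at h
  have h' := Germ.coe_le.1 h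
  have hab' := Germ.coe_le.1 hab
  choose! c hc using fun n (hn : a n ≤ b n ∧ (P.map (Pi.evalRingHom (fun _ => ℝ) n)).eval (a n) *
    (P.map (Pi.evalRingHom (fun _ => ℝ) n)).eval (b n) ≤ 0) => polyIVT_real _ _ _ hn.1 hn.2
  refine ⟨(c : RealGerm), Germ.coe_le.2 ?_, Germ.coe_le.2 ?_, ?_⟩
  · filter_upwards [h', hab'] with n h1 h2 using (hc n ⟨h2, h1⟩).1
  · filter_upwards [h', hab'] with n h1 h2 using (hc n ⟨h2, h1⟩).2.1
  · rw [eval_coe_germ]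
    refine Germ.coe_eq.2 ?_
    filter_upwards [h', hab'] with n h1 h2 using (hc n ⟨h2, h1⟩).2.2

theorem exists_diagonal_sequence (c : ℕ → ℕ → ℝ → Prop)
    (h : ∀ K, ∀ᶠ m in (hyperfilter ℕ : Filter ℕ), ∃ x, ∀ k < K, c k m x) :
    ∃ x : ℕ → ℝ, ∀ k, ∀ᶠ m in (hyperfilter ℕ : Filter ℕ), c k m (x m) := by
  classical
  let N : ℕ → ℕ := fun m => Nat.findGreatest (fun K => ∃ x, ∀ k < K, c k m x) m
  have hN : ∀ m, ∃ x, ∀ k < N m, c k m x := fun m =>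
    Nat.findGreatest_spec (P := fun K => ∃ x, ∀ k < K, c k m x) (Nat.zero_le m) ⟨0, by simp⟩
  choose x hx using hN
  refine ⟨x, fun k => ?_⟩
  filter_upwards [h (k + 1), Nat.hyperfilter_le_atTop (eventually_ge_atTop (k + 1))] with m h1 h2
  exact hx m k (Nat.lt_of_succ_le (Nat.le_findGreatest h2 h1))

theorem countablySaturated_realGerm : CountablySaturated RealGerm := by
  classical
  intro A B hA hB hAB
  have : Countable A := hA
  have : Countable B := hB
  obtain ⟨e, he⟩ := exists_injective_nat (A ⊕ B)
  have hrep : ∀ z : RealGerm, ∃ f : ℕ → ℝ, (f : RealGerm) = z := fun z =>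
    Germ.inductionOn z fun f => ⟨f, rfl⟩
  choose rep hrep using hrep
  obtain ⟨x, hx⟩ := exists_diagonal_sequence
    (fun k m x => (∀ a : A, e (Sum.inl a) = k → rep a m < x) ∧
      ∀ b : B, e (Sum.inr b) = k → x < rep b m) (fun K => by
    have hfA : {a : A | e (Sum.inl a) < K}.Finite :=
      (Set.finite_lt_nat K).preimage ((he.comp Sum.inl_injective).injOn)
    have hfB : {b : B | e (Sum.inr b) < K}.Finite :=
      (Set.finite_lt_nat K).preimage ((he.comp Sum.inr_injective).injOn)
    have hev : ∀ᶠ m in (hyperfilter ℕ : Filter ℕ), ∀ a ∈ {a : A | e (Sum.inl a) < K},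
        ∀ b ∈ {b : B | e (Sum.inr b) < K}, rep a m < rep b m := by
      rw [eventually_all_finite hfA]
      intro a _
      rw [eventually_all_finite hfB]
      intro b _
      have := hAB a a.2 b b.2
      rw [← hrep a, ← hrep b, Germ.coe_lt] at this
      exact this
    filter_upwards [hev] with m hm
    obtain ⟨x, hx1, hx2⟩ := Order.exists_between_finsets
      (hfA.toFinset.image fun a : A => rep a m) (hfB.toFinset.image fun b : B => rep b m) (by
        intro y hy z hz
        obtain ⟨a, ha, rfl⟩ := Finset.mem_image.1 hy
        obtain ⟨b, hb, rfl⟩ := Finset.mem_image.1 hz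
        exact hm a (hfA.mem_toFinset.1 ha) b (hfB.mem_toFinset.1 hb))
    refine ⟨x, fun k hk => ⟨fun a ha => hx1 _ (Finset.mem_image.2 ⟨a, ?_, rfl⟩),
      fun b hb => hx2 _ (Finset.mem_image.2 ⟨b, ?_, rfl⟩)⟩⟩
    · rw [hfA.mem_toFinset]; exact lt_of_eq_of_lt ha hk
    · rw [hfB.mem_toFinset]; exact lt_of_eq_of_lt hb hk)
  refine ⟨(x : RealGerm), fun a ha => ?_, fun b hb => ?_⟩
  · rw [← hrep a, Germ.coe_lt]
    filter_upwards [hx (e (Sum.inl ⟨a, ha⟩))] with m hm using hm.1 ⟨a, ha⟩ rfl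
  · rw [← hrep b, Germ.coe_lt]
    filter_upwards [hx (e (Sum.inr ⟨b, hb⟩))] with m hm using hm.2 ⟨b, hb⟩ rfl

theorem Subfield.countable_closure {K : Type*} [Field K] {s : Set K} (hs : s.Countable) :
    Countable (Subfield.closure s) := by
  rw [← Cardinal.mk_le_aleph0_iff]
  exact (Subfield.cardinalMk_closure_le_max s).trans
    (max_le (Cardinal.mk_le_aleph0_iff.2 hs) le_rfl)

/-- A finite system of polynomial equations and an inequation with real coefficients that has a
solution in an ordered extension field with the intermediate value property has a real solution. -/
theorem exists_real_point {R : Type*} [Field R] [LinearOrder R] [IsStrictOrderedRing R]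
    (hR : PolyIVT R) (ρ : ℝ →+* R) {σ : Type*} [Countable σ] (E : Set (MvPolynomial σ ℝ))
    (hE : E.Finite) (q : MvPolynomial σ ℝ) (x : σ → R)
    (hx : ∀ p ∈ E, MvPolynomial.eval₂ ρ x p = 0) (hq : MvPolynomial.eval₂ ρ x q ≠ 0) :
    ∃ y : σ → ℝ, (∀ p ∈ E, MvPolynomial.eval y p = 0) ∧ MvPolynomial.eval y q ≠ 0 := by
  let cs : Set ℝ := ⋃ p ∈ insert q E, (p.coeffs : Set ℝ)
  have hcs : cs.Countable :=
    ((hE.insert q).biUnion fun p _ => p.coeffs.finite_toSet).countable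
  let k := Subfield.closure cs
  let K := Subfield.closure (ρ '' cs ∪ Set.range x)
  have hK : Countable K :=
    Subfield.countable_closure ((hcs.image _).union (Set.countable_range x))
  let L := algebraicClosure K R
  have hL : Countable L := by
    rw [← Cardinal.mk_le_aleph0_iff]
    exact (Algebra.IsAlgebraic.cardinalMk_le_max K L).trans
      (max_le (Cardinal.mk_le_aleph0_iff.2 hK) le_rfl)
  have hKL : ∀ z ∈ K, z ∈ L := fun z hz => L.algebraMap_mem ⟨z, hz⟩
  have hIVT : PolyIVT L := by
    intro p a b hab h
    by_cases hp : p = 0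
    · exact ⟨a, le_rfl, hab, by simp [hp]⟩
    have ev : ∀ z : L, (p.map (algebraMap L R)).eval (z : R) = (p.eval z : L) := fun z => by
      rw [eval_map]; exact eval₂_at_apply (algebraMap L R) z
    obtain ⟨c, c1, c2, c3⟩ := hR (p.map (algebraMap L R)) a b hab (by
      rw [ev, ev]; exact h)
    have hcL : IsAlgebraic L c := ⟨p, hp, by rw [aeval_def, ← eval_map]; exact c3⟩
    have hc : c ∈ L := mem_algebraicClosure_iff.2 (hcL.restrictScalars K)
    refine ⟨⟨c, hc⟩, c1, c2, ?_⟩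
    have := ev ⟨c, hc⟩
    rw [c3] at this
    exact Subtype.ext this.symm
  have hkK : ∀ c ∈ k, ρ c ∈ K := by
    intro c hc
    have : k ≤ K.comap ρ := Subfield.closure_le.2 fun c hc =>
      Subfield.subset_closure (Or.inl ⟨c, hc, rfl⟩)
    exact this hc
  let j₁ : k →+* L := (ρ.comp k.subtype).codRestrict L fun c => hKL _ (hkK c c.2)
  let j₂ : k →+* RealGerm :=
    ((Germ.coeRingHom (hyperfilter ℕ : Filter ℕ)).comp (Pi.constRingHom ℕ ℝ)).comp k.subtype
  have hρ : ∀ c : ℝ, 0 < ρ c ↔ 0 < c := by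
    have h1 : ∀ c : ℝ, 0 < c → 0 < ρ c := fun c hc => by
      have h2 : ρ c = ρ (Real.sqrt c) ^ 2 := by rw [← map_pow, Real.sq_sqrt hc.le]
      rw [h2]
      have : ρ (Real.sqrt c) ≠ 0 := by
        rw [Ne, map_eq_zero, Real.sqrt_eq_zero']; exact hc.not_ge
      positivity
    intro c
    refine ⟨fun h => ?_, h1 c⟩
    by_contra! hc
    rcases hc.eq_or_lt with rfl | hc
    · simp at h
    · have := h1 (-c) (by linarith)
      rw [map_neg] at this
      linarith
  obtain ⟨Φ, hΦ⟩ := exists_ringHom_extension hIVT polyIVT_realGerm countablySaturated_realGerm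
    j₁ j₂ (fun c => by
      have e1 : 0 < j₁ c ↔ 0 < ρ (c : ℝ) := Iff.rfl
      have e2 : 0 < j₂ c ↔ 0 < (c : ℝ) := by
        change 0 < ((fun _ => (c : ℝ) : ℕ → ℝ) : RealGerm) ↔ _
        rw [Germ.coe_pos]
        simp
      rw [e1, e2, hρ])
  have hxL : ∀ i, x i ∈ L := fun i => hKL _ (Subfield.subset_closure (Or.inr ⟨i, rfl⟩))
  have hrep : ∀ i, ∃ f : ℕ → ℝ, (f : RealGerm) = Φ ⟨x i, hxL i⟩ := fun i =>
    Germ.inductionOn (Φ ⟨x i, hxL i⟩) fun f => ⟨f, rfl⟩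
  choose y hy using hrep
  have key : ∀ p ∈ insert q E, (MvPolynomial.eval₂ ρ x p = 0 ↔
      ∀ᶠ n in (hyperfilter ℕ : Filter ℕ), MvPolynomial.eval (fun i => y i n) p = 0) := by
    intro p hp
    obtain ⟨p', rfl⟩ : p ∈ Set.range (MvPolynomial.map k.subtype) := by
      rw [MvPolynomial.mem_range_map_iff_coeffs_subset]
      intro c hc
      exact ⟨⟨c, Subfield.subset_closure (Set.mem_biUnion hp hc)⟩, rfl⟩
    have e1 : MvPolynomial.eval₂ ρ x (MvPolynomial.map k.subtype p') =
        algebraMap L R (MvPolynomial.eval₂ j₁ (fun i => (⟨x i, hxL i⟩ : L)) p') := by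
      rw [MvPolynomial.eval₂_map, MvPolynomial.hom_eval₂]
      rfl
    have e2 : Φ (MvPolynomial.eval₂ j₁ (fun i => (⟨x i, hxL i⟩ : L)) p') =
        Germ.coeRingHom (hyperfilter ℕ : Filter ℕ) (MvPolynomial.eval₂
          ((Pi.constRingHom ℕ ℝ).comp k.subtype) y p') := by
      rw [MvPolynomial.hom_eval₂, MvPolynomial.hom_eval₂]
      have : Φ.comp j₁ = (Germ.coeRingHom (hyperfilter ℕ : Filter ℕ)).comp
          ((Pi.constRingHom ℕ ℝ).comp k.subtype) := RingHom.ext hΦ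
      rw [this]
      congr 1
      funext i
      exact (hy i).symm
    have e3 : ∀ n, MvPolynomial.eval₂ ((Pi.constRingHom ℕ ℝ).comp k.subtype) y p' n =
        MvPolynomial.eval (fun i => y i n) (MvPolynomial.map k.subtype p') := by
      intro n
      rw [MvPolynomial.eval_map]
      exact MvPolynomial.hom_eval₂ p' _ (Pi.evalRingHom (fun _ => ℝ) n) y
    rw [e1, map_eq_zero, ← map_eq_zero Φ, e2]
    simp_rw [← e3]
    exact Germ.coe_eq
  have hqev : ∀ᶠ n in (hyperfilter ℕ : Filter ℕ),
      ¬ MvPolynomial.eval (fun i => y i n) q = 0 := by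
    rw [Ultrafilter.eventually_not, ← key q (Set.mem_insert _ _)]
    exact hq
  have hEev : ∀ᶠ n in (hyperfilter ℕ : Filter ℕ),
      ∀ p ∈ E, MvPolynomial.eval (fun i => y i n) p = 0 := by
    rw [eventually_all_finite hE]
    exact fun p hp => (key p (Set.mem_insert_of_mem _ hp)).1 (hx p hp)
  obtain ⟨n, h1, h2⟩ := (hEev.and hqev).exists
  exact ⟨fun i => y i n, h1, h2⟩

end Transfer

section PrimeCone

theorem exists_maximal_preordering {C : Type*} [CommRing C] (P : Subsemiring C) {f : C}
    (hf : ∀ k : ℕ, -f ^ (2 * k) ∉ P) :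
    ∃ Q : Subsemiring C, P ≤ Q ∧
      Maximal (fun Q : Subsemiring C => ∀ k : ℕ, -f ^ (2 * k) ∉ Q) Q := by
  refine zorn_le_nonempty₀ {Q : Subsemiring C | ∀ k : ℕ, -f ^ (2 * k) ∉ Q}
    (fun c hc hchain y hy => ?_) P hf
  refine ⟨sSup c, fun k hk => ?_, fun z hz => le_sSup hz⟩
  obtain ⟨Q, hQ, hzQ⟩ := (Subsemiring.mem_sSup_of_directedOn ⟨y, hy⟩ hchain.directedOn).1 hk
  exact hc hQ k hzQ

variable {C : Type*} [CommRing C] {Q : Subsemiring C} {f : C}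

theorem exists_eq_of_notMem_maximal (hsq : ∀ a, a * a ∈ Q)
    (hQ : Maximal (fun Q : Subsemiring C => ∀ k : ℕ, -f ^ (2 * k) ∉ Q) Q) {a : C} (ha : a ∉ Q) :
    ∃ k : ℕ, ∃ p ∈ Q, ∃ q ∈ Q, -f ^ (2 * k) = p + a * q := by
  let Q' : Subsemiring C :=
    { carrier := {x | ∃ p ∈ Q, ∃ q ∈ Q, x = p + a * q}
      mul_mem' := by
        rintro _ _ ⟨p, hp, q, hq, rfl⟩ ⟨p', hp', q', hq', rfl⟩
        exact ⟨p * p' + a * a * (q * q'),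
          add_mem (mul_mem hp hp') (mul_mem (hsq a) (mul_mem hq hq')),
          p * q' + q * p', add_mem (mul_mem hp hq') (mul_mem hq hp'), by ring⟩
      one_mem' := ⟨1, one_mem _, 0, zero_mem _, by ring⟩
      add_mem' := by
        rintro _ _ ⟨p, hp, q, hq, rfl⟩ ⟨p', hp', q', hq', rfl⟩
        exact ⟨p + p', add_mem hp hp', q + q', add_mem hq hq', by ring⟩
      zero_mem' := ⟨0, zero_mem _, 0, zero_mem _, by ring⟩ }
  have hle : Q ≤ Q' := fun x hx => ⟨x, hx, 0, zero_mem _, by ring⟩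
  by_contra! hcon
  have : Q' ≤ Q := hQ.2 (y := Q') (fun k ⟨p, hp, q, hq, h⟩ => hcon k p hp q hq h) hle
  exact ha (this ⟨0, zero_mem _, 1, one_mem _, by ring⟩)

theorem pow_mem_of_sq_mem (hsq : ∀ a, a * a ∈ Q) (k : ℕ) : f ^ (2 * k) ∈ Q := by
  rw [two_mul, pow_add]; exact hsq _

theorem mem_or_neg_mem_of_maximal (hsq : ∀ a, a * a ∈ Q)
    (hQ : Maximal (fun Q : Subsemiring C => ∀ k : ℕ, -f ^ (2 * k) ∉ Q) Q) (a : C) :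
    a ∈ Q ∨ -a ∈ Q := by
  by_contra! h
  obtain ⟨k, p, hp, q, hq, e⟩ := exists_eq_of_notMem_maximal hsq hQ h.1
  obtain ⟨l, p', hp', q', hq', e'⟩ := exists_eq_of_notMem_maximal hsq hQ h.2
  refine hQ.1 (k + l) ?_
  have : -f ^ (2 * (k + l)) =
      a * a * (q * q') + (f ^ (2 * k) * p' + p * f ^ (2 * l) + p * p') := by
    have h1 : a * q = -f ^ (2 * k) - p := by rw [e]; ring
    have h2 : a * q' = f ^ (2 * l) + p' := by linear_combination e'
    have h3 : f ^ (2 * (k + l)) = f ^ (2 * k) * f ^ (2 * l) := by ring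
    linear_combination (-(a * q')) * h1 + (f ^ (2 * k) + p) * h2 - h3
  rw [this]
  have h1 := pow_mem_of_sq_mem (f := f) hsq k
  have h2 := pow_mem_of_sq_mem (f := f) hsq l
  exact add_mem (mul_mem (hsq a) (mul_mem hq hq'))
    (add_mem (add_mem (mul_mem h1 hp') (mul_mem hp h2)) (mul_mem hp hp'))

/-- The support of a total preordering. -/
def coneSupport (Q : Subsemiring C) (htot : ∀ a, a ∈ Q ∨ -a ∈ Q) : Ideal C where
  carrier := {a | a ∈ Q ∧ -a ∈ Q}
  add_mem' := by
    rintro a b ⟨ha, ha'⟩ ⟨hb, hb'⟩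
    exact ⟨add_mem ha hb, by rw [neg_add]; exact add_mem ha' hb'⟩
  zero_mem' := ⟨zero_mem _, by rw [neg_zero]; exact zero_mem _⟩
  smul_mem' := by
    rintro c a ⟨ha, ha'⟩
    rcases htot c with hc | hc
    · exact ⟨mul_mem hc ha, by rw [smul_eq_mul, ← mul_neg]; exact mul_mem hc ha'⟩
    · refine ⟨?_, ?_⟩
      · rw [smul_eq_mul, ← neg_mul_neg]; exact mul_mem hc ha'
      · rw [smul_eq_mul, ← neg_mul]; exact mul_mem hc ha

theorem mem_coneSupport {htot : ∀ a, a ∈ Q ∨ -a ∈ Q} {a : C} :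
    a ∈ coneSupport Q htot ↔ a ∈ Q ∧ -a ∈ Q := Iff.rfl

theorem coneSupport_isPrime (hsq : ∀ a, a * a ∈ Q)
    (hQ : Maximal (fun Q : Subsemiring C => ∀ k : ℕ, -f ^ (2 * k) ∉ Q) Q) :
    (coneSupport Q (mem_or_neg_mem_of_maximal hsq hQ)).IsPrime := by
  set I := coneSupport Q (mem_or_neg_mem_of_maximal hsq hQ) with hI
  have aux : ∀ a b, a * b ∈ I → -a ∉ Q → -b ∉ Q → False := by
    intro a b hab ha hb
    obtain ⟨k, p, hp, q, hq, e⟩ := exists_eq_of_notMem_maximal hsq hQ ha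
    obtain ⟨l, p', hp', q', hq', e'⟩ := exists_eq_of_notMem_maximal hsq hQ hb
    refine hQ.1 (k + l) ?_
    have : -f ^ (2 * (k + l)) =
        -(a * b) * (q * q') + (f ^ (2 * k) * p' + p * f ^ (2 * l) + p * p') := by
      have h1 : a * q = f ^ (2 * k) + p := by linear_combination e
      have h2 : b * q' = f ^ (2 * l) + p' := by linear_combination e'
      have h3 : f ^ (2 * (k + l)) = f ^ (2 * k) * f ^ (2 * l) := by ring
      linear_combination (b * q') * h1 + (f ^ (2 * k) + p) * h2 - h3
    rw [this]
    have h1 := pow_mem_of_sq_mem (f := f) hsq k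
    have h2 := pow_mem_of_sq_mem (f := f) hsq l
    exact add_mem (mul_mem hab.2 (mul_mem hq hq'))
      (add_mem (add_mem (mul_mem h1 hp') (mul_mem hp h2)) (mul_mem hp hp'))
  refine ⟨fun h => ?_, fun {a b} hab => ?_⟩
  · have : (1 : C) ∈ I := by rw [h]; trivial
    exact hQ.1 0 (by simpa using this.2)
  · by_contra! hcon
    have key : ∀ a, a ∉ I → ∃ a', (a' = a ∨ a' = -a) ∧ -a' ∉ Q := by
      intro a ha
      by_cases h : -a ∈ Q
      · exact ⟨-a, Or.inr rfl, fun h' => ha ⟨by simpa using h', h⟩⟩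
      · exact ⟨a, Or.inl rfl, h⟩
    obtain ⟨a', ha', ha⟩ := key a hcon.1
    obtain ⟨b', hb', hb⟩ := key b hcon.2
    refine aux a' b' ?_ ha hb
    rcases ha' with rfl | rfl <;> rcases hb' with rfl | rfl <;> simpa using hab

end PrimeCone

section RealClosure

open Polynomial

variable {A Ω : Type*} [CommRing A] [Field Ω]

/-- Sums of squares of elements of `L` weighted by images of members of `Q`. -/
def sumCone (Q : Subsemiring A) (φ : A →+* Ω) (L : Subfield Ω) : Subsemiring Ω :=
  Submonoid.subsemiringClosure
    { carrier := {x | ∃ q ∈ Q, ∃ l ∈ L, x = φ q * l ^ 2}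
      mul_mem' := by
        rintro _ _ ⟨q, hq, l, hl, rfl⟩ ⟨q', hq', l', hl', rfl⟩
        exact ⟨q * q', mul_mem hq hq', l * l', mul_mem hl hl', by rw [map_mul]; ring⟩
      one_mem' := ⟨1, one_mem _, 1, one_mem _, by simp⟩ }

variable {Q : Subsemiring A} {φ : A →+* Ω}

theorem mem_sumCone {L : Subfield Ω} {q : A} (hq : q ∈ Q) {l : Ω} (hl : l ∈ L) :
    φ q * l ^ 2 ∈ sumCone Q φ L :=
  AddSubmonoid.subset_closure ⟨q, hq, l, hl, rfl⟩

theorem sumCone_induction {L : Subfield Ω} {p : Ω → Prop}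
    (mem : ∀ q ∈ Q, ∀ l ∈ L, p (φ q * l ^ 2)) (zero : p 0) (add : ∀ x y, p x → p y → p (x + y))
    {s : Ω} (hs : s ∈ sumCone Q φ L) : p s := by
  change s ∈ AddSubmonoid.closure _ at hs
  induction hs using AddSubmonoid.closure_induction with
  | mem x hx => obtain ⟨q, hq, l, hl, rfl⟩ := hx; exact mem q hq l hl
  | zero => exact zero
  | add x y _ _ hx hy => exact add x y hx hy

theorem sumCone_mono {L L' : Subfield Ω} (h : L ≤ L') : sumCone Q φ L ≤ sumCone Q φ L' :=
  fun _ hs => sumCone_induction (fun _ hq _ hl => mem_sumCone hq (h hl)) (zero_mem _)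
    (fun _ _ => add_mem) hs

theorem sq_mem_sumCone {L : Subfield Ω} {l : Ω} (hl : l ∈ L) : l ^ 2 ∈ sumCone Q φ L := by
  simpa using mem_sumCone (φ := φ) (one_mem Q) hl

theorem exists_maximal_subfield {L₀ : Subfield Ω} (h₀ : -1 ∉ sumCone Q φ L₀) :
    ∃ L, L₀ ≤ L ∧ Maximal (fun L => -1 ∉ sumCone Q φ L) L := by
  refine zorn_le_nonempty₀ {L | -1 ∉ sumCone Q φ L} (fun c hc hchain y hy => ?_) L₀ h₀
  refine ⟨sSup c, fun h => ?_, fun z hz => le_sSup hz⟩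
  obtain ⟨L, hL, hL'⟩ : ∃ L ∈ c, (-1 : Ω) ∈ sumCone Q φ L := by
    refine sumCone_induction (p := fun x => ∃ L ∈ c, x ∈ sumCone Q φ L) ?_
      ⟨y, hy, zero_mem _⟩ ?_ h
    · intro q hq l hl
      obtain ⟨L, hL, hlL⟩ := (Subfield.mem_sSup_of_directedOn ⟨y, hy⟩ hchain.directedOn).1 hl
      exact ⟨L, hL, mem_sumCone hq hlL⟩
    · rintro a b ⟨L, hL, ha⟩ ⟨L', hL', hb⟩
      obtain ⟨M, hM, h1, h2⟩ := hchain.directedOn L hL L' hL'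
      exact ⟨M, hM, add_mem (sumCone_mono h1 ha) (sumCone_mono h2 hb)⟩
  exact absurd hL' (hc hL)

/-- Irreducible polynomials are linear or divide `1 + G` with `G` a sum of squares. -/
def HasRealFactors (R : Type*) [Field R] : Prop :=
  ∀ p : R[X], Irreducible p → p.natDegree = 1 ∨ ∃ G, IsSumSq G ∧ p ∣ 1 + G

section Maximal

variable {R : Subfield Ω} (hR : Maximal (fun L => -1 ∉ sumCone Q φ L) R) (hφ : ∀ c, φ c ∈ R)
include hR

theorem neg_one_mem_sumCone_of_notMem {α : Ω} (hα : IsAlgebraic R α) (hαR : α ∉ R) :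
    ∃ L : Subfield Ω, -1 ∈ sumCone Q φ L ∧ ∀ x ∈ L, ∃ g : R[X], aeval α g = x := by
  let L := (IntermediateField.adjoin R {α}).toSubfield
  refine ⟨L, ?_, fun x hx => ?_⟩
  · by_contra hL
    have hle : R ≤ L := fun x hx => (IntermediateField.adjoin R {α}).algebraMap_mem ⟨x, hx⟩
    exact hαR (hR.2 (y := L) hL hle (IntermediateField.mem_adjoin_simple_self R α))
  · have h1 : x ∈ (IntermediateField.adjoin R {α}).toSubalgebra := hx
    rw [IntermediateField.adjoin_simple_toSubalgebra_of_isAlgebraic hα,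
      Algebra.adjoin_singleton_eq_range_aeval] at h1
    exact h1

theorem eq_zero_of_mem_of_neg_mem_sumCone {a : Ω} (haR : a ∈ R) (h1 : a ∈ sumCone Q φ R)
    (h2 : -a ∈ sumCone Q φ R) : a = 0 := by
  by_contra h0
  refine hR.1 ?_
  have : (-1 : Ω) = a * -a * (a⁻¹) ^ 2 := by field_simp
  rw [this]
  exact mul_mem (mul_mem h1 h2) (sq_mem_sumCone (R.inv_mem haR))

omit hR in
include hφ in
theorem sumCone_le : ∀ s ∈ sumCone Q φ R, s ∈ R := fun _ hs =>
  sumCone_induction (p := fun s => s ∈ R)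
    (fun q _ _ hl => mul_mem (hφ q) (pow_mem hl 2)) (zero_mem _) (fun _ _ => add_mem) hs

include hφ in
theorem neg_mem_sumCone_or_exists_sq [IsAlgClosed Ω] {a : Ω} (haR : a ∈ R) :
    -a ∈ sumCone Q φ R ∨ ∃ r ∈ R, r ^ 2 = a := by
  obtain ⟨α, hα⟩ := IsAlgClosed.exists_pow_nat_eq a (n := 2) two_pos
  by_cases hαR : α ∈ R
  · exact Or.inr ⟨α, hαR, hα⟩
  left
  have halg : IsAlgebraic R α :=
    ⟨X ^ 2 - C (⟨a, haR⟩ : R), (monic_X_pow_sub_C _ two_ne_zero).ne_zero, by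
      have : algebraMap R Ω ⟨a, haR⟩ = a := rfl
      simp [hα, this]⟩
  obtain ⟨L, hL, hrep⟩ := neg_one_mem_sumCone_of_notMem hR halg hαR
  have hlin : ∀ g : R[X], ∃ u ∈ R, ∃ v ∈ R, aeval α g = u + v * α := by
    intro g
    induction g using Polynomial.induction_on' with
    | add p q hp hq =>
      obtain ⟨u, hu, v, hv, e⟩ := hp
      obtain ⟨u', hu', v', hv', e'⟩ := hq
      exact ⟨u + u', add_mem hu hu', v + v', add_mem hv hv', by rw [map_add, e, e']; ring⟩
    | monomial n c =>
      have hc : algebraMap R Ω c = (c : Ω) := rfl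
      rw [aeval_monomial, hc]
      obtain ⟨k, rfl | rfl⟩ := Nat.even_or_odd' n
      · exact ⟨c * a ^ k, mul_mem c.2 (pow_mem haR k), 0, zero_mem _, by
          rw [pow_mul, hα]; ring⟩
      · exact ⟨0, zero_mem _, c * a ^ k, mul_mem c.2 (pow_mem haR k), by
          rw [pow_succ, pow_mul, hα]; ring⟩
  obtain ⟨x, hx, y, hy, z, hz, e⟩ : ∃ x ∈ sumCone Q φ R, ∃ y ∈ sumCone Q φ R, ∃ z ∈ R,
      (-1 : Ω) = x + a * y + z * α := by
    refine sumCone_induction (p := fun s => ∃ x ∈ sumCone Q φ R, ∃ y ∈ sumCone Q φ R, ∃ z ∈ R,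
      s = x + a * y + z * α) ?_ ⟨0, zero_mem _, 0, zero_mem _, 0, zero_mem _, by ring⟩ ?_ hL
    · intro q hq l hl
      obtain ⟨g, rfl⟩ := hrep l hl
      obtain ⟨u, hu, v, hv, e⟩ := hlin g
      refine ⟨φ q * u ^ 2, mem_sumCone hq hu, φ q * v ^ 2, mem_sumCone hq hv,
        2 * φ q * u * v, mul_mem (mul_mem (mul_mem (ofNat_mem R 2) (hφ q)) hu) hv, ?_⟩
      rw [e, ← hα]; ring
    · rintro s t ⟨x, hx, y, hy, z, hz, rfl⟩ ⟨x', hx', y', hy', z', hz', rfl⟩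
      exact ⟨x + x', add_mem hx hx', y + y', add_mem hy hy', z + z', add_mem hz hz', by ring⟩
  have hxR := sumCone_le hφ x hx
  have hyR := sumCone_le hφ y hy
  have hz0 : z = 0 := by
    by_contra hz0
    apply hαR
    have : α = (-1 - x - a * y) * z⁻¹ := by
      rw [eq_mul_inv_iff_mul_eq₀ hz0, e]; ring
    rw [this]
    exact mul_mem (sub_mem (sub_mem (neg_mem (one_mem _)) hxR) (mul_mem haR hyR)) (R.inv_mem hz)
  rw [hz0, zero_mul, add_zero] at e
  have hy0 : y ≠ 0 := by
    rintro rfl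
    rw [mul_zero, add_zero] at e
    exact hR.1 (e ▸ hx)
  have : -a = (1 + x) * y * (y⁻¹) ^ 2 := by
    field_simp
    linear_combination e
  rw [this]
  exact mul_mem (mul_mem (add_mem (one_mem _) hx) hy) (sq_mem_sumCone (R.inv_mem hyR))

include hφ in
theorem exists_sq_eq_of_mem_sumCone [IsAlgClosed Ω] {a : Ω} (ha : a ∈ sumCone Q φ R) :
    ∃ r ∈ R, r ^ 2 = a := by
  have haR := sumCone_le hφ a ha
  rcases neg_mem_sumCone_or_exists_sq hR hφ haR with h | h
  · exact ⟨0, zero_mem _, by rw [eq_zero_of_mem_of_neg_mem_sumCone hR haR ha h]; ring⟩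
  · exact h

include hφ in
theorem hasRealFactors_of_maximal [IsAlgClosed Ω] : HasRealFactors R := by
  intro p hp
  obtain ⟨α, hα⟩ := IsAlgClosed.exists_aeval_eq_zero Ω p hp.degree_pos.ne'
  by_cases hαR : α ∈ R
  · left
    have hroot : p.eval ⟨α, hαR⟩ = 0 := by
      have : aeval (algebraMap R Ω ⟨α, hαR⟩) p = 0 := hα
      rwa [aeval_algebraMap_apply, coe_aeval_eq_eval, map_eq_zero] at this
    exact natDegree_eq_of_degree_eq_some (degree_eq_one_of_irreducible_of_root hp hroot)
  · right
    obtain ⟨L, hL, hrep⟩ := neg_one_mem_sumCone_of_notMem hR ⟨p, hp.ne_zero, hα⟩ hαR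
    obtain ⟨G, hG, e⟩ : ∃ G : R[X], IsSumSq G ∧ aeval α G = -1 := by
      refine sumCone_induction (p := fun s => ∃ G : R[X], IsSumSq G ∧ aeval α G = s) ?_
        ⟨0, .zero, by simp⟩ ?_ hL
      · intro q hq l hl
        obtain ⟨g, rfl⟩ := hrep l hl
        obtain ⟨r, hr, e⟩ := exists_sq_eq_of_mem_sumCone hR hφ
          (mem_sumCone (φ := φ) hq (one_mem R))
        refine ⟨(C (⟨r, hr⟩ : R) * g) * (C (⟨r, hr⟩ : R) * g), .mul_self _, ?_⟩
        have h1 : algebraMap R Ω ⟨r, hr⟩ = r := rfl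
        have h2 : φ q = r ^ 2 := by rw [e]; ring
        rw [map_mul, map_mul, aeval_C, h1, h2]; ring
      · rintro _ _ ⟨G, hG, rfl⟩ ⟨G', hG', rfl⟩
        exact ⟨G + G', hG.add hG', by simp⟩
    refine ⟨G, hG, ?_⟩
    have hmin := minpoly.eq_of_irreducible hp hα
    have hd : minpoly R α ∣ 1 + G := minpoly.dvd R α (by simp [e])
    rw [← hmin] at hd
    exact (dvd_mul_right p _).trans hd

end Maximal

end RealClosure

section RealClosedOrder

open Polynomial

/-- A subsemiring that is a total cone comes from a linear order. -/
theorem exists_linearOrder_of_cone {R : Type*} [Field R] (N : Subsemiring R)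
    (hanti : ∀ a ∈ N, -a ∈ N → a = 0) (htot : ∀ a, a ∈ N ∨ -a ∈ N) :
    ∃ _ : LinearOrder R, IsStrictOrderedRing R ∧ ∀ a : R, 0 ≤ a ↔ a ∈ N := by
  classical
  let K : RingCone R := { N with eq_zero_of_mem_of_neg_mem' := fun {a} => hanti a }
  have : HasMemOrNegMem K := ⟨htot⟩
  let o : LinearOrder R := LinearOrder.mkOfAddGroupCone K
  have h : @IsOrderedRing R _ o.toPartialOrder := IsOrderedRing.mkOfCone K
  refine ⟨o, IsOrderedRing.toIsStrictOrderedRing R, fun a => ?_⟩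
  change a - 0 ∈ N ↔ a ∈ N
  rw [sub_zero]

theorem exists_reduced_sumSq {R : Type*} [Field R] [LinearOrder R] [IsStrictOrderedRing R]
    {p : R[X]} (hp : p.natDegree ≠ 0) {G : R[X]} (hG : IsSumSq G) :
    ∃ G', p ∣ G - G' ∧ G'.natDegree ≤ 2 * (p.natDegree - 1) ∧ ∀ x, 0 ≤ G'.eval x := by
  induction hG with
  | zero => exact ⟨0, by simp, by simp, by simp⟩
  | @sq_add g s _ ih =>
    obtain ⟨G', h1, h2, h3⟩ := ih
    refine ⟨(g % p) * (g % p) + G', ?_, ?_, fun x => ?_⟩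
    · have hd : p ∣ g - g % p := ⟨g / p, by
        have := EuclideanDomain.div_add_mod g p
        linear_combination -this⟩
      have e : g * g + s - ((g % p) * (g % p) + G') =
        (g - g % p) * (g + g % p) + (s - G') := by ring
      rw [e]
      exact dvd_add (hd.mul_right _) h1
    · have h4 := natDegree_mod_lt g hp
      refine (natDegree_add_le _ _).trans (max_le ?_ h2)
      refine natDegree_mul_le.trans ?_
      omega
    · rw [eval_add, eval_mul]
      exact add_nonneg (mul_self_nonneg _) (h3 x)

theorem HasRealFactors.exists_root {R : Type*} [Field R] [LinearOrder R] [IsStrictOrderedRing R]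
    (hR : HasRealFactors R) (p : R[X]) (a b : R) (hab : a < b)
    (h : p.eval a * p.eval b < 0) : ∃ c, a < c ∧ c < b ∧ p.eval c = 0 := by
  induction hd : p.natDegree using Nat.strong_induction_on generalizing p with
  | _ d ih =>
    subst hd
    have hp0 : p ≠ 0 := by rintro rfl; simp at h
    have hpu : ¬ IsUnit p := by
      intro hu
      obtain ⟨r, -, rfl⟩ := Polynomial.isUnit_iff.1 hu
      simp only [eval_C] at h
      exact (mul_self_nonneg r).not_gt h
    by_cases hirr : Irreducible p
    · rcases hR p hirr with h1 | ⟨G, hG, hpG⟩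
      · obtain ⟨c, hc, d, rfl⟩ := natDegree_eq_one.1 h1
        simp only [eval_add, eval_mul, eval_C, eval_X] at h ⊢
        refine ⟨-d / c, ?_, ?_, by field_simp; ring⟩
        · by_contra! hle
          refine h.not_ge ?_
          have e : (c * a + d) * (c * b + d) = c ^ 2 * ((a - -d / c) * (b - -d / c)) := by
            field_simp; ring
          rw [e]
          exact mul_nonneg (sq_nonneg _) (mul_nonneg (by linarith) (by linarith))
        · by_contra! hle
          refine h.not_ge ?_
          have e : (c * a + d) * (c * b + d) = c ^ 2 * ((-d / c - a) * (-d / c - b)) := by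
            field_simp; ring
          rw [e]
          exact mul_nonneg (sq_nonneg _) (mul_nonneg (by linarith) (by linarith))
      · obtain ⟨G', h1, h2, h3⟩ := exists_reduced_sumSq hirr.natDegree_pos.ne' hG
        obtain ⟨q, hq⟩ : p ∣ 1 + G' := by
          have e : 1 + G' = (1 + G) - (G - G') := by ring
          rw [e]
          exact dvd_sub hpG h1
        have hpos : ∀ x, 0 < p.eval x * q.eval x := fun x => by
          rw [← eval_mul, ← hq, eval_add, eval_one]
          linarith [h3 x]
        have hq0 : q ≠ 0 := by rintro rfl; simpa using hpos a
        have hdeg : q.natDegree < p.natDegree := by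
          have e1 := natDegree_mul hp0 hq0
          rw [← hq] at e1
          have e2 : (1 + G').natDegree ≤ 2 * (p.natDegree - 1) :=
            (natDegree_add_le _ _).trans (max_le (by simp) h2)
          have := hirr.natDegree_pos
          omega
        obtain ⟨c, c1, c2, c3⟩ := ih _ hdeg q (by
          have := mul_pos (hpos a) (hpos b)
          have e : p.eval a * q.eval a * (p.eval b * q.eval b) =
            (p.eval a * p.eval b) * (q.eval a * q.eval b) := by ring
          rw [e] at this
          exact (neg_iff_neg_of_mul_pos this).1 h) rfl
        have := hpos c
        rw [c3, mul_zero] at this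
        exact absurd this (lt_irrefl _)
    · obtain ⟨g, k, hgu, hku, rfl⟩ : ∃ g k, ¬ IsUnit g ∧ ¬ IsUnit k ∧ p = g * k := by
        by_contra! hcon
        exact hirr ⟨hpu, fun g k e => by
          by_contra! hh
          exact hcon g k hh.1 hh.2 e⟩
      have hg0 : g ≠ 0 := left_ne_zero_of_mul hp0
      have hk0 : k ≠ 0 := right_ne_zero_of_mul hp0
      have hgd : 0 < g.natDegree := natDegree_pos_iff_degree_pos.2
        (degree_pos_of_ne_zero_of_nonunit hg0 hgu)
      have hkd : 0 < k.natDegree := natDegree_pos_iff_degree_pos.2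
        (degree_pos_of_ne_zero_of_nonunit hk0 hku)
      rw [natDegree_mul hg0 hk0] at ih
      rw [eval_mul, eval_mul] at h
      have e : g.eval a * k.eval a * (g.eval b * k.eval b) =
        (g.eval a * g.eval b) * (k.eval a * k.eval b) := by ring
      rw [e] at h
      rcases mul_neg_iff.1 h with ⟨-, h'⟩ | ⟨h', -⟩
      · obtain ⟨c, c1, c2, c3⟩ := ih _ (by omega) k h' rfl
        exact ⟨c, c1, c2, by rw [eval_mul, c3, mul_zero]⟩
      · obtain ⟨c, c1, c2, c3⟩ := ih _ (by omega) g h' rfl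
        exact ⟨c, c1, c2, by rw [eval_mul, c3, zero_mul]⟩

theorem HasRealFactors.polyIVT {R : Type*} [Field R] [LinearOrder R] [IsStrictOrderedRing R]
    (hR : HasRealFactors R) : PolyIVT R := by
  intro p a b hab h
  by_cases ha : p.eval a = 0
  · exact ⟨a, le_rfl, hab, ha⟩
  by_cases hb : p.eval b = 0
  · exact ⟨b, hab, le_rfl, hb⟩
  have hlt := lt_of_le_of_ne h (mul_ne_zero ha hb)
  have hab' : a < b := lt_of_le_of_ne hab (by
    rintro rfl; exact (mul_self_nonneg _).not_gt hlt)
  obtain ⟨c, c1, c2, c3⟩ := hR.exists_root p a b hab' hlt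
  exact ⟨c, c1.le, c2.le, c3⟩

universe u

/-- A preordering containing no `-f ^ (2 * k)` is nonnegative under some homomorphism to a real
closed field that does not annihilate `f`. -/
theorem exists_hom_to_ordered_field {C : Type u} [CommRing C] (P : Subsemiring C)
    (hsq : ∀ a, a * a ∈ P) {f : C} (hf : ∀ k : ℕ, -f ^ (2 * k) ∉ P) :
    ∃ (R : Type u) (_ : Field R) (_ : LinearOrder R) (_ : IsStrictOrderedRing R) (φ : C →+* R),
      HasRealFactors R ∧ (∀ p ∈ P, 0 ≤ φ p) ∧ φ f ≠ 0 := by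
  obtain ⟨Q, hPQ, hQ⟩ := exists_maximal_preordering P hf
  have hsqQ : ∀ a, a * a ∈ Q := fun a => hPQ (hsq a)
  have htot := mem_or_neg_mem_of_maximal hsqQ hQ
  let I := coneSupport Q htot
  have hI : I.IsPrime := coneSupport_isPrime hsqQ hQ
  let F := FractionRing (C ⧸ I)
  let Ω := AlgebraicClosure F
  let ψ : C →+* F := (algebraMap (C ⧸ I) F).comp (Ideal.Quotient.mk I)
  have hψ : ∀ c, ψ c = 0 ↔ c ∈ Q ∧ -c ∈ Q := by
    intro c
    change algebraMap (C ⧸ I) F (Ideal.Quotient.mk I c) = 0 ↔ _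
    rw [map_eq_zero_iff _ (IsFractionRing.injective (C ⧸ I) F), Ideal.Quotient.eq_zero_iff_mem]
    exact mem_coneSupport
  let φ : C →+* Ω := (algebraMap F Ω).comp ψ
  have hφ : ∀ c, φ c = 0 ↔ c ∈ Q ∧ -c ∈ Q := fun c => by
    rw [← hψ]; exact map_eq_zero (algebraMap F Ω)
  let L₀ : Subfield Ω := (algebraMap F Ω).fieldRange
  have hfrac : ∀ x ∈ L₀, ∃ a b, φ b ≠ 0 ∧ x * φ b = φ a := by
    rintro _ ⟨y, rfl⟩
    obtain ⟨a, b, hb, rfl⟩ := IsFractionRing.div_surjective (C ⧸ I) y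
    obtain ⟨a, rfl⟩ := Ideal.Quotient.mk_surjective a
    obtain ⟨b, rfl⟩ := Ideal.Quotient.mk_surjective b
    have hb0 : ψ b ≠ 0 := by
      change algebraMap (C ⧸ I) F (Ideal.Quotient.mk I b) ≠ 0
      rw [Ne, map_eq_zero_iff _ (IsFractionRing.injective (C ⧸ I) F)]
      exact nonZeroDivisors.ne_zero hb
    refine ⟨a, b, fun h => hb0 ((map_eq_zero (algebraMap F Ω)).1 h), ?_⟩
    change algebraMap F Ω (ψ a / ψ b) * algebraMap F Ω (ψ b) = algebraMap F Ω (ψ a)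
    rw [← map_mul, div_mul_cancel₀ _ hb0]
  have h₀ : -1 ∉ sumCone Q φ L₀ := by
    intro h
    obtain ⟨q, hq, b, hb, e⟩ : ∃ q ∈ Q, ∃ b, φ b ≠ 0 ∧ (-1 : Ω) * φ b ^ 2 = φ q := by
      refine sumCone_induction (p := fun s => ∃ q ∈ Q, ∃ b, φ b ≠ 0 ∧ s * φ b ^ 2 = φ q) ?_
        ⟨0, zero_mem _, 1, by simp, by simp⟩ ?_ h
      · intro q hq l hl
        obtain ⟨a, b, hb, e⟩ := hfrac l hl
        refine ⟨q * (a * a), mul_mem hq (hsqQ a), b, hb, ?_⟩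
        rw [map_mul, map_mul, ← e]; ring
      · rintro s t ⟨q, hq, b, hb, e⟩ ⟨q', hq', b', hb', e'⟩
        refine ⟨q * (b' * b') + q' * (b * b), add_mem (mul_mem hq (hsqQ _)) (mul_mem hq' (hsqQ _)),
          b * b', by rw [map_mul]; exact mul_ne_zero hb hb', ?_⟩
        rw [map_add, map_mul, map_mul, map_mul, map_mul, map_mul, ← e, ← e']; ring
    have h1 : φ (q + b * b) = 0 := by rw [map_add, map_mul, ← e]; ring
    have h2 := ((hφ _).1 h1).2
    have h3 : -(b * b) ∈ Q := by
      have : -(b * b) = -(q + b * b) + q := by ring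
      rw [this]; exact add_mem h2 hq
    have h4 : φ (b * b) = 0 := (hφ _).2 ⟨hsqQ b, h3⟩
    rw [map_mul] at h4
    exact hb (mul_self_eq_zero.1 h4)
  obtain ⟨R, hLR, hR⟩ := exists_maximal_subfield h₀
  have hφR : ∀ c, φ c ∈ R := fun c => hLR ⟨ψ c, rfl⟩
  obtain ⟨o, ho, hpos⟩ := exists_linearOrder_of_cone ((sumCone Q φ R).comap R.subtype)
    (fun a h1 h2 => Subtype.ext (eq_zero_of_mem_of_neg_mem_sumCone hR a.2 h1 h2))
    (fun a => by
      rcases neg_mem_sumCone_or_exists_sq hR hφR a.2 with h | ⟨r, hr, e⟩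
      · exact Or.inr h
      · left
        change (a : Ω) ∈ sumCone Q φ R
        rw [← e]
        exact sq_mem_sumCone hr)
  refine ⟨↥R, inferInstance, o, ho, φ.codRestrict R hφR, hasRealFactors_of_maximal hR hφR,
    fun p hp => (hpos _).2 ?_, fun h => ?_⟩
  · change φ p ∈ sumCone Q φ R
    simpa using mem_sumCone (φ := φ) (hPQ hp) (one_mem R)
  · have h1 : φ f = 0 := congrArg Subtype.val h
    have h2 := ((hφ f).1 h1)
    refine hQ.1 1 ?_
    have : -f ^ (2 * 1) = f * -f := by ring
    rw [this]
    exact mul_mem h2.1 h2.2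

/-- A quadratic form over a subring that is nonnegative there is nonnegative over the field. -/
theorem quadForm_nonneg_of_subring {R : Type*} [Field R] [LinearOrder R] [IsStrictOrderedRing R]
    (A : Subring R) (m : ℕ) (M : Fin m → Fin m → R) (hM : ∀ i j, M i j ∈ A)
    (hsymm : ∀ i j, M i j = M j i)
    (h : ∀ c : Fin m → R, (∀ i, c i ∈ A) → 0 ≤ ∑ i, ∑ j, c i * c j * M i j) (r : Fin m → R) :
    0 ≤ ∑ i, ∑ j, r i * r j * M i j := by
  induction m with
  | zero => simp
  | succ m ih =>
    set a := M 0 0 with ha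
    set b : Fin m → R := fun i => M 0 i.succ with hb
    set D : Fin m → Fin m → R := fun i j => M i.succ j.succ with hD
    have expand : ∀ c : Fin (m + 1) → R, ∑ i, ∑ j, c i * c j * M i j =
        c 0 ^ 2 * a + 2 * c 0 * (∑ i, b i * c i.succ) +
          ∑ i : Fin m, ∑ j : Fin m, c i.succ * c j.succ * D i j := by
      intro c
      rw [Fin.sum_univ_succ]
      simp_rw [Fin.sum_univ_succ (n := m)]
      rw [Finset.sum_add_distrib]
      have e1 : ∑ i : Fin m, c i.succ * c 0 * M i.succ 0 = c 0 * ∑ i, b i * c i.succ := by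
        rw [Finset.mul_sum]
        refine Finset.sum_congr rfl fun i _ => ?_
        rw [hsymm i.succ 0]; simp only [hb]; ring
      have e2 : ∑ i : Fin m, c 0 * c i.succ * M 0 i.succ = c 0 * ∑ i, b i * c i.succ := by
        rw [Finset.mul_sum]
        refine Finset.sum_congr rfl fun i _ => ?_
        simp only [hb]; ring
      rw [e1, e2]
      ring
    have ha0 : 0 ≤ a := by
      have := h (Fin.cons 1 0) (by
        intro i; refine Fin.cases ?_ (fun i => ?_) i
        · exact one_mem A
        · simp [zero_mem])
      rw [expand] at this
      simpa using this
    rcases ha0.eq_or_lt with ha0 | ha0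
    · have hb0 : ∀ i, b i = 0 := by
        intro i
        have := h (Fin.cons (-(D i i + 1)) (Pi.single i (b i))) (by
          intro j; refine Fin.cases ?_ (fun j => ?_) j
          · exact neg_mem (add_mem (hM _ _) (one_mem A))
          · rw [Fin.cons_succ]
            by_cases hji : j = i
            · subst hji; rw [Pi.single_eq_same]; exact hM _ _
            · rw [Pi.single_eq_of_ne hji]; exact zero_mem A)
        have hDi : 0 ≤ D i i := by
          have := h (Fin.cons 0 (Pi.single i 1)) (by
            intro j; refine Fin.cases ?_ (fun j => ?_) j
            · exact zero_mem A
            · rw [Fin.cons_succ]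
              by_cases hji : j = i
              · subst hji; rw [Pi.single_eq_same]; exact one_mem A
              · rw [Pi.single_eq_of_ne hji]; exact zero_mem A)
          rw [expand] at this
          simpa [Pi.single_apply] using this
        rw [expand, ← ha0] at this
        simp only [Fin.cons_zero, Fin.cons_succ, Pi.single_apply, mul_ite, ite_mul, mul_zero,
          zero_mul, Finset.sum_ite_eq', Finset.mem_univ, if_true] at this
        have h2 : 0 ≤ -((D i i + 2) * b i ^ 2) := by linarith
        by_contra hbi
        have : 0 < (D i i + 2) * b i ^ 2 := by positivity
        linarith
      rw [expand, ← ha0]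
      simp only [hb0, zero_mul, Finset.sum_const_zero, mul_zero, zero_add]
      refine ih D (fun i j => hM _ _) (fun i j => hsymm _ _) (fun c hc => ?_) _
      have := h (Fin.cons 0 c) (by
        intro i; refine Fin.cases ?_ (fun i => ?_) i
        · exact zero_mem A
        · exact hc i)
      rw [expand] at this
      simpa using this
    · have key : ∀ c : Fin m → R, ∑ i, ∑ j, c i * c j * (a * D i j - b i * b j) =
          a * (∑ i, ∑ j, c i * c j * D i j) - (∑ i, b i * c i) ^ 2 := by
        intro c
        rw [sq, Finset.sum_mul_sum, Finset.mul_sum, ← Finset.sum_sub_distrib]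
        refine Finset.sum_congr rfl fun i _ => ?_
        rw [Finset.mul_sum, ← Finset.sum_sub_distrib]
        exact Finset.sum_congr rfl fun j _ => by ring
      have hred := ih (fun i j => a * D i j - b i * b j)
        (fun i j => sub_mem (mul_mem (hM _ _) (hM _ _)) (mul_mem (hM _ _) (hM _ _)))
        (fun i j => by
          have : D i j = D j i := hsymm _ _
          rw [this]; ring)
        (fun c hc => by
          rw [key]
          have := h (Fin.cons (-∑ i, b i * c i) (fun i => a * c i)) (by
            intro i; refine Fin.cases ?_ (fun i => ?_) i
            · exact neg_mem (sum_mem fun i _ => mul_mem (hM _ _) (hc i))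
            · exact mul_mem (hM _ _) (hc i))
          rw [expand] at this
          simp only [Fin.cons_zero, Fin.cons_succ] at this
          have e1 : ∑ i, b i * (a * c i) = a * ∑ i, b i * c i := by
            rw [Finset.mul_sum]; exact Finset.sum_congr rfl fun i _ => by ring
          have e2 : ∑ i, ∑ j, a * c i * (a * c j) * D i j =
              a ^ 2 * ∑ i, ∑ j, c i * c j * D i j := by
            rw [Finset.mul_sum]
            refine Finset.sum_congr rfl fun i _ => ?_
            rw [Finset.mul_sum]; exact Finset.sum_congr rfl fun j _ => by ring
          rw [e1, e2] at this
          refine (mul_nonneg_iff_of_pos_left ha0).1 ?_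
          linarith) (fun i => r i.succ)
      rw [key] at hred
      rw [expand]
      refine (mul_nonneg_iff_of_pos_left ha0).1 ?_
      nlinarith [sq_nonneg (a * r 0 + ∑ i, b i * r i.succ)]

end RealClosedOrder

section MatricialTrace

open Polynomial

/-- Power sums `t` (with `t (j + 1)` the `j + 1`-st one) have finitely many nonzero elementary
symmetric functions, where every root is counted with weight `1 / w`. -/
def HasNewtonSequence {R : Type*} [Field R] (w : R) (t : ℕ → R) : Prop :=
  ∃ x : ℕ → R, x 0 = 1 ∧
    (∀ k : ℕ, w * (k + 1) * x (k + 1) =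
      ∑ j ∈ Finset.range (k + 1), (-1) ^ j * t (j + 1) * x (k - j)) ∧
    ∃ N, ∀ k, N ≤ k → x k = 0

/-- A positive definite trace on a ring with involution that behaves like the trace of a ring of
matrices. -/
structure IsMatricialTrace {R B : Type*} [Field R] [LinearOrder R] [Ring B] [Algebra R B]
    [StarRing B] (τ : B →ₗ[R] R) : Prop where
  star_smul : ∀ (r : R) (b : B), star (r • b) = r • star b
  map_mul_comm : ∀ a b, τ (a * b) = τ (b * a)
  map_star : ∀ a, τ (star a) = τ a
  pos : ∀ b, b ≠ 0 → 0 < τ (b * star b)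
  isIntegral : ∀ b : B, IsIntegral R b
  newton : ∀ b : B, HasNewtonSequence 1 fun j => τ (b ^ j)
  newton_skew : ∀ u v : B, star u = -u → star v = -v → HasNewtonSequence 2 fun j => τ ((u * v) ^ j)

theorem exists_nat_eq_of_recursion {R : Type*} [Field R] [CharZero R] {m w : R} {x a : ℕ → R}
    (h0 : x 0 = 1) (hN : ∃ N, ∀ k, N ≤ k → x k = 0)
    (h : ∀ k, a k * x (k + 1) = (m - w * k) * x k) : ∃ k : ℕ, m = w * k := by
  by_contra! hne
  obtain ⟨N, hN⟩ := hN
  have : ∀ k, x k ≠ 0 := by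
    intro k
    induction k with
    | zero => rw [h0]; exact one_ne_zero
    | succ k ih =>
      intro hx
      have := h k
      rw [hx, mul_zero] at this
      exact mul_ne_zero (sub_ne_zero.2 (hne k)) ih this.symm
  exact this N (hN N le_rfl)

theorem HasNewtonSequence.exists_nat_of_const {R : Type*} [Field R] [CharZero R] {t : ℕ → R}
    (h : HasNewtonSequence 1 t) (ht : ∀ j, t (j + 2) = t (j + 1)) : ∃ k : ℕ, t 1 = k := by
  obtain ⟨x, h0, hx, hN⟩ := h
  have ht' : ∀ j, t (j + 1) = t 1 := fun j => by
    induction j with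
    | zero => rfl
    | succ j ih => rw [ht, ih]
  have key : ∀ k : ℕ, ((k : R) + 1) * x (k + 1) = (t 1 - 1 * k) * x k := by
    intro k
    rw [← one_mul ((k : R) + 1), hx]
    cases k with
    | zero => simp
    | succ k =>
      have := hx k
      rw [Finset.sum_range_succ']
      have e : ∑ j ∈ Finset.range (k + 1), (-1 : R) ^ (j + 1) * t (j + 1 + 1) * x (k + 1 - (j + 1))
          = - ∑ j ∈ Finset.range (k + 1), (-1 : R) ^ j * t (j + 1) * x (k - j) := by
        rw [← Finset.sum_neg_distrib]
        refine Finset.sum_congr rfl fun j _ => ?_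
        rw [ht, Nat.add_sub_add_right]; ring
      rw [e, ← this]
      push_cast
      simp
      ring
  obtain ⟨k, hk⟩ := exists_nat_eq_of_recursion h0 hN key
  exact ⟨k, by rw [hk, one_mul]⟩

theorem HasNewtonSequence.exists_nat_of_alternating {R : Type*} [Field R] [CharZero R] {w : R}
    {t : ℕ → R} (h : HasNewtonSequence w t) (h1 : t 1 = 0) (ht : ∀ j, t (j + 3) = -t (j + 1)) :
    ∃ k : ℕ, t 2 = -(2 * w * k) := by
  obtain ⟨x, h0, hx, N, hN⟩ := h
  have key : ∀ k : ℕ, w * (k + 2) * x (k + 2) = (-t 2 - w * k) * x k := by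
    intro k
    have := hx (k + 1)
    push_cast at this
    rw [add_assoc, one_add_one_eq_two] at this
    rw [this]
    rw [Finset.sum_range_succ', Finset.sum_range_succ']
    cases k with
    | zero => simp [h1]
    | succ k =>
      have hk := hx k
      have e : ∑ j ∈ Finset.range (k + 1), (-1 : R) ^ (j + 1 + 1) * t (j + 1 + 1 + 1) *
            x (k + 1 + 1 - (j + 1 + 1))
          = - ∑ j ∈ Finset.range (k + 1), (-1 : R) ^ j * t (j + 1) * x (k - j) := by
        rw [← Finset.sum_neg_distrib]
        refine Finset.sum_congr rfl fun j _ => ?_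
        rw [show j + 1 + 1 + 1 = j + 3 from rfl, ht,
          show k + 1 + 1 - (j + 1 + 1) = k - j by omega]
        ring
      rw [e, ← hk, h1]
      push_cast
      simp
      ring
  obtain ⟨k, hk⟩ := exists_nat_eq_of_recursion (m := -t 2) (w := 2 * w)
    (x := fun k => x (2 * k)) (a := fun k => w * (2 * k + 2))
    h0 ⟨N, fun k hk => hN _ (by omega)⟩ (fun k => by
      have := key (2 * k)
      push_cast at this
      rw [show 2 * (k + 1) = 2 * k + 2 by ring, this]; ring)
  exact ⟨k, by rw [← hk, neg_neg]⟩

end MatricialTrace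

set_option linter.unusedSectionVars false

namespace IsMatricialTrace

open Polynomial

variable {R B : Type*} [Field R] [LinearOrder R] [IsStrictOrderedRing R] [Ring B] [Algebra R B]
  [StarRing B] {τ : B →ₗ[R] R}

theorem nonneg (h : IsMatricialTrace τ) (b : B) : 0 ≤ τ (b * star b) := by
  by_cases hb : b = 0
  · simp [hb]
  · exact (h.pos b hb).le

theorem eq_zero_of_nonpos (h : IsMatricialTrace τ) {b : B} (hb : τ (b * star b) ≤ 0) : b = 0 := by
  by_contra hne
  exact (h.pos b hne).not_ge hb

theorem eq_zero_of_mul_star (h : IsMatricialTrace τ) {b : B} (hb : b * star b = 0) : b = 0 :=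
  h.eq_zero_of_nonpos (by simp [hb])

theorem star_aeval (h : IsMatricialTrace τ) {b : B} (hb : star b = b) (q : R[X]) :
    star (aeval b q) = aeval b q := by
  induction q using Polynomial.induction_on' with
  | add p q hp hq => rw [map_add, star_add, hp, hq]
  | monomial n r =>
    rw [aeval_monomial, ← Algebra.smul_def, h.star_smul, star_pow, hb]

/-- A symmetric element behaves like a diagonal matrix. -/
theorem exists_spectrum (h : IsMatricialTrace τ) (hR : HasRealFactors R) {b : B}
    (hb : star b = b) : ∃ Λ : Finset R, ∀ q : R[X], aeval b q = 0 ↔ ∀ l ∈ Λ, q.eval l = 0 := by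
  classical
  have hint := h.isIntegral b
  set p := minpoly R b with hp
  have hp0 : p ≠ 0 := minpoly.ne_zero hint
  have hpm : p.Monic := minpoly.monic hint
  have hdvd : ∀ q : R[X], aeval b q = 0 ↔ p ∣ q := fun q => (minpoly.dvd_iff).symm
  have hsqf : Squarefree p := by
    rintro x ⟨y, hy⟩
    have h1 : aeval b (x * y) = 0 := by
      apply h.eq_zero_of_mul_star
      rw [h.star_aeval hb, ← map_mul, hdvd, show x * y * (x * y) = (x * x * y) * y by ring, ← hy]
      exact dvd_mul_right _ _
    obtain ⟨z, hz⟩ := (hdvd _).1 h1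
    have hxy : x * y ≠ 0 := by
      intro h0
      rw [mul_assoc, h0, mul_zero] at hy
      exact hp0 hy
    rw [hy] at hz
    have : x * y * 1 = x * y * (x * z) := by rw [mul_one]; linear_combination hz
    exact IsUnit.of_mul_eq_one z (mul_left_cancel₀ hxy this).symm
  have hfac : ∀ r : R[X], Irreducible r → r ∣ p → r.natDegree = 1 := by
    rintro r hr ⟨y, hy⟩
    rcases hR r hr with h1 | ⟨G, hG, z, hz⟩
    · exact h1
    · exfalso
      have h1 : aeval b ((1 + G) * y) = 0 := by
        rw [hz, mul_right_comm, ← hy, map_mul, minpoly.aeval, zero_mul]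
      have h2 : 0 ≤ τ (aeval b (G * y * y)) := by
        clear hz h1
        induction hG with
        | zero => simp
        | @sq_add g s _ ih =>
          have e : (g * g + s) * y * y = (g * y) * (g * y) + s * y * y := by ring
          rw [e, map_add, map_add, map_mul]
          refine add_nonneg ?_ ih
          have := h.nonneg (aeval b (g * y))
          rwa [h.star_aeval hb] at this
      have h3 : aeval b y = 0 := by
        apply h.eq_zero_of_nonpos
        rw [h.star_aeval hb, ← map_mul]
        have e : y * y = (1 + G) * y * y - G * y * y := by ring
        rw [e, map_sub, map_mul _ _ y, h1, zero_mul, zero_sub, map_neg]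
        linarith
      obtain ⟨t, ht⟩ := (hdvd _).1 h3
      have hy0 : y ≠ 0 := by rintro rfl; rw [mul_zero] at hy; exact hp0 hy
      rw [hy] at ht
      have : y * 1 = y * (r * t) := by rw [mul_one]; linear_combination ht
      exact hr.not_isUnit (IsUnit.of_mul_eq_one t (mul_left_cancel₀ hy0 this).symm)
  have hspl : p.Splits := by
    refine (splits_iff_splits.2 (Or.inr fun {g} hg hgp => ?_))
    rw [degree_eq_natDegree hg.ne_zero, hfac g hg hgp]; rfl
  refine ⟨p.roots.toFinset, fun q => ?_⟩
  rw [hdvd]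
  constructor
  · rintro ⟨y, rfl⟩ l hl
    rw [Multiset.mem_toFinset, mem_roots hp0] at hl
    rw [eval_mul, hl.eq_zero, zero_mul]
  · intro hq
    by_cases hq0 : q = 0
    · simp [hq0]
    have hnd : p.roots.Nodup := nodup_roots (by
      exact (PerfectField.separable_iff_squarefree).2 hsqf)
    have e := hspl.eq_prod_roots
    rw [hpm.leadingCoeff, C_1, one_mul] at e
    rw [e]
    refine (Multiset.prod_X_sub_C_dvd_iff_le_roots hq0 _).2 ?_
    refine (Multiset.le_iff_subset hnd).2 fun l hl => ?_
    rw [mem_roots hq0]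
    exact hq l (Multiset.mem_toFinset.2 hl)

theorem aeval_eq_aeval {b : B} {Λ : Finset R}
    (hΛ : ∀ q : R[X], aeval b q = 0 ↔ ∀ l ∈ Λ, q.eval l = 0) {p q : R[X]}
    (hpq : ∀ l ∈ Λ, p.eval l = q.eval l) : aeval b p = aeval b q := by
  rw [← sub_eq_zero, ← map_sub, hΛ]
  intro l hl
  rw [eval_sub, hpq l hl, sub_self]

/-- Positive elements have symmetric square roots. -/
theorem exists_sqrt (h : IsMatricialTrace τ) (hR : HasRealFactors R) {s : B} (hs : star s = s)
    (hpos : ∀ b, 0 ≤ τ (b * s * star b)) : ∃ r, star r = r ∧ r * r = s := by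
  classical
  obtain ⟨Λ, hΛ⟩ := h.exists_spectrum hR hs
  have hΛ0 : ∀ l ∈ Λ, 0 ≤ l := by
    intro l hl
    set f : R[X] := Lagrange.interpolate Λ id (Pi.single l 1) with hf
    have hfl : ∀ k ∈ Λ, f.eval k = (Pi.single l 1 : R → R) k := fun k hk =>
      Lagrange.eval_interpolate_at_node _ Function.injective_id.injOn hk
    have hf0 : aeval s f ≠ 0 := by
      rw [Ne, hΛ]
      intro h0
      have := h0 l hl
      rw [hfl l hl, Pi.single_eq_same] at this
      exact one_ne_zero this
    have h1 := hpos (aeval s f)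
    have e : aeval s f * s = l • aeval s f := by
      have : aeval s (f * X) = aeval s (C l * f) := aeval_eq_aeval hΛ fun k hk => by
        rw [eval_mul, eval_mul, eval_X, eval_C, hfl k hk]
        by_cases hkl : k = l
        · rw [hkl]; ring
        · rw [Pi.single_eq_of_ne hkl]; ring
      rwa [map_mul, aeval_X, map_mul, aeval_C, ← Algebra.smul_def] at this
    rw [e, smul_mul_assoc, map_smul, smul_eq_mul] at h1
    exact nonneg_of_mul_nonneg_left h1 (h.pos _ hf0)
  have hsq : ∀ l : R, ∃ r : R, 0 ≤ l → r * r = l := fun l => by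
    by_cases hl : 0 ≤ l
    · obtain ⟨r, -, hr⟩ := hR.polyIVT.exists_sq_eq hl
      exact ⟨r, fun _ => by rw [← sq, hr]⟩
    · exact ⟨0, fun h => absurd h hl⟩
  choose r hr using hsq
  set f : R[X] := Lagrange.interpolate Λ id r with hf
  have hfl : ∀ k ∈ Λ, f.eval k = r k := fun k hk =>
    Lagrange.eval_interpolate_at_node _ Function.injective_id.injOn hk
  refine ⟨aeval s f, h.star_aeval hs f, ?_⟩
  rw [← map_mul, aeval_eq_aeval hΛ (q := X), aeval_X]
  intro l hl
  rw [eval_mul, eval_X, hfl l hl, hr l (hΛ0 l hl)]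

end IsMatricialTrace

/-- A symmetric idempotent all of whose symmetric compressions are scalar. -/
structure IsMinimalProj (R : Type*) {B : Type*} [Field R] [Ring B] [Algebra R B] [StarRing B]
    (E : B) : Prop where
  star_eq : star E = E
  mul_self : E * E = E
  ne_zero : E ≠ 0
  scalar : ∀ b, star b = b → ∃ c : R, E * b * E = c • E

namespace IsMatricialTrace

open Polynomial

variable {R B : Type*} [Field R] [LinearOrder R] [IsStrictOrderedRing R] [Ring B] [Algebra R B]
  [StarRing B] {τ : B →ₗ[R] R}

theorem exists_nat_of_proj (h : IsMatricialTrace τ) {E : B} (h2 : E * E = E) :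
    ∃ k : ℕ, τ E = k := by
  have hp : ∀ j, E ^ (j + 1) = E := fun j => by
    induction j with
    | zero => rw [zero_add, pow_one]
    | succ j ih => rw [pow_succ, ih, h2]
  obtain ⟨k, hk⟩ := (h.newton E).exists_nat_of_const (fun j => by rw [hp (j + 1), hp j])
  exact ⟨k, by rw [← hk, pow_one]⟩

theorem pos_of_proj (h : IsMatricialTrace τ) {E : B} (h1 : star E = E) (h2 : E * E = E)
    (h0 : E ≠ 0) : 0 < τ E := by
  have := h.pos E h0
  rwa [h1, h2] at this

/-- A symmetric idempotent that is not minimal splits. -/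
theorem exists_proj_lt (h : IsMatricialTrace τ) (hR : HasRealFactors R) {E : B}
    (h1 : star E = E) (h2 : E * E = E) {b : B} (hb : star b = b)
    (hne : ∀ c : R, E * b * E ≠ c • E) :
    ∃ F : B, star F = F ∧ F * F = F ∧ E * F = F ∧ F * E = F ∧ F ≠ 0 ∧ F ≠ E := by
  classical
  set x := E * b * E with hx
  have hxs : star x = x := by rw [hx, star_mul, star_mul, h1, hb, mul_assoc]
  have hEx : E * x = x := by rw [hx, ← mul_assoc, ← mul_assoc, h2]
  have hxE : x * E = x := by rw [hx, mul_assoc, h2]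
  obtain ⟨Λ, hΛ⟩ := h.exists_spectrum hR hxs
  obtain ⟨l, hl, hl0⟩ : ∃ l ∈ Λ, l ≠ 0 := by
    by_contra! hcon
    have : aeval x (X : R[X]) = 0 := (hΛ X).2 fun l hl => by rw [eval_X, hcon l hl]
    rw [aeval_X] at this
    exact hne 0 (by rw [this, zero_smul])
  set f : R[X] := Lagrange.interpolate (insert 0 Λ) id (Pi.single l 1) with hf
  have hfl : ∀ k ∈ insert 0 Λ, f.eval k = (Pi.single l 1 : R → R) k := fun k hk =>
    Lagrange.eval_interpolate_at_node _ Function.injective_id.injOn hk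
  have hf1 : ∀ k ∈ Λ, f.eval k = (Pi.single l 1 : R → R) k := fun k hk =>
    hfl k (Finset.mem_insert_of_mem hk)
  have hf0 : f.eval 0 = 0 := by
    rw [hfl 0 (Finset.mem_insert_self _ _), Pi.single_eq_of_ne hl0.symm]
  obtain ⟨y, hy⟩ : X ∣ f := X_dvd_iff.2 (by rwa [coeff_zero_eq_eval_zero])
  have hF : aeval x f = x * aeval x y := by rw [hy, map_mul, aeval_X]
  have hF' : aeval x f = aeval x y * x := by rw [hy, mul_comm, map_mul, aeval_X]
  refine ⟨aeval x f, h.star_aeval hxs f, ?_, ?_, ?_, ?_, ?_⟩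
  · rw [← map_mul]
    refine aeval_eq_aeval hΛ fun k hk => ?_
    rw [eval_mul, hf1 k hk]
    by_cases hkl : k = l
    · rw [hkl, Pi.single_eq_same, one_mul]
    · rw [Pi.single_eq_of_ne hkl, zero_mul]
  · rw [hF, ← mul_assoc, hEx]
  · rw [hF', mul_assoc, hxE]
  · rw [Ne, hΛ]
    intro h0
    have := h0 l hl
    rw [hf1 l hl, Pi.single_eq_same] at this
    exact one_ne_zero this
  · intro hFE
    have e : x * aeval x f = l • aeval x f := by
      have : aeval x (X * f) = aeval x (C l * f) := aeval_eq_aeval hΛ fun k hk => by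
        rw [eval_mul, eval_mul, eval_X, eval_C, hf1 k hk]
        by_cases hkl : k = l
        · rw [hkl]
        · rw [Pi.single_eq_of_ne hkl]; ring
      rwa [map_mul, aeval_X, map_mul, aeval_C, ← Algebra.smul_def] at this
    rw [hFE, hxE] at e
    exact hne l e

/-- Symmetric idempotents are orthogonal sums of minimal ones. -/
theorem exists_minimal_decomposition (h : IsMatricialTrace τ) (hR : HasRealFactors R) {E : B}
    (h1 : star E = E) (h2 : E * E = E) :
    ∃ s : Finset B, (∀ e ∈ s, IsMinimalProj R e) ∧ (∀ e ∈ s, ∀ f ∈ s, e ≠ f → e * f = 0) ∧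
      ∑ e ∈ s, e = E := by
  classical
  obtain ⟨N, hN⟩ := h.exists_nat_of_proj h2
  induction N using Nat.strong_induction_on generalizing E with
  | _ N ih =>
    by_cases h0 : E = 0
    · exact ⟨∅, by simp, by simp, by simp [h0]⟩
    by_cases hmin : ∀ b, star b = b → ∃ c : R, E * b * E = c • E
    · refine ⟨{E}, ?_, ?_, by simp⟩
      · intro e he
        rw [Finset.mem_singleton.1 he]
        exact ⟨h1, h2, h0, hmin⟩
      · intro e he f hf hef
        rw [Finset.mem_singleton.1 he, Finset.mem_singleton.1 hf] at hef
        exact absurd rfl hef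
    · push Not at hmin
      obtain ⟨b, hb, hne⟩ := hmin
      obtain ⟨F, f1, f2, f3, f4, f5, f6⟩ := h.exists_proj_lt hR h1 h2 hb hne
      have g1 : star (E - F) = E - F := by rw [star_sub, h1, f1]
      have g2 : (E - F) * (E - F) = E - F := by
        rw [sub_mul, mul_sub, mul_sub, h2, f2, f3, f4]; abel
      have hF := h.pos_of_proj f1 f2 f5
      have hG := h.pos_of_proj g1 g2 (sub_ne_zero.2 (Ne.symm f6))
      obtain ⟨k, hk⟩ := h.exists_nat_of_proj f2
      obtain ⟨k', hk'⟩ := h.exists_nat_of_proj g2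
      have hsum : k + k' = N := by
        have : τ F + τ (E - F) = τ E := by rw [map_sub]; ring
        rw [hk, hk', hN] at this
        exact_mod_cast this
      rw [hk] at hF
      rw [hk'] at hG
      have hkp : 0 < k := by exact_mod_cast hF
      have hkp' : 0 < k' := by exact_mod_cast hG
      obtain ⟨s, s1, s2, s3⟩ := ih k (by omega) f1 f2 hk
      obtain ⟨t, t1, t2, t3⟩ := ih k' (by omega) g1 g2 hk'
      have hs : ∀ e ∈ s, e * F = e := fun e he => by
        rw [← s3, Finset.mul_sum, Finset.sum_eq_single e (fun f hf hfe => s2 e he f hf hfe.symm)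
          (fun hn => absurd he hn), (s1 e he).mul_self]
      have ht : ∀ e ∈ t, (E - F) * e = e := fun e he => by
        rw [← t3, Finset.sum_mul, Finset.sum_eq_single e (fun f hf hfe => t2 f hf e he hfe)
          (fun hn => absurd he hn), (t1 e he).mul_self]
      have hst : ∀ e ∈ s, ∀ f ∈ t, e * f = 0 := fun e he f hf => by
        rw [← hs e he, ← ht f hf, mul_assoc, ← mul_assoc F, mul_sub, f4, f2, sub_self, zero_mul,
          mul_zero]
      have hts : ∀ e ∈ s, ∀ f ∈ t, f * e = 0 := fun e he f hf => by
        have := congrArg star (hst e he f hf)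
        rwa [star_mul, (s1 e he).star_eq, (t1 f hf).star_eq, star_zero] at this
      have hdisj : Disjoint s t := by
        rw [Finset.disjoint_left]
        intro e he he'
        have := hst e he e he'
        rw [(s1 e he).mul_self] at this
        exact (s1 e he).ne_zero this
      refine ⟨s ∪ t, ?_, ?_, ?_⟩
      · intro e he
        rcases Finset.mem_union.1 he with he | he
        · exact s1 e he
        · exact t1 e he
      · intro e he f hf hef
        rcases Finset.mem_union.1 he with he | he <;> rcases Finset.mem_union.1 hf with hf | hf
        · exact s2 e he f hf hef
        · exact hst e he f hf
        · exact hts f hf e he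
        · exact t2 e he f hf hef
      · rw [Finset.sum_union hdisj, s3, t3]; abel

end IsMatricialTrace

/-- Membership in the corner ring of an idempotent. -/
def InCorner {B : Type*} [Mul B] (E x : B) : Prop := E * x = x ∧ x * E = x

namespace InCorner

variable {B : Type*} [Ring B] {E x y : B}

theorem mul (hx : InCorner E x) (hy : InCorner E y) : InCorner E (x * y) :=
  ⟨by rw [← mul_assoc, hx.1], by rw [mul_assoc, hy.2]⟩

theorem add (hx : InCorner E x) (hy : InCorner E y) : InCorner E (x + y) :=
  ⟨by rw [mul_add, hx.1, hy.1], by rw [add_mul, hx.2, hy.2]⟩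

theorem sub (hx : InCorner E x) (hy : InCorner E y) : InCorner E (x - y) :=
  ⟨by rw [mul_sub, hx.1, hy.1], by rw [sub_mul, hx.2, hy.2]⟩

theorem smul {R : Type*} [CommRing R] [Algebra R B] (r : R) (hx : InCorner E x) :
    InCorner E (r • x) :=
  ⟨by rw [mul_smul_comm, hx.1], by rw [smul_mul_assoc, hx.2]⟩

theorem star [StarRing B] (hE : Star.star E = E) (hx : InCorner E x) : InCorner E (Star.star x) :=
  ⟨by simpa [hE] using congrArg Star.star hx.2, by simpa [hE] using congrArg Star.star hx.1⟩

end InCorner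

/-- An orthogonal basis of unitaries of the corner ring at `E`. -/
structure IsFrame {R B : Type*} [Field R] [Ring B] [Algebra R B] [StarRing B] (τ : B →ₗ[R] R)
    (E : B) {d : ℕ} (δ : Fin d → B) : Prop where
  inCorner : ∀ k, InCorner E (δ k)
  mul_star : ∀ k, δ k * star (δ k) = E
  orth : ∀ k l, τ (star (δ k) * δ l) = if k = l then τ E else 0
  span : ∀ x, InCorner E x → ∃ a : Fin d → R, x = ∑ k, a k • δ k
  dvd : ∃ i : ℕ, τ E = d * i

namespace IsMatricialTrace

variable {R B : Type*} [Field R] [LinearOrder R] [IsStrictOrderedRing R] [Ring B] [Algebra R B]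
  [StarRing B] {τ : B →ₗ[R] R}

theorem trace_skew (h : IsMatricialTrace τ) {u : B} (hu : star u = -u) : τ u = 0 := by
  have := h.map_star u
  rw [hu, map_neg] at this
  linarith

theorem exists_smul_of_symm {E x : B} (hE : IsMinimalProj R E) (hx : InCorner E x)
    (hs : star x = x) : ∃ c : R, x = c • E := by
  obtain ⟨c, hc⟩ := hE.scalar x hs
  exact ⟨c, by rw [← hc, hx.1, hx.2]⟩

theorem exists_normalized_skew (h : IsMatricialTrace τ) (hR : HasRealFactors R) {E u : B}
    (hE : IsMinimalProj R E) (hu : InCorner E u) (hs : star u = -u) (h0 : u ≠ 0) :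
    ∃ r : R, r ≠ 0 ∧ r • u * r • u = -E := by
  obtain ⟨c, hc⟩ := exists_smul_of_symm hE (hu.mul hu) (by rw [star_mul, hs, neg_mul_neg])
  have hEpos := h.pos_of_proj hE.star_eq hE.mul_self hE.ne_zero
  have h1 := h.pos u h0
  rw [hs, mul_neg, hc, map_neg, map_smul, smul_eq_mul, ← neg_mul] at h1
  have hc0 : 0 < -c := pos_of_mul_pos_left h1 hEpos.le
  obtain ⟨r, hr0, hr⟩ := hR.polyIVT.exists_sq_eq hc0.le
  have hr0 : r ≠ 0 := by rintro rfl; exact hc0.ne (by rw [← hr]; simp)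
  refine ⟨r⁻¹, inv_ne_zero hr0, ?_⟩
  rw [smul_mul_smul_comm, hc, smul_smul]
  have : r⁻¹ * r⁻¹ * c = -1 := by
    have : c = - r ^ 2 := by rw [hr, neg_neg]
    rw [this]; field_simp
  rw [this, neg_one_smul]

theorem pow_of_mul_self {E w : B} (hw : InCorner E w) (h2 : w * w = -E) (j : ℕ) :
    w ^ (j + 3) = -w ^ (j + 1) := by
  rw [pow_add w (j + 1) 2, sq, h2, mul_neg, pow_succ, mul_assoc, hw.2]

theorem exists_nat_of_skew (h : IsMatricialTrace τ) {E u : B} (hu : InCorner E u)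
    (hs : star u = -u) (h2 : u * u = -E) : ∃ k : ℕ, τ E = (2 : ℕ) * k := by
  obtain ⟨k, hk⟩ := (h.newton u).exists_nat_of_alternating (by rw [pow_one, h.trace_skew hs])
    (fun j => by rw [pow_of_mul_self hu h2, map_neg])
  rw [sq, h2, map_neg, neg_inj] at hk
  exact ⟨k, by rw [hk]; push_cast; ring⟩

theorem exists_nat_of_anticommuting (h : IsMatricialTrace τ) {E u v : B} (hu : InCorner E u)
    (hv : InCorner E v) (hus : star u = -u) (hvs : star v = -v) (hw : star (u * v) = -(u * v))
    (h2 : u * v * (u * v) = -E) : ∃ k : ℕ, τ E = (4 : ℕ) * k := by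
  obtain ⟨k, hk⟩ := (h.newton_skew u v hus hvs).exists_nat_of_alternating
    (by rw [pow_one, h.trace_skew hw])
    (fun j => by rw [pow_of_mul_self (hu.mul hv) h2, map_neg])
  rw [sq, h2, map_neg, neg_inj] at hk
  exact ⟨k, by rw [hk]; push_cast; ring⟩

theorem exists_scalar_add_skew {E x : B} (h : IsMatricialTrace τ) (hE : IsMinimalProj R E)
    (hx : InCorner E x) :
    ∃ (c : R) (y : B), InCorner E y ∧ star y = -y ∧ x = c • E + y := by
  have hx' := hx.star hE.star_eq
  obtain ⟨c, hc⟩ := exists_smul_of_symm hE ((hx.add hx').smul (2⁻¹ : R))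
    (by rw [h.star_smul, star_add, star_star, add_comm])
  refine ⟨c, (2⁻¹ : R) • (x - star x), (hx.sub hx').smul _, ?_, ?_⟩
  · rw [h.star_smul, star_sub, star_star, ← smul_neg, neg_sub]
  · rw [← hc, ← smul_add]
    have : x + star x + (x - star x) = (2 : R) • x := by rw [two_smul]; abel
    rw [this, smul_smul, inv_mul_cancel₀ two_ne_zero, one_smul]

theorem exists_frame (h : IsMatricialTrace τ) (hR : HasRealFactors R) {E : B}
    (hE : IsMinimalProj R E) : ∃ (d : ℕ) (δ : Fin d → B), IsFrame τ E δ := by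
  have hEE : InCorner E E := ⟨hE.mul_self, hE.mul_self⟩
  obtain ⟨m, hm⟩ := h.exists_nat_of_proj hE.mul_self
  by_cases h1 : ∀ u, InCorner E u → star u = -u → u = 0
  · refine ⟨1, ![E], fun k => ?_, fun k => ?_, fun k l => ?_, fun x hx => ?_, m, by simp [hm]⟩
    · fin_cases k; exact hEE
    · fin_cases k; simp [hE.star_eq, hE.mul_self]
    · fin_cases k; fin_cases l; simp [hE.star_eq, hE.mul_self]
    · obtain ⟨c, y, hy, hys, rfl⟩ := exists_scalar_add_skew h hE hx
      exact ⟨![c], by simp [h1 y hy hys]⟩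
  push Not at h1
  obtain ⟨u', hu', hus', hu0⟩ := h1
  obtain ⟨r, hr, huu⟩ := h.exists_normalized_skew hR hE hu' hus' hu0
  set u := r • u' with hu_def
  have hu : InCorner E u := hu'.smul r
  have hus : star u = -u := by rw [hu_def, h.star_smul, hus', smul_neg]
  clear_value u
  clear hu' hus' hu0 hu_def hr r u'
  by_cases h2 : ∀ x, InCorner E x → star x = -x → ∃ c : R, x = c • u
  · refine ⟨2, ![E, u], fun k => ?_, fun k => ?_, fun k l => ?_, fun x hx => ?_,
      h.exists_nat_of_skew hu hus huu⟩
    · fin_cases k; exacts [hEE, hu]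
    · fin_cases k <;> simp [hE.star_eq, hE.mul_self, hus, huu]
    · fin_cases k <;> fin_cases l <;>
        simp [hE.star_eq, hE.mul_self, hus, huu, hu.1, hu.2, h.trace_skew hus]
    · obtain ⟨c, y, hy, hys, rfl⟩ := exists_scalar_add_skew h hE hx
      obtain ⟨t, rfl⟩ := h2 y hy hys
      exact ⟨![c, t], by simp⟩
  push Not at h2
  obtain ⟨x, hx, hxs, hxu⟩ := h2
  -- the part of a skew element anticommuting with a unit
  have anti : ∀ w, InCorner E w → star w = -w → w * w = -E → ∀ y, InCorner E y → star y = -y →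
      ∃ c : R, w * (y + c • w) + (y + c • w) * w = 0 := by
    intro w hw hws hww y hy hys
    obtain ⟨c, hc⟩ := exists_smul_of_symm hE ((hw.mul hy).add (hy.mul hw))
      (by rw [star_add, star_mul, star_mul, hys, hws, neg_mul_neg, neg_mul_neg, add_comm])
    refine ⟨2⁻¹ * c, ?_⟩
    have e : w * (y + (2⁻¹ * c) • w) + (y + (2⁻¹ * c) • w) * w =
        (w * y + y * w) + (2 * (2⁻¹ * c)) • (w * w) := by
      rw [two_mul, add_smul, mul_add, add_mul, mul_smul_comm, smul_mul_assoc]; abel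
    rw [e, hc, hww, mul_inv_cancel_left₀ two_ne_zero, smul_neg, add_neg_cancel]
  obtain ⟨c, hc⟩ := anti u hu hus huu x hx hxs
  have hv' : InCorner E (x + c • u) := hx.add (hu.smul c)
  have hvs' : star (x + c • u) = -(x + c • u) := by
    rw [star_add, h.star_smul, hxs, hus, smul_neg, neg_add]
  have hv0 : x + c • u ≠ 0 := fun h0 =>
    hxu (-c) (by rw [neg_smul]; exact eq_neg_of_add_eq_zero_left h0)
  obtain ⟨r, hr, hvv⟩ := h.exists_normalized_skew hR hE hv' hvs' hv0
  set v := r • (x + c • u) with hv_def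
  have hv : InCorner E v := hv'.smul r
  have hvs : star v = -v := by rw [hv_def, h.star_smul, hvs', smul_neg]
  have hvu : v * u = -(u * v) := by
    rw [eq_neg_iff_add_eq_zero, hv_def, mul_smul_comm, smul_mul_assoc, ← smul_add, add_comm, hc,
      smul_zero]
  clear_value v
  clear hv' hvs' hv0 hv_def hr r hc c hxu hxs hx x
  have hw : InCorner E (u * v) := hu.mul hv
  have hws : star (u * v) = -(u * v) := by rw [star_mul, hus, hvs, neg_mul_neg, hvu]
  have e1 : u * (u * v) = -v := by rw [← mul_assoc, huu, neg_mul, hv.1]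
  have e2 : u * v * v = -u := by rw [mul_assoc, hvv, mul_neg, hu.2]
  have e3 : u * v * u = v := by rw [mul_assoc, hvu, mul_neg, e1, neg_neg]
  have e4 : v * (u * v) = u := by rw [← mul_assoc, hvu, neg_mul, e2, neg_neg]
  have hww : u * v * (u * v) = -E := by rw [mul_assoc, e4, huu]
  refine ⟨4, ![E, u, v, u * v], fun k => ?_, fun k => ?_, fun k l => ?_, fun x hx => ?_,
    h.exists_nat_of_anticommuting hu hv hus hvs hws hww⟩
  · fin_cases k; exacts [hEE, hu, hv, hw]
  · fin_cases k
    · simp [hE.star_eq, hE.mul_self]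
    · simp [hus, huu]
    · simp [hvs, hvv]
    · change u * v * star (u * v) = E
      rw [hws, mul_neg, hww, neg_neg]
  · have t1 := h.trace_skew hus
    have t2 := h.trace_skew hvs
    have t3 := h.trace_skew hws
    fin_cases k <;> fin_cases l <;>
      simp [hE.star_eq, hE.mul_self, hus, huu, hu.1, hu.2, hvs, hvv, hv.1, hv.2, hw.1, hw.2, hws,
        -star_mul, t1, t2, t3, hvu, e1, e2, e3, e4, hww]
  · obtain ⟨c, y, hy, hys, rfl⟩ := exists_scalar_add_skew h hE hx
    obtain ⟨a1, ha1⟩ := anti u hu hus huu y hy hys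
    obtain ⟨a2, ha2⟩ := anti v hv hvs hvv y hy hys
    obtain ⟨a3, ha3⟩ := anti (u * v) hw hws hww y hy hys
    set z := y + a1 • u + a2 • v + a3 • (u * v) with hz
    have hzc : InCorner E z := ((hy.add (hu.smul _)).add (hv.smul _)).add (hw.smul _)
    have z1 : z * u = -(u * z) := by
      rw [eq_neg_iff_add_eq_zero]
      have e : z * u + u * z = (u * (y + a1 • u) + (y + a1 • u) * u) +
          a2 • (v * u + u * v) + a3 • (u * v * u + u * (u * v)) := by
        rw [hz]
        simp only [mul_add, add_mul, mul_smul_comm, smul_mul_assoc, smul_add]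
        abel
      rw [e, ha1, hvu, e3, e1]; simp
    have z2 : z * v = -(v * z) := by
      rw [eq_neg_iff_add_eq_zero]
      have e : z * v + v * z = (v * (y + a2 • v) + (y + a2 • v) * v) +
          a1 • (v * u + u * v) + a3 • (u * v * v + v * (u * v)) := by
        rw [hz]
        simp only [mul_add, add_mul, mul_smul_comm, smul_mul_assoc, smul_add]
        abel
      rw [e, ha2, hvu, e2, e4]; simp
    have z3 : z * (u * v) = -(u * v * z) := by
      rw [eq_neg_iff_add_eq_zero]
      have e : z * (u * v) + u * v * z =
          (u * v * (y + a3 • (u * v)) + (y + a3 • (u * v)) * (u * v)) +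
          a1 • (u * (u * v) + u * v * u) + a2 • (v * (u * v) + u * v * v) := by
        rw [hz]
        simp only [mul_add, add_mul, mul_smul_comm, smul_mul_assoc, smul_add]
        abel
      rw [e, ha3, e1, e2, e3, e4]; simp
    have z4 : z * (u * v) = u * v * z := by
      rw [← mul_assoc, z1, neg_mul, mul_assoc, z2, mul_neg, neg_neg, mul_assoc]
    have z5 : (2 : R) • (z * (u * v)) = 0 := by
      rw [two_smul]; nth_rewrite 1 [z3]; rw [z4, neg_add_cancel]
    have z6 : z * (u * v) = 0 := (smul_eq_zero.1 z5).resolve_left two_ne_zero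
    have z7 : z = 0 := by
      have : z * (u * v) * (u * v) = -z := by rw [mul_assoc, hww, mul_neg, hzc.2]
      rw [z6, zero_mul] at this
      exact neg_eq_zero.1 this.symm
    refine ⟨![c, -a1, -a2, -a3], ?_⟩
    have : y = -(a1 • u) - a2 • v - a3 • (u * v) := by
      rw [← sub_eq_zero, ← z7, hz]; abel
    rw [this]
    simp [Fin.sum_univ_four]
    abel

end IsMatricialTrace

universe u v

/-- Equivalence of projections through a partial isometry. -/
def ProjEquiv {B : Type*} [Ring B] [StarRing B] (E F : B) : Prop :=
  ∃ u, u * star u = E ∧ star u * u = F ∧ E * u = u ∧ u * F = u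

theorem ProjEquiv.symm {B : Type*} [Ring B] [StarRing B] {E F : B} (h : ProjEquiv E F) :
    ProjEquiv F E := by
  obtain ⟨u, h1, h2, h3, h4⟩ := h
  have hE : star E = E := by rw [← h1, star_mul, star_star]
  have hF : star F = F := by rw [← h2, star_mul, star_star]
  exact ⟨star u, by rw [star_star, h2], by rw [star_star, h1],
    by simpa [hF] using congrArg star h4, by simpa [hE] using congrArg star h3⟩

theorem ProjEquiv.trans {B : Type*} [Ring B] [StarRing B] {E F G : B} (h : ProjEquiv E F)
    (h' : ProjEquiv F G) : ProjEquiv E G := by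
  obtain ⟨u, h1, h2, h3, h4⟩ := h
  obtain ⟨v, k1, k2, k3, k4⟩ := h'
  refine ⟨u * v, ?_, ?_, by rw [← mul_assoc, h3], by rw [mul_assoc, k4]⟩
  · rw [star_mul, mul_assoc, ← mul_assoc v, k1, ← mul_assoc, h4, h1]
  · rw [star_mul, mul_assoc, ← mul_assoc (star u), h2, k3, k2]

/-- A function that is the trace of a matrix representation compatible with the involution. -/
def IsRepTrace {R : Type v} {B : Type u} [Field R] [Ring B] [Algebra R B] [StarRing B]
    (t : B → R) : Prop :=
  ∃ (I : Type u) (_ : Fintype I) (_ : DecidableEq I) (π : B →ₐ[R] Matrix I I R),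
    (∀ b, π (star b) = (π b)ᵀ) ∧ ∀ b, (π b).trace = t b

namespace IsRepTrace

variable {R : Type v} {B : Type u} [Field R] [Ring B] [Algebra R B] [StarRing B]

theorem zero : IsRepTrace (R := R) (fun _ : B => 0) := by
  refine ⟨PEmpty, inferInstance, inferInstance,
    { toFun := fun _ => 0, map_one' := Subsingleton.elim _ _, map_mul' := fun _ _ => by simp,
      map_zero' := rfl, map_add' := fun _ _ => by simp,
      commutes' := fun _ => Subsingleton.elim _ _ }, fun b => rfl, fun b => rfl⟩

theorem add {t t' : B → R} (h : IsRepTrace t) (h' : IsRepTrace t') :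
    IsRepTrace (fun b => t b + t' b) := by
  obtain ⟨I, _, _, π, h1, h2⟩ := h
  obtain ⟨J, _, _, π', h1', h2'⟩ := h'
  refine ⟨I ⊕ J, inferInstance, inferInstance,
    AlgHom.ofLinearMap
      { toFun := fun b => fromBlocks (π b) 0 0 (π' b)
        map_add' := fun a b => by simp [fromBlocks_add]
        map_smul' := fun r b => by simp [fromBlocks_smul] }
      (by simp) (fun a b => by simp [fromBlocks_multiply]), fun b => ?_, fun b => ?_⟩
  · simp [h1, h1', fromBlocks_transpose]
  · simp [Matrix.trace, ← h2, ← h2']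

theorem nsmul {t : B → R} (h : IsRepTrace t) (k : ℕ) : IsRepTrace (fun b => (k : R) * t b) := by
  induction k with
  | zero => simpa using zero (R := R) (B := B)
  | succ k ih =>
    have := ih.add h
    simpa only [Nat.cast_succ, add_mul, one_mul] using this

end IsRepTrace

namespace IsMatricialTrace

variable {R : Type v} {B : Type u} [Field R] [LinearOrder R] [IsStrictOrderedRing R] [Ring B]
  [Algebra R B] [StarRing B] {τ : B →ₗ[R] R}

theorem exists_isometry (h : IsMatricialTrace τ) (hR : HasRealFactors R) {E F x : B}
    (hE : IsMinimalProj R E) (hF : IsMinimalProj R F) (h0 : E * x * F ≠ 0) : ProjEquiv E F := by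
  set y := E * x * F with hy
  have hEy : E * y = y := by rw [hy, ← mul_assoc, ← mul_assoc, hE.mul_self]
  have hyF : y * F = y := by rw [hy, mul_assoc, hF.mul_self]
  have hFy : F * star y = star y := by simpa [hF.star_eq] using congrArg star hyF
  have hyE : star y * E = star y := by simpa [hE.star_eq] using congrArg star hEy
  obtain ⟨c, hc⟩ := exists_smul_of_symm hE (x := y * star y)
    ⟨by rw [← mul_assoc, hEy], by rw [mul_assoc, hyE]⟩ (by rw [star_mul, star_star])
  obtain ⟨c', hc'⟩ := exists_smul_of_symm hF (x := star y * y)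
    ⟨by rw [← mul_assoc, hFy], by rw [mul_assoc, hyF]⟩ (by rw [star_mul, star_star])
  have hcc : c = c' := by
    have e : c • y = c' • y := by
      rw [← hEy, ← smul_mul_assoc, ← hc, mul_assoc, hEy, hc', mul_smul_comm, hyF]
    by_contra hne
    rw [← sub_eq_zero, ← sub_smul, smul_eq_zero] at e
    exact e.elim (sub_ne_zero.2 hne) h0
  have hEpos := h.pos_of_proj hE.star_eq hE.mul_self hE.ne_zero
  have hcpos : 0 < c := by
    have := h.pos y h0
    rw [hc, map_smul, smul_eq_mul] at this
    exact pos_of_mul_pos_left this hEpos.le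
  obtain ⟨r, hr0, hr⟩ := hR.polyIVT.exists_sq_eq hcpos.le
  have hr0 : r ≠ 0 := by rintro rfl; exact hcpos.ne (by rw [← hr]; simp)
  have hrc : r⁻¹ * r⁻¹ * c = 1 := by rw [← hr]; field_simp
  refine ⟨r⁻¹ • y, ?_, ?_, ?_, ?_⟩
  · rw [h.star_smul, smul_mul_smul_comm, hc, smul_smul, hrc, one_smul]
  · rw [h.star_smul, smul_mul_smul_comm, hc', ← hcc, smul_smul, hrc, one_smul]
  · rw [mul_smul_comm, hEy]
  · rw [smul_mul_assoc, hyF]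

/-- The representation on a left ideal with an orthogonal basis. -/
theorem isRepTrace_of_basis (h : IsMatricialTrace τ) {I : Type u} [Fintype I] [DecidableEq I]
    (p : I → B) (c : B) (m : R) (hm : m ≠ 0) (hpc : ∀ i, p i * c = p i)
    (orth : ∀ i j, τ (star (p i) * p j) = if i = j then m else 0)
    (span : ∀ y, y * c = y → m • y = ∑ i, τ (star (p i) * y) • p i) :
    IsRepTrace (fun b => m⁻¹ * τ (b * ∑ i, p i * star (p i))) := by
  refine ⟨I, inferInstance, inferInstance,
    AlgHom.ofLinearMap
      { toFun := fun b => Matrix.of fun i j => m⁻¹ * τ (star (p i) * b * p j)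
        map_add' := fun a b => by ext; simp [mul_add, add_mul]
        map_smul' := fun r b => by ext; simp; ring } ?_ ?_, ?_, ?_⟩
  · ext i j
    simp only [LinearMap.coe_mk, AddHom.coe_mk, of_apply, mul_one, orth, Matrix.one_apply]
    split_ifs
    · exact inv_mul_cancel₀ hm
    · simp
  · intro a b
    ext i j
    simp only [LinearMap.coe_mk, AddHom.coe_mk, of_apply, Matrix.mul_apply]
    have e : a * b * p j = m⁻¹ • ∑ k, τ (star (p k) * (b * p j)) • (a * p k) := by
      have := span (b * p j) (by rw [mul_assoc, hpc])
      rw [mul_assoc, eq_inv_smul_iff₀ hm, ← mul_smul_comm, this, Finset.mul_sum]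
      simp only [mul_smul_comm]
    rw [mul_assoc, e, mul_smul_comm, Finset.mul_sum, map_smul, map_sum, smul_eq_mul,
      Finset.mul_sum, Finset.mul_sum]
    refine Finset.sum_congr rfl fun k _ => ?_
    rw [mul_smul_comm, map_smul, smul_eq_mul, ← mul_assoc (star (p k)), ← mul_assoc (star (p i))]
    ring
  · intro b
    ext i j
    simp only [AlgHom.ofLinearMap_apply, LinearMap.coe_mk, AddHom.coe_mk, of_apply,
      transpose_apply]
    rw [← h.map_star, star_mul, star_mul, star_star, star_star, mul_assoc]
  · intro b
    simp only [AlgHom.ofLinearMap_apply, LinearMap.coe_mk, AddHom.coe_mk, Matrix.trace,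
      Matrix.diag_apply, of_apply]
    rw [Finset.mul_sum, map_sum, Finset.mul_sum]
    refine Finset.sum_congr rfl fun i _ => ?_
    rw [mul_assoc, h.map_mul_comm, mul_assoc]

theorem isRepTrace_of_class (h : IsMatricialTrace τ) (hR : HasRealFactors R) {s : Finset B}
    (hs : ∀ e ∈ s, IsMinimalProj R e) (horth : ∀ e ∈ s, ∀ f ∈ s, e ≠ f → e * f = 0)
    (hsum : ∑ e ∈ s, e = 1) {c : B} (hc : IsMinimalProj R c) {s' : Finset B}
    (hs' : ∀ e, e ∈ s' ↔ e ∈ s ∧ ProjEquiv e c) :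
    IsRepTrace (fun b => τ (b * ∑ e ∈ s', e)) := by
  classical
  obtain ⟨d, δ, hδ⟩ := h.exists_frame hR hc
  obtain ⟨i, hi⟩ := hδ.dvd
  have hm := h.pos_of_proj hc.star_eq hc.mul_self hc.ne_zero
  have hch : ∀ e : s', ∃ u, u * star u = (e : B) ∧ star u * u = c ∧ (e : B) * u = u ∧ u * c = u :=
    fun e => ((hs' e).1 e.2).2
  choose u u1 u2 u3 u4 using hch
  have u3' : ∀ e : s', star (u e) * e = star (u e) := fun e => by
    simpa [(hs e ((hs' e).1 e.2).1).star_eq] using congrArg star (u3 e)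
  have u4' : ∀ e, c * star (u e) = star (u e) := fun e => by
    simpa [hc.star_eq] using congrArg star (u4 e)
  have key := h.isRepTrace_of_basis (I := s' × Fin d) (fun x => u x.1 * δ x.2) c (τ c) hm.ne'
    (fun x => by rw [mul_assoc, (hδ.inCorner x.2).2]) ?_ ?_
  · have e : ∀ b, τ (b * ∑ e ∈ s', e) = (i : R) * ((τ c)⁻¹ *
        τ (b * ∑ x : s' × Fin d, u x.1 * δ x.2 * star (u x.1 * δ x.2))) := by
      intro b
      have e1 : ∑ x : s' × Fin d, u x.1 * δ x.2 * star (u x.1 * δ x.2) =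
          (d : R) • ∑ e ∈ s', e := by
        rw [Fintype.sum_prod_type, ← Finset.sum_coe_sort s', Finset.smul_sum]
        refine Finset.sum_congr rfl fun e _ => ?_
        have : ∀ k, u e * δ k * star (u e * δ k) = e := fun k => by
          rw [star_mul, mul_assoc, ← mul_assoc (δ k), hδ.mul_star, ← mul_assoc, u4, u1]
        simp only [this, Finset.sum_const, Finset.card_univ, Fintype.card_fin]
        rw [Nat.cast_smul_eq_nsmul]
      rw [e1, mul_smul_comm, map_smul, smul_eq_mul, ← mul_assoc, ← mul_assoc]
      have : (i : R) * (τ c)⁻¹ * d = 1 := by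
        rw [mul_right_comm, mul_comm (i : R), ← hi, mul_inv_cancel₀ hm.ne']
      rw [this, one_mul]
    simp only [e]
    exact key.nsmul i
  · rintro ⟨e, k⟩ ⟨f, l⟩
    simp only [star_mul, Prod.mk.injEq]
    by_cases hef : e = f
    · subst hef
      rw [mul_assoc, ← mul_assoc (star (u e)), u2, (hδ.inCorner l).1, hδ.orth]
      simp
    · have : star (u e) * u f = 0 := by
        rw [← u3', ← u3 f, mul_assoc, ← mul_assoc (e : B),
          horth _ ((hs' e).1 e.2).1 _ ((hs' f).1 f.2).1 (fun h => hef (Subtype.ext h)), zero_mul,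
          mul_zero]
      rw [mul_assoc, ← mul_assoc (star (u e)), this]
      simp [hef]
  · intro y hy
    have hspan : ∀ z, InCorner c z → τ c • z = ∑ k, τ (star (δ k) * z) • δ k := by
      intro z hz
      obtain ⟨a, ha⟩ := hδ.span z hz
      have : ∀ k, τ (star (δ k) * z) = a k * τ c := fun k => by
        rw [ha, Finset.mul_sum, map_sum, Finset.sum_eq_single k]
        · rw [mul_smul_comm, map_smul, hδ.orth, if_pos rfl, smul_eq_mul]
        · intro l _ hl
          rw [mul_smul_comm, map_smul, hδ.orth, if_neg hl.symm, smul_zero]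
        · simp
      simp only [this]
      nth_rewrite 1 [ha]
      rw [Finset.smul_sum]
      refine Finset.sum_congr rfl fun k _ => ?_
      rw [smul_smul, mul_comm]
    have e1 : y = ∑ e : s', (e : B) * y := by
      rw [Finset.sum_coe_sort s' (fun e => e * y)]
      nth_rewrite 1 [← one_mul y]
      rw [← hsum, Finset.sum_mul]
      refine (Finset.sum_subset (fun e he => ((hs' e).1 he).1) fun e he he' => ?_).symm
      by_contra h0
      refine he' ((hs' e).2 ⟨he, h.exists_isometry hR (hs e he) hc (x := y) ?_⟩)
      rwa [mul_assoc, hy]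
    nth_rewrite 1 [e1]
    rw [Fintype.sum_prod_type, Finset.smul_sum]
    refine Finset.sum_congr rfl fun e _ => ?_
    have := hspan (star (u e) * y) ⟨by rw [← mul_assoc, u4'], by rw [mul_assoc, hy]⟩
    rw [← u1 e, mul_assoc, ← mul_smul_comm, this, Finset.mul_sum]
    refine Finset.sum_congr rfl fun k _ => ?_
    rw [mul_smul_comm, star_mul, mul_assoc]

theorem isRepTrace (h : IsMatricialTrace τ) (hR : HasRealFactors R) : IsRepTrace τ := by
  classical
  obtain ⟨s, s1, s2, s3⟩ := h.exists_minimal_decomposition hR (star_one B) (one_mul (1 : B))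
  have key : ∀ t : Finset B, t ⊆ s → (∀ e ∈ t, ∀ f ∈ s, ProjEquiv e f → f ∈ t) →
      IsRepTrace (fun b => τ (b * ∑ e ∈ t, e)) := by
    intro t
    induction t using Finset.strongInduction with
    | _ t ih =>
      intro hts ht
      rcases t.eq_empty_or_nonempty with rfl | ⟨c, hc⟩
      · simpa using IsRepTrace.zero (R := R) (B := B)
      have hself : ∀ e ∈ t, ProjEquiv e e := fun e he => by
        have := s1 e (hts he)
        exact ⟨e, by rw [this.star_eq, this.mul_self], by rw [this.star_eq, this.mul_self],
          this.mul_self, this.mul_self⟩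
      have h1 := h.isRepTrace_of_class hR s1 s2 s3 (s1 c (hts hc))
        (s' := t.filter fun e => ProjEquiv e c) (fun e => by
          rw [Finset.mem_filter]
          exact ⟨fun he => ⟨hts he.1, he.2⟩, fun he => ⟨ht c hc e he.1 he.2.symm, he.2⟩⟩)
      have h2 := ih (t.filter fun e => ¬ ProjEquiv e c)
        (Finset.filter_ssubset.2 ⟨c, hc, not_not.2 (hself c hc)⟩)
        ((Finset.filter_subset _ _).trans hts) (fun e he f hf hef => by
          rw [Finset.mem_filter] at he ⊢
          exact ⟨ht e he.1 f hf hef, fun hfc => he.2 (hef.trans hfc)⟩)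
      have := h1.add h2
      simpa only [← map_add, ← mul_add, Finset.sum_filter_add_sum_filter_not] using this
  have := key s (Finset.Subset.refl s) (fun e he f hf _ => hf)
  simpa only [s3, mul_one] using this

/-- A matricial trace is the trace of a matrix representation. -/
theorem exists_representation (h : IsMatricialTrace τ) (hR : HasRealFactors R) {n : ℕ}
    (hn : τ 1 = n) : ∃ π : B →ₐ[R] Matrix (Fin n) (Fin n) R,
      (∀ b, π (star b) = (π b)ᵀ) ∧ ∀ b, (π b).trace = τ b := by
  obtain ⟨I, _, _, π, h1, h2⟩ := h.isRepTrace hR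
  have hcard : Fintype.card I = n := by
    have := h2 1
    rw [map_one, Matrix.trace_one, hn] at this
    exact_mod_cast this
  let e : I ≃ Fin n := Fintype.equivFinOfCardEq hcard
  refine ⟨(Matrix.reindexAlgEquiv R R e).toAlgHom.comp π, fun b => ?_, fun b => ?_⟩
  · simp [h1, Matrix.reindex_apply, Matrix.transpose_submatrix]
  · rw [← h2]
    exact e.symm.sum_comp fun i => π b i i

end IsMatricialTrace

section NewtonIdentities

open Polynomial

variable {K : Type*} [CommRing K] {n : Type*} [Fintype n] [DecidableEq n]

/-- Jacobi's formula. -/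
theorem derivative_det_eq_trace (A : Matrix n n K[X]) :
    derivative A.det = (A.adjugate * A.map derivative).trace := by
  have h1 : ∀ i, (A.adjugate * A.map derivative) i i =
      (A.updateCol i fun k => derivative (A k i)).det := by
    intro i
    rw [← cramer_apply, cramer_eq_adjugate_mulVec]
    rfl
  simp only [Matrix.trace, Matrix.diag_apply, h1]
  simp only [det_apply, derivative_sum]
  rw [Finset.sum_comm]
  refine Finset.sum_congr rfl fun σ _ => ?_
  rw [← Finset.smul_sum, Units.smul_def, Units.smul_def, derivative_smul, derivative_prod_finset]
  congr 1
  refine Finset.sum_congr rfl fun i _ => ?_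
  rw [← Finset.mul_prod_erase _ _ (Finset.mem_univ i), mul_comm]
  congr 1
  · simp
  · refine Finset.prod_congr rfl fun j hj => ?_
    rw [updateCol_ne (Finset.ne_of_mem_erase hj)]

theorem coeff_derivative_det_one_add (M : Matrix n n K) (k : ℕ) :
    (k + 1) * (1 + (X : K[X]) • M.map C).det.coeff (k + 1) =
      ∑ j ∈ Finset.range (k + 1),
        (-1) ^ j * (M ^ (j + 1)).trace * (1 + (X : K[X]) • M.map C).det.coeff (k - j) := by
  set A : Matrix n n K[X] := 1 + (X : K[X]) • M.map C with hA
  set P := A.det with hP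
  let s : ℕ → K[X] := fun j => (A.adjugate * (M ^ j).map (C : K → K[X])).trace
  have hs : ∀ j, s j + X * s (j + 1) = P * C (M ^ j).trace := by
    intro j
    have e : A.adjugate * (M ^ j).map (C : K → K[X]) +
        (X : K[X]) • (A.adjugate * (M ^ (j + 1)).map (C : K → K[X])) =
        P • (M ^ j).map (C : K → K[X]) := by
      have : (M ^ (j + 1)).map (C : K → K[X]) = M.map C * (M ^ j).map C := by
        rw [pow_succ', Matrix.map_mul]
      rw [this, ← mul_smul_comm, ← smul_mul_assoc, ← mul_add]
      have : (M ^ j).map (C : K → K[X]) + (X : K[X]) • M.map C * (M ^ j).map C =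
          A * (M ^ j).map (C : K → K[X]) := by
        rw [hA, add_mul, one_mul]
      rw [this, ← mul_assoc, adjugate_mul, smul_mul_assoc, one_mul]
    have := congrArg Matrix.trace e
    rw [trace_add, trace_smul, trace_smul, smul_eq_mul, smul_eq_mul] at this
    rw [this]
    congr 1
    simp [Matrix.trace]
  have hcoeff : ∀ k j, (s j).coeff k =
      ∑ i ∈ Finset.range (k + 1), (-1) ^ i * (M ^ (j + i)).trace * P.coeff (k - i) := by
    intro k
    induction k with
    | zero =>
      intro j
      have := congrArg (fun p => p.coeff 0) (hs j)
      simp only [coeff_add, mul_coeff_zero, coeff_X_zero, zero_mul, add_zero, coeff_C_zero] at this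
      simp [this, mul_comm]
    | succ k ih =>
      intro j
      have := congrArg (fun p => p.coeff (k + 1)) (hs j)
      simp only [coeff_add, coeff_X_mul, coeff_mul_C, ih] at this
      rw [eq_sub_of_add_eq this, Finset.sum_range_succ' _ (k + 1)]
      have e : ∀ i, (-1) ^ (i + 1) * (M ^ (j + (i + 1))).trace * P.coeff (k + 1 - (i + 1)) =
          -((-1) ^ i * (M ^ (j + 1 + i)).trace * P.coeff (k - i)) := fun i => by
        rw [Nat.add_sub_add_right, show j + (i + 1) = j + 1 + i by ring]; ring
      simp only [e, Finset.sum_neg_distrib, pow_zero, one_mul, add_zero, Nat.sub_zero]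
      ring
  have hd : derivative P = s 1 := by
    rw [hP, derivative_det_eq_trace]
    congr 2
    ext i j
    simp [hA, Matrix.one_apply]
    split_ifs <;> simp
  have := congrArg (fun p => p.coeff k) hd
  simp only [coeff_derivative, hcoeff] at this
  rw [mul_comm, this]
  refine Finset.sum_congr rfl fun j _ => ?_
  rw [add_comm 1 j]

end NewtonIdentities

section SkewDeterminant

/-- The determinant of a skew-symmetric matrix over a field is a square. -/
theorem exists_sq_eq_det_of_skew {F : Type*} [Field F] (h2 : (2 : F) ≠ 0) {n : Type*} [Fintype n]
    [DecidableEq n] (M : Matrix n n F) (hM : Mᵀ = -M) : ∃ p, p ^ 2 = M.det := by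
  induction hN : Fintype.card n using Nat.strong_induction_on generalizing n with
  | _ N ih =>
    have hMa : ∀ i j, M j i = -M i j := fun i j => congrFun (congrFun hM i) j
    have hd : ∀ i, M i i = 0 := fun i => by
      have : 2 * M i i = 0 := by rw [two_mul]; nth_rewrite 1 [hMa i i]; ring
      exact (mul_eq_zero.1 this).resolve_left h2
    by_cases h0 : M = 0
    · rcases isEmpty_or_nonempty n with hn | hn
      · exact ⟨1, by rw [det_isEmpty, one_pow]⟩
      · exact ⟨0, by rw [h0, det_zero]; simp⟩
    obtain ⟨i, j, hij⟩ : ∃ i j, M i j ≠ 0 := by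
      by_contra! hcon
      exact h0 (by ext i j; exact hcon i j)
    have hne : i ≠ j := by rintro rfl; exact hij (hd i)
    let p : n → Prop := fun k => k = i ∨ k = j
    set A := toBlock M p p with hA
    set B := toBlock M p (fun k => ¬ p k) with hB
    set C := toBlock M (fun k => ¬ p k) p with hC
    set D := toBlock M (fun k => ¬ p k) (fun k => ¬ p k) with hD
    have hdetA : A.det = (M i j) ^ 2 := by
      let f : Fin 2 → {k // p k} := ![⟨i, Or.inl rfl⟩, ⟨j, Or.inr rfl⟩]
      have hf : Function.Bijective f := by
        constructor
        · intro a b hab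
          fin_cases a <;> fin_cases b
          · rfl
          · exact absurd (congrArg Subtype.val hab) hne
          · exact absurd (congrArg Subtype.val hab).symm hne
          · rfl
        · rintro ⟨k, rfl | rfl⟩
          · exact ⟨0, rfl⟩
          · exact ⟨1, rfl⟩
      rw [← det_submatrix_equiv_self (Equiv.ofBijective f hf), det_fin_two]
      change M i i * M j j - M i j * M j i = _
      rw [hd, hd, hMa i j]; ring
    have hdet0 : IsUnit A.det := by rw [hdetA]; exact (pow_ne_zero 2 hij).isUnit
    have : Invertible A := A.invertibleOfIsUnitDet hdet0
    have hAT : Aᵀ = -A := by ext a b; exact hMa _ _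
    have hBT : Bᵀ = -C := by ext a b; exact hMa _ _
    have hCT : Cᵀ = -B := by ext a b; exact hMa _ _
    have hDT : Dᵀ = -D := by ext a b; exact hMa _ _
    have hAi : (A⁻¹)ᵀ = -A⁻¹ := by
      rw [transpose_nonsing_inv, hAT]
      refine inv_eq_right_inv ?_
      rw [neg_mul_neg, mul_nonsing_inv _ hdet0]
    have hcard : Fintype.card {k // ¬ p k} < N := by
      rw [← hN]
      exact Fintype.card_subtype_lt (x := i) (by simp [p])
    obtain ⟨q, hq⟩ := ih _ hcard (D - C * A⁻¹ * B) (by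
      rw [transpose_sub, transpose_mul, transpose_mul, hDT, hBT, hCT, hAi]
      simp [Matrix.mul_assoc]
      abel) rfl
    refine ⟨M i j * q, ?_⟩
    rw [det_toBlock M p, det_fromBlocks₁₁, invOf_eq_nonsing_inv, mul_pow, hq, ← hdetA]

theorem det_fromBlocks_one_neg_one {K : Type*} [CommRing K] {n : Type*} [Fintype n]
    [DecidableEq n] (A B : Matrix n n K) : (fromBlocks A 1 (-1) B).det = (1 + B * A).det := by
  have h1 : fromBlocks A 1 (-1) B = fromBlocks 1 1 0 1 * (fromBlocks 1 0 (-1) 1 *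
      (fromBlocks 1 1 0 1 * (fromBlocks (1 + B * A) (-B) 0 1 * fromBlocks 1 0 A 1))) := by
    simp [fromBlocks_multiply]
  rw [h1]
  simp [det_mul]

open Polynomial in
/-- The determinant of `1 + X • (A * B)` for skew-symmetric `A`, `B` is a square. -/
theorem exists_sq_eq_det_one_add_mul {K : Type*} [CommRing K] [IsDomain K]
    [UniqueFactorizationMonoid K] [CharZero K] {n : Type*} [Fintype n] [DecidableEq n]
    (A B : Matrix n n K) (hA : Aᵀ = -A) (hB : Bᵀ = -B) :
    ∃ q : K[X], q.coeff 0 = 1 ∧ q ^ 2 = (1 + (X : K[X]) • (A * B).map C).det := by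
  let F := FractionRing K[X]
  have hskew : (fromBlocks (B.map C) 1 (-1) ((X : K[X]) • A.map C))ᵀ =
      -fromBlocks (B.map C) 1 (-1) ((X : K[X]) • A.map C) := by
    have h1 : (B.map (C : K → K[X]))ᵀ = -B.map C := by
      rw [← transpose_map, hB]; ext; simp
    have h2 : (A.map (C : K → K[X]))ᵀ = -A.map C := by
      rw [← transpose_map, hA]; ext; simp
    rw [fromBlocks_transpose, fromBlocks_neg, transpose_smul, h1, h2]
    simp
  have hdet : (fromBlocks (B.map C) 1 (-1) ((X : K[X]) • A.map C)).det =
      (1 + (X : K[X]) • (A * B).map C).det := by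
    rw [det_fromBlocks_one_neg_one, Matrix.map_mul, smul_mul_assoc]
  obtain ⟨p, hp⟩ := exists_sq_eq_det_of_skew (F := F) two_ne_zero
    ((fromBlocks (B.map C) 1 (-1) ((X : K[X]) • A.map C)).map (algebraMap K[X] F)) (by
      rw [← transpose_map, hskew]; ext; simp)
  rw [← RingHom.mapMatrix_apply, ← RingHom.map_det, hdet] at hp
  obtain ⟨q, hq⟩ := IsIntegrallyClosed.exists_algebraMap_eq_of_isIntegral_pow (R := K[X])
    (x := p) two_pos (by rw [hp]; exact isIntegral_algebraMap)
  rw [← hq, ← map_pow] at hp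
  have hq2 := IsFractionRing.injective K[X] F hp
  have h0 : q.coeff 0 ^ 2 = 1 := by
    rw [coeff_zero_eq_eval_zero, ← eval_pow, hq2, ← coe_evalRingHom, RingHom.map_det]
    have : (evalRingHom (0 : K)).mapMatrix (1 + (X : K[X]) • (A * B).map C) = 1 := by
      ext i j
      simp [Matrix.one_apply]
      split_ifs <;> simp
    rw [this, det_one]
  rcases sq_eq_one_iff.1 h0 with h0 | h0
  · exact ⟨q, h0, hq2⟩
  · exact ⟨-q, by rw [coeff_neg, h0, neg_neg], by rw [neg_sq, hq2]⟩

open Polynomial in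
theorem coeff_derivative_of_sq_eq {K : Type*} [CommRing K] [IsDomain K] {p q : K[X]}
    (hpq : q ^ 2 = p) (h0 : q ≠ 0) (t : ℕ → K)
    (hp : ∀ k : ℕ, (k + 1) * p.coeff (k + 1) = ∑ j ∈ Finset.range (k + 1), t j * p.coeff (k - j))
    (k : ℕ) :
    2 * (k + 1) * q.coeff (k + 1) = ∑ j ∈ Finset.range (k + 1), t j * q.coeff (k - j) := by
  have h1 : ((derivative p : K[X]) : PowerSeries K) = PowerSeries.mk t * (p : PowerSeries K) := by
    ext k
    rw [coeff_coe, coeff_derivative, mul_comm, hp, PowerSeries.coeff_mul,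
      Finset.Nat.sum_antidiagonal_eq_sum_range_succ_mk]
    simp
  have h2 : ((2 * derivative q : K[X]) : PowerSeries K) =
      PowerSeries.mk t * (q : PowerSeries K) := by
    have hq0 : (q : PowerSeries K) ≠ 0 := by
      rwa [Ne, Polynomial.coe_eq_zero_iff]
    apply mul_left_cancel₀ hq0
    rw [← hpq, derivative_pow] at h1
    push_cast at h1 ⊢
    simp at h1
    have e : ((2 : K[X]) : PowerSeries K) = PowerSeries.C 2 := by
      rw [show (2 : K[X]) = C 2 from (map_ofNat C 2).symm, coe_C]
    rw [e]
    linear_combination h1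
  have h3 := congrArg (PowerSeries.coeff k) h2
  rw [coeff_coe, PowerSeries.coeff_mul, Finset.Nat.sum_antidiagonal_eq_sum_range_succ_mk] at h3
  have e : (2 * derivative q).coeff k = 2 * (k + 1) * q.coeff (k + 1) := by
    rw [show (2 : K[X]) = C 2 from (map_ofNat C 2).symm, coeff_C_mul, coeff_derivative]; ring
  rw [← e, h3]
  simp only [PowerSeries.coeff_mk, coeff_coe]

end SkewDeterminant

section TraceQuotient

open Polynomial

universe w w'

variable {R : Type w} {A : Type w'} [Field R] [LinearOrder R] [IsStrictOrderedRing R] [Ring A]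
  [Algebra R A]

/-- The kernel of the bilinear form `(a, b) ↦ τ (a * b)`. -/
def traceKernel (τ : A →ₗ[R] R) (hcomm : ∀ a b, τ (a * b) = τ (b * a)) : Ideal A where
  carrier := {a | ∀ y, τ (a * y) = 0}
  add_mem' ha hb y := by rw [add_mul, map_add, ha y, hb y, add_zero]
  zero_mem' y := by rw [zero_mul, map_zero]
  smul_mem' c a ha y := by rw [smul_eq_mul, mul_assoc, hcomm, mul_assoc, ha]

instance traceKernel_isTwoSided (τ : A →ₗ[R] R) (hcomm : ∀ a b, τ (a * b) = τ (b * a)) :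
    (traceKernel τ hcomm).IsTwoSided :=
  ⟨fun {a} b ha y => by rw [mul_assoc, ha]⟩

theorem apply_mul_eq_zero_of_apply_mul_star_self [StarRing A] (τ : A →ₗ[R] R)
    (hsmul : ∀ (r : R) (a : A), star (r • a) = r • star a) (hstar : ∀ a, τ (star a) = τ a)
    (hpos : ∀ a, 0 ≤ τ (a * star a)) {b : A} (hb : τ (b * star b) = 0) (y : A) :
    τ (b * y) = 0 := by
  have key : ∀ r : R, 0 ≤ 2 * r * τ (b * y) + r ^ 2 * τ (star y * y) := by
    intro r
    have h1 := hpos (b + r • star y)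
    have h2 : τ (star y * star b) = τ (b * y) := by rw [← star_mul, hstar]
    rw [star_add, hsmul, star_star, add_mul, mul_add, mul_add] at h1
    simp only [map_add, smul_mul_assoc, mul_smul_comm, map_smul, smul_eq_mul, hb, h2] at h1
    linarith
  set c := τ (b * y)
  set d := τ (star y * y)
  by_contra hc
  have hd : 0 ≤ d := by simpa using hpos (star y)
  have h1 := key (-c / (d + 1))
  have hd1 : 0 < d + 1 := by linarith
  have e : 2 * (-c / (d + 1)) * c + (-c / (d + 1)) ^ 2 * d = -(c ^ 2 * (d + 2)) / (d + 1) ^ 2 := by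
    field_simp; ring
  rw [e, neg_div] at h1
  have : 0 < c ^ 2 * (d + 2) / (d + 1) ^ 2 := by positivity
  linarith

theorem exists_isMatricialTrace_quotient [StarRing A] (τ : A →ₗ[R] R)
    (hsmul : ∀ (r : R) (a : A), star (r • a) = r • star a)
    (hcomm : ∀ a b, τ (a * b) = τ (b * a)) (hstar : ∀ a, τ (star a) = τ a)
    (hpos : ∀ a, 0 ≤ τ (a * star a))
    (hint : ∀ a, ∃ p : R[X], p.Monic ∧ ∀ y, τ (aeval a p * y) = 0)
    (hnewton : ∀ a, HasNewtonSequence 1 fun j => τ (a ^ j))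
    (hskew : ∀ u v : A, star u = -u → star v = -v →
      HasNewtonSequence 2 fun j => τ ((u * v) ^ j)) :
    ∃ (B : Type w') (_ : Ring B) (_ : Algebra R B) (_ : StarRing B) (q : A →ₐ[R] B)
      (τ' : B →ₗ[R] R), IsMatricialTrace τ' ∧ Function.Surjective q ∧
      (∀ a, q (star a) = star (q a)) ∧ (∀ a, τ' (q a) = τ a) ∧
      ∀ a, (∀ y, τ (a * y) = 0) → q a = 0 := by
  let N := traceKernel τ hcomm
  have hmem : ∀ a, a ∈ N ↔ ∀ y, τ (a * y) = 0 := fun a => Iff.rfl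
  have hNstar : ∀ a ∈ N, star a ∈ N := by
    intro a ha y
    rw [← hstar, star_mul, star_star, hcomm]
    exact ha _
  let B := A ⧸ N
  let q : A →ₐ[R] B := Ideal.Quotient.mkₐ R N
  have hqs : Function.Surjective q := Ideal.Quotient.mkₐ_surjective R N
  have hq0 : ∀ a, q a = 0 ↔ a ∈ N := fun a => Ideal.Quotient.eq_zero_iff_mem
  have hqe : ∀ a b, q a = q b ↔ a - b ∈ N := fun a b => by rw [← hq0, map_sub, sub_eq_zero]
  have hinv : ∀ b, q (Function.surjInv hqs b) = b := Function.surjInv_eq hqs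
  let st : B → B := fun b => q (star (Function.surjInv hqs b))
  have hst : ∀ a, st (q a) = q (star a) := by
    intro a
    rw [hqe, ← star_sub]
    exact hNstar _ ((hqe _ _).1 (Function.surjInv_eq hqs _))
  let _ : StarRing B :=
    { star := st
      star_involutive := fun b => by
        obtain ⟨a, rfl⟩ := hqs b
        refine (congrArg st (hst a)).trans ?_
        rw [hst, star_star]
      star_mul := fun b c => by
        obtain ⟨a, rfl⟩ := hqs b
        obtain ⟨a', rfl⟩ := hqs c
        change st (q a * q a') = st (q a') * st (q a)
        rw [← map_mul, hst, hst, hst, star_mul, map_mul]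
      star_add := fun b c => by
        obtain ⟨a, rfl⟩ := hqs b
        obtain ⟨a', rfl⟩ := hqs c
        change st (q a + q a') = st (q a) + st (q a')
        rw [← map_add, hst, hst, hst, star_add, map_add] }
  have hqstar : ∀ a, q (star a) = star (q a) := fun a => (hst a).symm
  have hτN : ∀ a, q a = 0 → τ a = 0 := fun a ha => by
    simpa using (hq0 a).1 ha 1
  let τ' : B →ₗ[R] R :=
    { toFun := fun b => τ (Function.surjInv hqs b)
      map_add' := fun b c => by
        rw [← map_add, ← sub_eq_zero, ← map_sub]
        refine hτN _ ?_
        rw [map_sub, map_add, hinv, hinv, hinv, sub_self]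
      map_smul' := fun r c => by
        rw [RingHom.id_apply, ← map_smul, ← sub_eq_zero, ← map_sub]
        refine hτN _ ?_
        rw [map_sub, map_smul, hinv, hinv, sub_self] }
  have hτ' : ∀ a, τ' (q a) = τ a := by
    intro a
    change τ (Function.surjInv hqs (q a)) = τ a
    rw [← sub_eq_zero, ← map_sub]
    refine hτN _ ?_
    rw [map_sub, hinv, sub_self]
  have hlift : ∀ u : B, star u = -u → ∃ a, q a = u ∧ star a = -a := by
    intro u hu
    obtain ⟨a, rfl⟩ := hqs u
    refine ⟨(2 : R)⁻¹ • (a - star a), ?_, ?_⟩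
    · rw [map_smul, map_sub, hqstar, hu, sub_neg_eq_add, ← two_smul R, smul_smul,
        inv_mul_cancel₀ two_ne_zero, one_smul]
    · rw [hsmul, star_sub, star_star, ← smul_neg, neg_sub]
  refine ⟨B, inferInstance, inferInstance, inferInstance, q, τ', ?_, hqs, hqstar, hτ',
    fun a ha => (hq0 a).2 ha⟩
  constructor
  · intro r b
    obtain ⟨a, rfl⟩ := hqs b
    rw [← map_smul, ← hqstar, ← hqstar, hsmul, map_smul]
  · intro b c
    obtain ⟨a, rfl⟩ := hqs b
    obtain ⟨a', rfl⟩ := hqs c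
    rw [← map_mul, ← map_mul, hτ', hτ', hcomm]
  · intro b
    obtain ⟨a, rfl⟩ := hqs b
    rw [← hqstar, hτ', hτ', hstar]
  · intro b hb
    obtain ⟨a, rfl⟩ := hqs b
    rw [← hqstar, ← map_mul, hτ']
    refine (hpos a).lt_of_ne' fun h0 => hb ((hq0 a).2 ?_)
    exact apply_mul_eq_zero_of_apply_mul_star_self τ hsmul hstar hpos h0
  · intro b
    obtain ⟨a, rfl⟩ := hqs b
    obtain ⟨p, hp, hp0⟩ := hint a
    refine ⟨p, hp, ?_⟩
    rw [← aeval_def, aeval_algHom_apply]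
    exact (hq0 _).2 hp0
  · intro b
    obtain ⟨a, rfl⟩ := hqs b
    simpa only [← map_pow, hτ'] using hnewton a
  · intro u v hu hv
    obtain ⟨a, rfl, ha⟩ := hlift u hu
    obtain ⟨b, rfl, hb⟩ := hlift v hv
    simpa only [← map_mul, ← map_pow, hτ'] using hskew a b ha hb

end TraceQuotient

open scoped TensorProduct in
/-- A homomorphism from an algebra of polynomials over `k` to an extension field `R` extends to the
`R`-algebra generated by these polynomials. -/
theorem exists_extension_adjoin_map {k R : Type*} [Field k] [Field R] [Algebra k R] {σ : Type*}
    (A : Subalgebra k (MvPolynomial σ k)) (φ : A →ₐ[k] R) :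
    ∃ Φ : Algebra.adjoin R (MvPolynomial.map (algebraMap k R) '' (A : Set (MvPolynomial σ k))) →ₐ[R]
      R, ∀ c (hc : c ∈ A) (h), Φ ⟨MvPolynomial.map (algebraMap k R) c, h⟩ = φ ⟨c, hc⟩ := by
  let ι : R ⊗[k] A →ₐ[R] MvPolynomial σ R :=
    (MvPolynomial.algebraTensorAlgEquiv k R).toAlgHom.comp
      (Algebra.TensorProduct.map (AlgHom.id R R) A.val)
  have hι : Function.Injective ι := by
    refine (MvPolynomial.algebraTensorAlgEquiv k R).injective.comp ?_
    exact Module.Flat.lTensor_preserves_injective_linearMap (M := R) A.val.toLinearMap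
      Subtype.val_injective
  have hι1 : ∀ c : A, ι (1 ⊗ₜ c) = MvPolynomial.map (algebraMap k R) c.1 := by
    intro c
    simp [ι]
  have hle : Algebra.adjoin R
      (MvPolynomial.map (algebraMap k R) '' (A : Set (MvPolynomial σ k))) ≤ ι.range := by
    refine Algebra.adjoin_le ?_
    rintro _ ⟨c, hc, rfl⟩
    exact ⟨1 ⊗ₜ ⟨c, hc⟩, hι1 ⟨c, hc⟩⟩
  let e := AlgEquiv.ofInjective ι hι
  let l : R ⊗[k] A →ₐ[R] R :=
    Algebra.TensorProduct.lift (AlgHom.id R R) φ fun _ _ => Commute.all _ _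
  refine ⟨(l.comp e.symm.toAlgHom).comp (Subalgebra.inclusion hle), fun c hc h => ?_⟩
  have : e.symm (Subalgebra.inclusion hle ⟨MvPolynomial.map (algebraMap k R) c, h⟩) =
      1 ⊗ₜ ⟨c, hc⟩ := by
    rw [AlgEquiv.symm_apply_eq]
    ext1
    exact (hι1 ⟨c, hc⟩).symm
  refine (congrArg l this).trans ?_
  simp [l]

section ScalarExtension

open Polynomial

/-- The polynomials `p` for which the scalar matrix `p • 1` lies in `A`. -/
def scalarSubalgebra {k P ι : Type*} [Field k] [CommRing P] [Algebra k P] [Fintype ι]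
    [DecidableEq ι] (A : Subalgebra k (Matrix ι ι P)) : Subalgebra k P :=
  A.comap ((Algebra.ofId P (Matrix ι ι P)).restrictScalars k)

theorem mem_scalarSubalgebra {k P ι : Type*} [Field k] [CommRing P] [Algebra k P] [Fintype ι]
    [DecidableEq ι] {A : Subalgebra k (Matrix ι ι P)} {p : P} :
    p ∈ scalarSubalgebra A ↔ p • (1 : Matrix ι ι P) ∈ A := by
  rw [← Algebra.algebraMap_eq_smul_one]
  rfl

theorem smul_mem_of_mem_scalarSubalgebra {k P ι : Type*} [Field k] [CommRing P] [Algebra k P]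
    [Fintype ι] [DecidableEq ι] {A : Subalgebra k (Matrix ι ι P)} {p : P} {h : Matrix ι ι P}
    (hp : p ∈ scalarSubalgebra A) (hh : h ∈ A) : p • h ∈ A := by
  have := A.mul_mem (mem_scalarSubalgebra.1 hp) hh
  rwa [smul_mul_assoc, one_mul] at this

variable {R P : Type*} [Field R] [CharZero R] [CommRing P] [Algebra R P]

theorem coeff_mem_of_newton (Z : Subalgebra R P) (w : ℕ) (hw : w ≠ 0) (e t : ℕ → P)
    (ht : ∀ j, t (j + 1) ∈ Z) (h0 : e 0 = 1)
    (he : ∀ k : ℕ, (w : P) * (k + 1) * e (k + 1) =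
      ∑ j ∈ Finset.range (k + 1), (-1) ^ j * t (j + 1) * e (k - j)) (k : ℕ) : e k ∈ Z := by
  induction k using Nat.strong_induction_on with
  | _ k ih =>
    rcases k with _ | k
    · rw [h0]; exact Z.one_mem
    have h1 : (w : P) * (k + 1) * e (k + 1) ∈ Z := by
      rw [he]
      refine Z.sum_mem fun j hj => ?_
      refine Z.mul_mem (Z.mul_mem (Z.pow_mem (Z.neg_mem Z.one_mem) _) (ht j)) (ih _ (by omega))
    have h2 := Z.smul_mem h1 ((w : R) * (k + 1))⁻¹
    have h3 : (w : P) * (k + 1) * e (k + 1) = ((w : R) * (k + 1)) • e (k + 1) := by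
      rw [Algebra.smul_def]; simp
    rwa [h3, smul_smul, inv_mul_cancel₀, one_smul] at h2
    exact mul_ne_zero (Nat.cast_ne_zero.2 hw) (Nat.cast_add_one_ne_zero k)

theorem hasNewtonSequence_of_coeff (Z : Subalgebra R P) (Φ : Z →ₐ[R] R) (w : ℕ) (hw : w ≠ 0)
    (e t : ℕ → P) (ht : ∀ j, t (j + 1) ∈ Z) (h0 : e 0 = 1)
    (he : ∀ k : ℕ, (w : P) * (k + 1) * e (k + 1) =
      ∑ j ∈ Finset.range (k + 1), (-1) ^ j * t (j + 1) * e (k - j))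
    (hN : ∃ N, ∀ k, N ≤ k → e k = 0) (t' : ℕ → R) (ht' : ∀ j, t' (j + 1) = Φ ⟨t (j + 1), ht j⟩) :
    HasNewtonSequence (w : R) t' := by
  have hm := coeff_mem_of_newton Z w hw e t ht h0 he
  refine ⟨fun k => Φ ⟨e k, hm k⟩, ?_, fun k => ?_, ?_⟩
  · exact (congrArg Φ (Subtype.ext h0 : (⟨e 0, hm 0⟩ : Z) = 1)).trans (map_one Φ)
  · have h1 : (w : Z) * (k + 1) * ⟨e (k + 1), hm (k + 1)⟩ =
        ∑ j ∈ Finset.range (k + 1), (-1) ^ j * ⟨t (j + 1), ht j⟩ * ⟨e (k - j), hm (k - j)⟩ := by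
      ext1
      push_cast
      exact he k
    have h2 := congrArg Φ h1
    simp only [map_mul, map_sum, map_pow, map_neg, map_one, map_add, map_natCast] at h2
    rw [h2]
    exact Finset.sum_congr rfl fun j _ => by rw [ht']
  · obtain ⟨N, hN⟩ := hN
    refine ⟨N, fun k hk => ?_⟩
    exact (congrArg Φ (Subtype.ext (hN k hk) : (⟨e k, hm k⟩ : Z) = 0)).trans (map_zero Φ)

variable {ι : Type*} [Fintype ι] [DecidableEq ι]

theorem coeff_zero_det_one_add (M : Matrix ι ι P) :
    (1 + (X : P[X]) • M.map C).det.coeff 0 = 1 := by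
  rw [coeff_zero_eq_eval_zero, ← coe_evalRingHom, RingHom.map_det]
  have : (evalRingHom (0 : P)).mapMatrix (1 + (X : P[X]) • M.map C) = 1 := by
    ext i j
    simp [Matrix.one_apply]
    split_ifs <;> simp
  rw [this, det_one]

theorem det_one_add_eq_charpolyRev (M : Matrix ι ι P) :
    (1 + (X : P[X]) • M.map C).det = (-M).charpolyRev := by
  rw [charpolyRev]
  congr 1
  ext i j
  simp

theorem charpoly_coeff_mem (Z : Subalgebra R P) (M : Matrix ι ι P)
    (hM : ∀ j, (M ^ (j + 1)).trace ∈ Z) (i : ℕ) : M.charpoly.coeff i ∈ Z := by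
  nontriviality P
  have h1 : ∀ k, (-(-M)).charpolyRev.coeff k ∈ Z := by
    rw [← det_one_add_eq_charpolyRev]
    refine coeff_mem_of_newton Z 1 one_ne_zero _ (fun j => ((-M) ^ j).trace) (fun j => ?_)
      (coeff_zero_det_one_add _) fun k => ?_
    · rw [← neg_one_smul P M, _root_.smul_pow, trace_smul, smul_eq_mul]
      exact Z.mul_mem (Z.pow_mem (Z.neg_mem Z.one_mem) _) (hM j)
    · rw [Nat.cast_one, one_mul]
      exact coeff_derivative_det_one_add _ k
  rw [neg_neg, ← reverse_charpoly] at h1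
  rcases lt_or_ge M.charpoly.natDegree i with hi | hi
  · rw [coeff_eq_zero_of_natDegree_lt hi]; exact Z.zero_mem
  · have := h1 (M.charpoly.natDegree - i)
    rwa [coeff_reverse, revAt_le (Nat.sub_le _ _), Nat.sub_sub_self hi] at this

end ScalarExtension

theorem exists_sum_of_mem_adjoin_map {k R A' B' : Type*} [CommRing k] [CommRing R] [Ring A']
    [Ring B'] [Algebra k A'] [Algebra R B'] (A : Subalgebra k A') (f : A' →+* B') {x : B'}
    (hx : x ∈ Algebra.adjoin R (f '' (A : Set A'))) :
    ∃ (m : ℕ) (r : Fin m → R) (h : Fin m → A'), (∀ i, h i ∈ A) ∧ x = ∑ i, r i • f (h i) := by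
  have e : (Submonoid.closure (f '' (A : Set A')) : Set B') = f '' (A : Set A') :=
    congrArg _ (A.toSubmonoid.map (f : A' →* B')).closure_eq
  rw [← Subalgebra.mem_toSubmodule, Algebra.adjoin_eq_span, e, Submodule.mem_span_set'] at hx
  obtain ⟨m, r, y, rfl⟩ := hx
  choose h hh hy using fun i => (y i).2
  exact ⟨m, r, h, hh, by simp [hy]⟩

section MatrixExtension

variable {k P ι : Type*} [Field k] [CommRing P] [Algebra k P] [Fintype ι] [DecidableEq ι]
  {R Q : Type*} [Field R] [CommRing Q] [Algebra R Q] {A : Subalgebra k (Matrix ι ι P)}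
  (ρ : P →+* Q)

theorem transpose_mem_adjoin_map (hT : ∀ h ∈ A, hᵀ ∈ A) {x : Matrix ι ι Q}
    (hx : x ∈ Algebra.adjoin R (ρ.mapMatrix '' (A : Set (Matrix ι ι P)))) :
    xᵀ ∈ Algebra.adjoin R (ρ.mapMatrix '' (A : Set (Matrix ι ι P))) := by
  obtain ⟨m, r, h, hh, rfl⟩ := exists_sum_of_mem_adjoin_map A _ hx
  rw [transpose_sum]
  refine Subalgebra.sum_mem _ fun i _ => ?_
  rw [transpose_smul]
  refine Subalgebra.smul_mem _ (Algebra.subset_adjoin ?_) _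
  exact ⟨(h i)ᵀ, hT _ (hh i), (transpose_map ..).symm⟩

theorem trace_mem_adjoin_map (htr : ∀ h ∈ A, h.trace ∈ scalarSubalgebra A) {x : Matrix ι ι Q}
    (hx : x ∈ Algebra.adjoin R (ρ.mapMatrix '' (A : Set (Matrix ι ι P)))) :
    x.trace ∈ Algebra.adjoin R (ρ '' (scalarSubalgebra A : Set P)) := by
  obtain ⟨m, r, h, hh, rfl⟩ := exists_sum_of_mem_adjoin_map A _ hx
  rw [trace_sum]
  refine Subalgebra.sum_mem _ fun i _ => ?_
  rw [trace_smul]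
  refine Subalgebra.smul_mem _ (Algebra.subset_adjoin ?_) _
  exact ⟨(h i).trace, htr _ (hh i), AddMonoidHom.map_trace ρ _⟩

theorem smul_mem_adjoin_map {p : Q} (hp : p ∈ Algebra.adjoin R (ρ '' (scalarSubalgebra A : Set P)))
    {x : Matrix ι ι Q} (hx : x ∈ Algebra.adjoin R (ρ.mapMatrix '' (A : Set (Matrix ι ι P)))) :
    p • x ∈ Algebra.adjoin R (ρ.mapMatrix '' (A : Set (Matrix ι ι P))) := by
  obtain ⟨m, r, h, hh, rfl⟩ := exists_sum_of_mem_adjoin_map _ _ hp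
  rw [Finset.sum_smul]
  refine Subalgebra.sum_mem _ fun i _ => ?_
  rw [smul_assoc]
  refine Subalgebra.smul_mem _ ?_ _
  have : ρ (h i) • x = ρ.mapMatrix (h i • 1) * x := by
    ext a b
    simp [Matrix.mul_apply, Matrix.one_apply, apply_ite ρ]
  rw [this]
  exact Subalgebra.mul_mem _
    (Algebra.subset_adjoin ⟨_, mem_scalarSubalgebra.1 (hh i), rfl⟩) hx

end MatrixExtension

section TraceRepresentation

open Polynomial

variable {R Q : Type*} [Field R] [LinearOrder R] [IsStrictOrderedRing R] [CommRing Q] [IsDomain Q]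
    [UniqueFactorizationMonoid Q] [CharZero Q] [Algebra R Q] {n : ℕ}
    {Z : Subalgebra R Q} {E : Subalgebra R (Matrix (Fin n) (Fin n) Q)}

theorem exists_representation_of_trace (hR : HasRealFactors R)
    (hET : ∀ x ∈ E, xᵀ ∈ E) (hEtr : ∀ x ∈ E, x.trace ∈ Z) (hsmul : ∀ p ∈ Z, ∀ x ∈ E, p • x ∈ E)
    (Φ : Z →ₐ[R] R)
    (hpos : ∀ (x) (hx : x ∈ E), 0 ≤ Φ ⟨(x * xᵀ).trace, hEtr _ (E.mul_mem hx (hET x hx))⟩) :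
    ∃ π : E →ₐ[R] Matrix (Fin n) (Fin n) R,
      (∀ (x) (hx : x ∈ E), π ⟨xᵀ, hET x hx⟩ = (π ⟨x, hx⟩)ᵀ) ∧
      (∀ (x) (hx : x ∈ E), (π ⟨x, hx⟩).trace = Φ ⟨x.trace, hEtr x hx⟩) ∧
      (∀ (p) (hp : p ∈ Z), π ⟨p • 1, hsmul p hp 1 E.one_mem⟩ = Φ ⟨p, hp⟩ • 1) ∧
      ∀ (s) (hs : s ∈ E), sᵀ = s →
        (∀ (x) (hx : x ∈ E),
          0 ≤ Φ ⟨(x * s * xᵀ).trace, hEtr _ (E.mul_mem (E.mul_mem hx hs) (hET x hx))⟩) →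
        ∃ W, Wᵀ = W ∧ W * W = π ⟨s, hs⟩ := by
  let _ : StarRing E :=
    { star := fun x => ⟨x.1ᵀ, hET x.1 x.2⟩
      star_involutive := fun x => Subtype.ext (transpose_transpose _)
      star_mul := fun x y => Subtype.ext (transpose_mul _ _)
      star_add := fun x y => Subtype.ext (transpose_add _ _) }
  have hstar : ∀ x : E, (star x).1 = x.1ᵀ := fun _ => rfl
  let trZ : E →ₗ[R] Z :=
    { toFun := fun x => ⟨x.1.trace, hEtr x.1 x.2⟩
      map_add' := fun x y => Subtype.ext (trace_add x.1 y.1)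
      map_smul' := fun r x => Subtype.ext (trace_smul r x.1) }
  let τ : E →ₗ[R] R := Φ.toLinearMap ∘ₗ trZ
  have hτ : ∀ (x : E) (p) (hp : p ∈ Z), x.1.trace = p → τ x = Φ ⟨p, hp⟩ := by
    rintro x p hp rfl; rfl
  have hτs : ∀ (p : Z) (x : E), τ ⟨p.1 • x.1, hsmul p.1 p.2 x.1 x.2⟩ = Φ p * τ x := by
    intro p x
    refine Eq.trans ?_ (map_mul Φ p (trZ x))
    exact congrArg Φ (Subtype.ext (trace_smul p.1 x.1))
  have hcomm : ∀ x y, τ (x * y) = τ (y * x) := fun x y =>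
    congrArg Φ (Subtype.ext (trace_mul_comm x.1 y.1))
  have hpow : ∀ (x : E) j, (x.1 ^ (j + 1)).trace ∈ Z := fun x j => hEtr _ (E.pow_mem x.2 _)
  obtain ⟨B, _, _, _, q, τ', hB, hq, hqs, hqτ, hq0⟩ := exists_isMatricialTrace_quotient τ
    (fun r x => Subtype.ext (transpose_smul r x.1)) hcomm
    (fun x => congrArg Φ (Subtype.ext (trace_transpose x.1)))
    (fun x => hpos x.1 x.2)
    (fun x => by
      have h1 : x.1.charpoly ∈ Polynomial.lifts (algebraMap Z Q) := by
        rw [Polynomial.lifts_iff_coeff_lifts]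
        exact fun i => ⟨⟨_, charpoly_coeff_mem Z x.1 (hpow x) i⟩, rfl⟩
      obtain ⟨p, hp, -, hpm⟩ := lifts_and_degree_eq_and_monic h1 (charpoly_monic _)
      refine ⟨p.map (Φ : Z →+* R), hpm.map _, fun y => ?_⟩
      have h2 : ∑ i ∈ Finset.range (p.natDegree + 1), (p.coeff i).1 • (x.1 ^ i * y.1) = 0 := by
        have := aeval_self_charpoly x.1
        rw [← hp, aeval_map_algebraMap, aeval_eq_sum_range] at this
        have := congrArg (· * y.1) this
        simp only [Finset.sum_mul, zero_mul, smul_mul_assoc] at this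
        exact this
      have h3 : aeval x (p.map (Φ : Z →+* R)) * y =
          ∑ i ∈ Finset.range (p.natDegree + 1), Φ (p.coeff i) • (x ^ i * y) := by
        rw [aeval_eq_sum_range' (n := p.natDegree + 1)
          (Nat.lt_succ_of_le (natDegree_map_le)), Finset.sum_mul]
        simp only [coeff_map, smul_mul_assoc]
        rfl
      rw [h3, map_sum]
      simp only [map_smul, smul_eq_mul, ← hτs]
      rw [← map_sum]
      refine (congrArg τ (Subtype.ext ?_)).trans (map_zero τ)
      push_cast
      exact h2)
    (fun x => by
      have := hasNewtonSequence_of_coeff Z Φ 1 one_ne_zero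
        (fun i => (1 + (X : Q[X]) • x.1.map C).det.coeff i) (fun j => (x.1 ^ j).trace) (hpow x)
        (coeff_zero_det_one_add _)
        (fun k => by rw [Nat.cast_one, one_mul]; exact coeff_derivative_det_one_add _ k)
        ⟨_, fun k hk => coeff_eq_zero_of_natDegree_lt (Nat.lt_of_succ_le hk)⟩
        (fun j => τ (x ^ j)) (fun j => rfl)
      rwa [Nat.cast_one] at this)
    (fun u v hu hv => by
      have hu' : u.1ᵀ = -u.1 := congrArg Subtype.val hu
      have hv' : v.1ᵀ = -v.1 := congrArg Subtype.val hv
      obtain ⟨p, hp0, hp⟩ := exists_sq_eq_det_one_add_mul u.1 v.1 hu' hv'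
      have := hasNewtonSequence_of_coeff Z Φ 2 two_ne_zero
        (fun i => p.coeff i) (fun j => ((u.1 * v.1) ^ j).trace) (hpow (u * v)) hp0
        (fun k => by
          simpa using coeff_derivative_of_sq_eq hp (fun h0 => by simp [h0] at hp0)
            (fun j => (-1) ^ j * ((u.1 * v.1) ^ (j + 1)).trace)
            (fun k => coeff_derivative_det_one_add (u.1 * v.1) k) k)
        ⟨_, fun k hk => coeff_eq_zero_of_natDegree_lt (Nat.lt_of_succ_le hk)⟩
        (fun j => τ ((u * v) ^ j)) (fun j => rfl)
      rwa [Nat.cast_ofNat] at this)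
  have hone : τ' 1 = n := by
    rw [← map_one q, hqτ, hτ 1 n (natCast_mem Z n) (by simp)]
    exact map_natCast Φ n
  obtain ⟨π, hπs, hπt⟩ := hB.exists_representation hR hone
  refine ⟨π.comp q, fun x hx => ?_, fun x hx => ?_, fun p hp => ?_, fun s hs hss hsp => ?_⟩
  · exact (congrArg π (hqs ⟨x, hx⟩)).trans (hπs _)
  · exact (hπt _).trans (hqτ _)
  · have h1 : q (⟨p • 1, hsmul p hp 1 E.one_mem⟩ - Φ ⟨p, hp⟩ • 1) = 0 := by
      refine hq0 _ fun y => ?_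
      rw [sub_mul, map_sub, smul_mul_assoc, one_mul, map_smul, smul_eq_mul, ← hτs, sub_eq_zero]
      refine congrArg τ (Subtype.ext ?_)
      change p • 1 * y.1 = p • y.1
      rw [smul_mul_assoc, one_mul]
    rw [map_sub, map_smul, map_one, sub_eq_zero] at h1
    refine (congrArg π h1).trans ?_
    rw [map_smul, map_one]
  · obtain ⟨r, hr, hrs⟩ := hB.exists_sqrt hR (s := q ⟨s, hs⟩)
      (by rw [← hqs]; exact congrArg q (Subtype.ext hss)) (fun b => by
        obtain ⟨x, rfl⟩ := hq b
        rw [← hqs, ← map_mul, ← map_mul, hqτ]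
        exact hsp x.1 x.2)
    refine ⟨π r, by rw [← hπs, hr], ?_⟩
    rw [← map_mul, hrs]
    rfl

end TraceRepresentation

section TraceExtension

variable {k P R : Type*} [Field k] [CommRing P] [Algebra k P] [Field R] [LinearOrder R]
  [IsStrictOrderedRing R] {n : ℕ} {A : Subalgebra k (Matrix (Fin n) (Fin n) P)}

theorem trace_form_nonneg_of_adjoin {Q : Type*} [CommRing Q] [Algebra R Q] {ρ : P →+* Q}
    (hT : ∀ h ∈ A, hᵀ ∈ A) (htr : ∀ h ∈ A, h.trace ∈ scalarSubalgebra A)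
    (φ : scalarSubalgebra A →+* R)
    (Φ : Algebra.adjoin R (ρ '' (scalarSubalgebra A : Set P)) →ₐ[R] R)
    (hΦ : ∀ c (hc : c ∈ scalarSubalgebra A) (h), Φ ⟨ρ c, h⟩ = φ ⟨c, hc⟩)
    {s : Matrix (Fin n) (Fin n) P} (hs : s ∈ A) (hss : sᵀ = s)
    (hpos : ∀ (h) (hh : h ∈ A),
      0 ≤ φ ⟨(h * s * hᵀ).trace, htr _ (A.mul_mem (A.mul_mem hh hs) (hT h hh))⟩)
    {x : Matrix (Fin n) (Fin n) Q}
    (hx : x ∈ Algebra.adjoin R (ρ.mapMatrix '' (A : Set (Matrix (Fin n) (Fin n) P)))) (h) :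
    0 ≤ Φ ⟨(x * ρ.mapMatrix s * xᵀ).trace, h⟩ := by
  obtain ⟨m, r, y, hy, rfl⟩ := exists_sum_of_mem_adjoin_map A _ hx
  have hm : ∀ i j, (y i * s * (y j)ᵀ).trace ∈ scalarSubalgebra A := fun i j =>
    htr _ (A.mul_mem (A.mul_mem (hy i) hs) (hT _ (hy j)))
  have hρ : ∀ i j, ρ (y i * s * (y j)ᵀ).trace ∈
      Algebra.adjoin R (ρ '' (scalarSubalgebra A : Set P)) := fun i j =>
    Algebra.subset_adjoin ⟨_, hm i j, rfl⟩
  have key := quadForm_nonneg_of_subring φ.range m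
    (fun i j => φ ⟨(y i * s * (y j)ᵀ).trace, hm i j⟩) (fun i j => ⟨_, rfl⟩)
    (fun i j => by
      refine congrArg φ (Subtype.ext ?_)
      change (y i * s * (y j)ᵀ).trace = (y j * s * (y i)ᵀ).trace
      rw [← trace_transpose, transpose_mul, transpose_mul, transpose_transpose, hss, mul_assoc])
    (fun c hc => by
      choose z hz using hc
      have hmem : ∑ i, (z i).1 • y i ∈ A := A.sum_mem fun i _ =>
        smul_mem_of_mem_scalarSubalgebra (z i).2 (hy i)
      have h1 := hpos _ hmem
      have h2 : (⟨((∑ i, (z i).1 • y i) * s * (∑ i, (z i).1 • y i)ᵀ).trace,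
          htr _ (A.mul_mem (A.mul_mem hmem hs) (hT _ hmem))⟩ : scalarSubalgebra A) =
          ∑ i, ∑ j, z i * z j * ⟨(y i * s * (y j)ᵀ).trace, hm i j⟩ := by
        ext1
        push_cast
        simp only [transpose_sum, transpose_smul, Finset.sum_mul, Finset.mul_sum, trace_sum,
          smul_mul_assoc, mul_smul_comm, trace_smul, smul_eq_mul]
        rw [Finset.sum_comm]
        refine Finset.sum_congr rfl fun i _ => Finset.sum_congr rfl fun j _ => by ring
      rw [h2] at h1
      simp only [map_sum, map_mul] at h1
      simp only [← hz]
      exact h1) r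
  have e : (⟨((∑ i, r i • ρ.mapMatrix (y i)) * ρ.mapMatrix s *
      (∑ i, r i • ρ.mapMatrix (y i))ᵀ).trace, h⟩ :
        Algebra.adjoin R (ρ '' (scalarSubalgebra A : Set P))) =
      ∑ i, ∑ j, (r i * r j) • ⟨ρ (y i * s * (y j)ᵀ).trace, hρ i j⟩ := by
    have hmap : ∀ M : Matrix (Fin n) (Fin n) P, (ρ.mapMatrix M)ᵀ = ρ.mapMatrix Mᵀ := fun M => rfl
    ext1
    push_cast
    simp only [transpose_sum, transpose_smul, Finset.sum_mul, Finset.mul_sum, trace_sum,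
      smul_mul_assoc, mul_smul_comm, trace_smul, Finset.smul_sum, smul_smul, hmap, ← map_mul]
    rw [Finset.sum_comm]
    refine Finset.sum_congr rfl fun i _ => Finset.sum_congr rfl fun j _ => ?_
    rw [mul_comm]
    exact congrArg _ (AddMonoidHom.map_trace ρ _).symm
  rw [e]
  simp only [map_sum, map_smul, smul_eq_mul, hΦ _ (hm _ _)]
  exact key

/-- An evaluation of the scalars of a trace algebra with values in a real field is induced by a
representation, provided that it extends to the scalars of the extended algebra. -/
theorem exists_representation_of_extension {Q : Type*} [CommRing Q] [IsDomain Q]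
    [UniqueFactorizationMonoid Q] [CharZero Q] [Algebra R Q] {ρ : P →+* Q}
    (hR : HasRealFactors R) (hT : ∀ h ∈ A, hᵀ ∈ A)
    (htr : ∀ h ∈ A, h.trace ∈ scalarSubalgebra A) (φ : scalarSubalgebra A →+* R)
    (Φ : Algebra.adjoin R (ρ '' (scalarSubalgebra A : Set P)) →ₐ[R] R)
    (hΦ : ∀ c (hc : c ∈ scalarSubalgebra A) (h), Φ ⟨ρ c, h⟩ = φ ⟨c, hc⟩)
    (hpos : ∀ (h) (hh : h ∈ A),
      0 ≤ φ ⟨(h * hᵀ).trace, htr _ (A.mul_mem hh (hT h hh))⟩) :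
    ∃ π : A →+* Matrix (Fin n) (Fin n) R,
      (∀ (h) (hh : h ∈ A), π ⟨hᵀ, hT h hh⟩ = (π ⟨h, hh⟩)ᵀ) ∧
      (∀ (h) (hh : h ∈ A), (π ⟨h, hh⟩).trace = φ ⟨h.trace, htr h hh⟩) ∧
      (∀ (p) (hp : p ∈ scalarSubalgebra A),
        π ⟨p • 1, mem_scalarSubalgebra.1 hp⟩ = φ ⟨p, hp⟩ • 1) ∧
      ∀ (s) (hs : s ∈ A), sᵀ = s →
        (∀ (h) (hh : h ∈ A),
          0 ≤ φ ⟨(h * s * hᵀ).trace, htr _ (A.mul_mem (A.mul_mem hh hs) (hT h hh))⟩) →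
        ∃ W, Wᵀ = W ∧ W * W = π ⟨s, hs⟩ := by
  have hρ : ∀ h ∈ A, ρ.mapMatrix h ∈ Algebra.adjoin R (ρ.mapMatrix ''
      (A : Set (Matrix (Fin n) (Fin n) P))) :=
    fun h hh => Algebra.subset_adjoin ⟨h, hh, rfl⟩
  have hρs : ∀ p ∈ scalarSubalgebra A, ρ p ∈ Algebra.adjoin R (ρ ''
      (scalarSubalgebra A : Set P)) :=
    fun p hp => Algebra.subset_adjoin ⟨p, hp, rfl⟩
  obtain ⟨π, hπT, hπtr, hπs, hπW⟩ := exists_representation_of_trace hR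
    (fun x hx => transpose_mem_adjoin_map (R := R) ρ hT hx)
    (fun x hx => trace_mem_adjoin_map ρ htr hx) (fun p hp x hx => smul_mem_adjoin_map ρ hp hx) Φ
    (fun x hx => by
      have := trace_form_nonneg_of_adjoin hT htr φ Φ hΦ A.one_mem transpose_one
        (fun h hh => by simpa only [mul_one] using hpos h hh) hx
      simp only [map_one, mul_one] at this
      exact this (trace_mem_adjoin_map ρ htr (Subalgebra.mul_mem _ hx
        (transpose_mem_adjoin_map ρ hT hx))))
  let j : A →+* Algebra.adjoin R (ρ.mapMatrix '' (A : Set (Matrix (Fin n) (Fin n) P))) :=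
    (ρ.mapMatrix.comp (A.val : A →+* _)).codRestrict _ fun h => hρ h.1 h.2
  refine ⟨(π : _ →+* _).comp j, fun h hh => ?_, fun h hh => ?_, fun p hp => ?_,
    fun s hs hss hsp => ?_⟩
  · exact hπT _ (hρ h hh)
  · refine (hπtr _ (hρ h hh)).trans ?_
    rw [← hΦ _ _ (hρs _ (htr h hh))]
    exact congrArg Φ (Subtype.ext (AddMonoidHom.map_trace ρ h).symm)
  · refine Eq.trans ?_ ((hπs (ρ p) (hρs p hp)).trans ?_)
    · refine congrArg π (Subtype.ext ?_)
      change ρ.mapMatrix (p • 1) = ρ p • 1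
      ext a b
      simp [Matrix.one_apply, apply_ite ρ]
    · rw [hΦ p hp]
  · exact hπW _ (hρ s hs) (congrArg ρ.mapMatrix hss) fun x hx =>
      trace_form_nonneg_of_adjoin hT htr φ Φ hΦ hs hss hsp hx _

end TraceExtension

/-- A real evaluation of the scalars of a trace algebra is induced by a representation. -/
theorem exists_representation_of_scalar_evaluation {k R σ : Type*} [Field k] [Field R]
    [LinearOrder R] [IsStrictOrderedRing R] [Algebra k R] {n : ℕ}
    {A : Subalgebra k (Matrix (Fin n) (Fin n) (MvPolynomial σ k))}
    (hR : HasRealFactors R) (hT : ∀ h ∈ A, hᵀ ∈ A)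
    (htr : ∀ h ∈ A, h.trace ∈ scalarSubalgebra A) (φ : scalarSubalgebra A →ₐ[k] R)
    (hpos : ∀ (h) (hh : h ∈ A),
      0 ≤ φ ⟨(h * hᵀ).trace, htr _ (A.mul_mem hh (hT h hh))⟩) :
    ∃ π : A →+* Matrix (Fin n) (Fin n) R,
      (∀ (h) (hh : h ∈ A), π ⟨hᵀ, hT h hh⟩ = (π ⟨h, hh⟩)ᵀ) ∧
      (∀ (h) (hh : h ∈ A), (π ⟨h, hh⟩).trace = φ ⟨h.trace, htr h hh⟩) ∧
      (∀ (p) (hp : p ∈ scalarSubalgebra A),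
        π ⟨p • 1, mem_scalarSubalgebra.1 hp⟩ = φ ⟨p, hp⟩ • 1) ∧
      ∀ (s) (hs : s ∈ A), sᵀ = s →
        (∀ (h) (hh : h ∈ A),
          0 ≤ φ ⟨(h * s * hᵀ).trace, htr _ (A.mul_mem (A.mul_mem hh hs) (hT h hh))⟩) →
        ∃ W, Wᵀ = W ∧ W * W = π ⟨s, hs⟩ := by
  obtain ⟨Φ, hΦ⟩ := exists_extension_adjoin_map (scalarSubalgebra A) φ
  exact exists_representation_of_extension hR hT htr (φ : scalarSubalgebra A →+* R) Φ hΦ hpos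

section TraceRing

variable {n g : ℕ}

theorem transpose_mem_genSet {m : MatP n g} (hm : m ∈ genSet n g) : mᵀ ∈ genSet n g := by
  rcases hm with ⟨j, rfl⟩ | ⟨j, rfl⟩
  · exact Or.inr ⟨j, rfl⟩
  · exact Or.inl ⟨j, rfl⟩

theorem word_mem_traceRing {w : MatP n g} (hw : w ∈ Submonoid.closure (genSet n g)) :
    w ∈ traceRing n g := by
  have : Submonoid.closure (genSet n g) ≤ (traceRing n g).toSubmonoid :=
    Submonoid.closure_le.2 fun m hm => Algebra.subset_adjoin (Or.inl hm)
  exact this hw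

theorem transpose_mem_traceRing {h : MatP n g} (hh : h ∈ traceRing n g) :
    hᵀ ∈ traceRing n g := by
  induction hh using Algebra.adjoin_induction with
  | mem x hx =>
    rcases hx with hx | ⟨w, hw, rfl⟩
    · exact Algebra.subset_adjoin (Or.inl (transpose_mem_genSet hx))
    · refine Algebra.subset_adjoin (Or.inr ⟨w, hw, ?_⟩)
      rw [transpose_smul, transpose_one]
  | algebraMap r =>
    rw [Algebra.algebraMap_eq_smul_one, transpose_smul, transpose_one,
      ← Algebra.algebraMap_eq_smul_one]
    exact Subalgebra.algebraMap_mem _ r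
  | add x y _ _ hx hy => rw [transpose_add]; exact Subalgebra.add_mem _ hx hy
  | mul x y _ _ hx hy => rw [transpose_mul]; exact Subalgebra.mul_mem _ hy hx

theorem trace_mem_scalarSubalgebra {h : MatP n g} (hh : h ∈ traceRing n g) :
    h.trace ∈ scalarSubalgebra (traceRing n g) := by
  rw [traceRing, ← Subalgebra.mem_toSubmodule, Algebra.adjoin_eq_span] at hh
  induction hh using Submodule.span_induction with
  | mem x hx =>
    obtain ⟨p, hp, w, hw, rfl⟩ : ∃ p ∈ scalarSubalgebra (traceRing n g),
        ∃ w ∈ Submonoid.closure (genSet n g), x = p • w := by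
      induction hx using Submonoid.closure_induction with
      | mem x hx =>
        rcases hx with hx | ⟨w, hw, rfl⟩
        · exact ⟨1, Subalgebra.one_mem _, x, Submonoid.subset_closure hx, (one_smul _ _).symm⟩
        · exact ⟨w.trace, mem_scalarSubalgebra.2 (Algebra.subset_adjoin (Or.inr ⟨w, hw, rfl⟩)),
            1, Submonoid.one_mem _, rfl⟩
      | one => exact ⟨1, Subalgebra.one_mem _, 1, Submonoid.one_mem _, (one_smul _ _).symm⟩
      | mul x y _ _ hx hy =>
        obtain ⟨p, hp, w, hw, rfl⟩ := hx
        obtain ⟨p', hp', w', hw', rfl⟩ := hy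
        exact ⟨p * p', Subalgebra.mul_mem _ hp hp', w * w', Submonoid.mul_mem _ hw hw',
          smul_mul_smul_comm p w p' w'⟩
    rw [trace_smul]
    exact Subalgebra.mul_mem _ hp
      (mem_scalarSubalgebra.2 (Algebra.subset_adjoin (Or.inr ⟨w, hw, rfl⟩)))
  | zero => rw [trace_zero]; exact Subalgebra.zero_mem _
  | add x y _ _ hx hy => rw [trace_add]; exact Subalgebra.add_mem _ hx hy
  | smul r x _ hx => rw [trace_smul]; exact Subalgebra.smul_mem _ hx r

theorem isCyclicPreordering_symmetric :
    IsCyclicPreordering n g {h | h ∈ traceRing n g ∧ hᵀ = h} := by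
  refine ⟨⟨fun q hq => hq, ⟨Subalgebra.one_mem _, transpose_one⟩, fun a ha b hb => ?_,
    fun h hh q hq => ?_, fun q hq => ?_⟩, fun a ha b hb => ?_⟩
  · exact ⟨Subalgebra.add_mem _ ha.1 hb.1, by rw [transpose_add, ha.2, hb.2]⟩
  · refine ⟨Subalgebra.mul_mem _ (Subalgebra.mul_mem _ hh hq.1) (transpose_mem_traceRing hh), ?_⟩
    rw [transpose_mul, transpose_mul, transpose_transpose, hq.2, mul_assoc]
  · exact ⟨mem_scalarSubalgebra.1 (trace_mem_scalarSubalgebra hq.1),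
      by rw [transpose_smul, transpose_one]⟩
  · obtain ⟨-, p, rfl⟩ := ha.2
    refine ⟨Subalgebra.mul_mem _ ha.1.1 hb.1.1, ?_⟩
    rw [smul_mul_assoc, one_mul, transpose_smul, hb.1.2]

variable {S : Set (MatP n g)}

theorem subset_TtrS : S ⊆ TtrS n g S := fun _ hs _ _ hST => hST hs

theorem isCyclicPreordering_TtrS (hS : ∀ s ∈ S, s ∈ traceRing n g ∧ sᵀ = s) :
    IsCyclicPreordering n g (TtrS n g S) := by
  refine ⟨⟨fun q hq => hq _ isCyclicPreordering_symmetric hS, fun T hT _ => hT.1.2.1,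
    fun a ha b hb T hT hST => hT.1.2.2.1 a (ha T hT hST) b (hb T hT hST),
    fun h hh q hq T hT hST => hT.1.2.2.2.1 h hh q (hq T hT hST),
    fun q hq T hT hST => hT.1.2.2.2.2 q (hq T hT hST)⟩,
    fun a ha b hb T hT hST => hT.2 a ⟨ha.1 T hT hST, ha.2⟩ b ⟨hb.1 T hT hST, hb.2⟩⟩

theorem evalMat_eq_mapMatrix (X : Fin g → Matrix (Fin n) (Fin n) ℝ) (h : MatP n g) :
    evalMat n g X h = (MvPolynomial.eval fun v : Fin g × Fin n × Fin n =>
      X v.1 v.2.1 v.2.2).mapMatrix h := rfl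

theorem evalMat_smul_one (X : Fin g → Matrix (Fin n) (Fin n) ℝ) (p : PolyRing n g) :
    evalMat n g X (p • 1) =
      (MvPolynomial.eval fun v : Fin g × Fin n × Fin n => X v.1 v.2.1 v.2.2) p • 1 := by
  ext a b
  simp [evalMat, Matrix.one_apply, apply_ite (MvPolynomial.eval _)]

theorem evalMat_posSemidef_of_mem_TtrS (hn : 0 < n) (hS : ∀ s ∈ S, s ∈ traceRing n g ∧ sᵀ = s)
    {q : MatP n g} (hq : q ∈ TtrS n g S) {X : Fin g → Matrix (Fin n) (Fin n) ℝ}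
    (hX : X ∈ KSet n g S) : (evalMat n g X q).PosSemidef := by
  refine (hq {q | (q ∈ traceRing n g ∧ qᵀ = q) ∧ (evalMat n g X q).PosSemidef} ?_
    fun s hs => ⟨hS s hs, hX s hs⟩).2
  have hsym := isCyclicPreordering_symmetric (n := n) (g := g)
  refine ⟨⟨fun q hq => hq.1, ⟨hsym.1.2.1, ?_⟩, fun a ha b hb => ⟨hsym.1.2.2.1 a ha.1 b hb.1, ?_⟩,
    fun h hh q hq => ⟨hsym.1.2.2.2.1 h hh q hq.1, ?_⟩,
    fun q hq => ⟨hsym.1.2.2.2.2 q hq.1, ?_⟩⟩,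
    fun a ha b hb => ⟨hsym.2 a ⟨ha.1.1, ha.2⟩ b ⟨hb.1.1, hb.2⟩, ?_⟩⟩
  · rw [evalMat_eq_mapMatrix, map_one]; exact PosSemidef.one
  · rw [evalMat_eq_mapMatrix, map_add]; exact ha.2.add hb.2
  · rw [evalMat_eq_mapMatrix, map_mul, map_mul]
    exact hq.2.mul_mul_conjTranspose_same _
  · rw [evalMat_smul_one, show MvPolynomial.eval _ q.trace = (evalMat n g X q).trace from
      AddMonoidHom.map_trace (MvPolynomial.eval _) q]
    exact PosSemidef.one.smul hq.2.trace_nonneg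
  · obtain ⟨-, p, rfl⟩ := ha.2
    have h1 := ha.1.2
    rw [evalMat_smul_one] at h1
    have h2 := h1.diag_nonneg (i := ⟨0, hn⟩)
    simp only [Matrix.smul_apply, one_apply_eq, smul_eq_mul, mul_one] at h2
    rw [evalMat_eq_mapMatrix, map_mul, ← evalMat_eq_mapMatrix, ← evalMat_eq_mapMatrix,
      evalMat_smul_one, smul_mul_assoc, one_mul]
    exact hb.1.2.smul h2

theorem eq_zero_of_neg_pow_posSemidef {A : Matrix (Fin n) (Fin n) ℝ} (hA : Aᵀ = A) (k : ℕ)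
    (h : (-A ^ (2 * k)).PosSemidef) : A = 0 := by
  have hAH : A.IsHermitian := hA
  have h1 : (A ^ k)ᴴ * A ^ k = 0 := by
    have h2 : ((A ^ k)ᴴ * A ^ k).PosSemidef := posSemidef_conjTranspose_mul_self _
    have e : (A ^ k)ᴴ * A ^ k = A ^ (2 * k) := by
      rw [(hAH.pow k).eq, two_mul, pow_add]
    rw [← h2.trace_eq_zero_iff]
    refine le_antisymm ?_ h2.trace_nonneg
    have := h.trace_nonneg
    rw [trace_neg, ← e] at this
    linarith
  have h3 : A ^ k = 0 := conjTranspose_mul_self_eq_zero.1 h1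
  have h4 : ∀ m : ℕ, A ^ 2 ^ m = 0 → A = 0 := by
    intro m
    induction m with
    | zero => simp
    | succ m ih =>
      intro h
      refine ih (conjTranspose_mul_self_eq_zero.1 ?_)
      rw [(hAH.pow _).eq, ← pow_add, ← two_mul, ← pow_succ', h]
  exact h4 k (pow_eq_zero_of_le Nat.lt_two_pow_self.le h3)

theorem evalMat_eq_zero_of_neg_pow_mem_TtrS (hn : 0 < n)
    (hS : ∀ s ∈ S, s ∈ traceRing n g ∧ sᵀ = s) {a : MatP n g} (ha : aᵀ = a) {k : ℕ}
    (hk : -(a ^ (2 * k)) ∈ TtrS n g S) {X : Fin g → Matrix (Fin n) (Fin n) ℝ}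
    (hX : X ∈ KSet n g S) : evalMat n g X a = 0 := by
  have h := evalMat_posSemidef_of_mem_TtrS hn hS hk hX
  rw [evalMat_eq_mapMatrix, map_neg, map_pow] at h
  refine eq_zero_of_neg_pow_posSemidef ?_ k h
  change (a.map _)ᵀ = a.map _
  rw [← transpose_map, ha]

end TraceRing

section ScalarPositivstellensatz

variable {n g : ℕ}

/-- The scalars of a cyclic preordering. -/
def scalarCone {T : Set (MatP n g)} (hT : IsCyclicPreordering n g T) :
    Subsemiring (scalarSubalgebra (traceRing n g)) where
  carrier := {p | p.1 • (1 : MatP n g) ∈ T}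
  mul_mem' {p q} hp hq := by
    have := hT.2 _ ⟨hp, mem_scalarSubalgebra.1 p.2, _, rfl⟩ _
      ⟨hq, mem_scalarSubalgebra.1 q.2, _, rfl⟩
    rwa [smul_mul_smul_comm, one_mul] at this
  one_mem' := by
    change (1 : PolyRing n g) • (1 : MatP n g) ∈ T
    rw [one_smul]; exact hT.1.2.1
  add_mem' {p q} hp hq := by
    change (p.1 + q.1) • (1 : MatP n g) ∈ T
    rw [add_smul]; exact hT.1.2.2.1 _ hp _ hq
  zero_mem' := by
    change (0 : PolyRing n g) • (1 : MatP n g) ∈ T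
    have := hT.1.2.2.2.1 0 (Subalgebra.zero_mem _) 1 hT.1.2.1
    rwa [zero_mul, zero_mul, ← zero_smul (PolyRing n g) (1 : MatP n g)] at this

theorem mul_self_mem_scalarCone {T : Set (MatP n g)} (hT : IsCyclicPreordering n g T)
    (p : scalarSubalgebra (traceRing n g)) : p * p ∈ scalarCone hT := by
  have := hT.1.2.2.2.1 _ (mem_scalarSubalgebra.1 p.2) 1 hT.1.2.1
  rw [mul_one, transpose_smul, transpose_one, smul_mul_smul_comm, one_mul] at this
  exact this

theorem map_eval₂_eq_of_representation {R : Type*} [Field R] [Algebra ℝ R]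
    (φ : scalarSubalgebra (traceRing n g) →ₐ[ℝ] R)
    (π : traceRing n g →+* Matrix (Fin n) (Fin n) R)
    (hπT : ∀ (h) (hh : h ∈ traceRing n g), π ⟨hᵀ, transpose_mem_traceRing hh⟩ = (π ⟨h, hh⟩)ᵀ)
    (hπtr : ∀ (h) (hh : h ∈ traceRing n g),
      (π ⟨h, hh⟩).trace = φ ⟨h.trace, trace_mem_scalarSubalgebra hh⟩)
    (hπs : ∀ (p) (hp : p ∈ scalarSubalgebra (traceRing n g)),
      π ⟨p • 1, mem_scalarSubalgebra.1 hp⟩ = φ ⟨p, hp⟩ • 1)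
    {x : Fin g × Fin n × Fin n → R}
    (hx : ∀ j h, π ⟨genMat n g j, h⟩ = Matrix.of fun a b => x (j, a, b)) {h : MatP n g}
    (hh : h ∈ traceRing n g) :
    (MvPolynomial.eval₂Hom (algebraMap ℝ R) x).mapMatrix h = π ⟨h, hh⟩ := by
  set ev := MvPolynomial.eval₂Hom (algebraMap ℝ R) x
  have hgen : ∀ m (hm : m ∈ genSet n g), ev.mapMatrix m =
      π ⟨m, word_mem_traceRing (Submonoid.subset_closure hm)⟩ := by
    have h1 : ∀ j, ev.mapMatrix (genMat n g j) = Matrix.of fun a b => x (j, a, b) := by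
      intro j
      ext a b
      simp [ev, genMat]
    rintro m (⟨j, rfl⟩ | ⟨j, rfl⟩)
    · rw [hx, h1]
    · rw [hπT _ (word_mem_traceRing (Submonoid.subset_closure (Or.inl ⟨j, rfl⟩))), hx, ← h1]
      rfl
  have hword : ∀ w (hw : w ∈ Submonoid.closure (genSet n g)), ev.mapMatrix w =
      π ⟨w, word_mem_traceRing hw⟩ := by
    intro w hw
    induction hw using Submonoid.closure_induction with
    | mem m hm => exact hgen m hm
    | one => rw [map_one]; exact (map_one π).symm
    | mul u v hu hv ihu ihv =>
      rw [map_mul, ihu, ihv, ← map_mul]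
      rfl
  have hsc : ∀ p : PolyRing n g, ev.mapMatrix (p • (1 : MatP n g)) = ev p • 1 := by
    intro p
    ext a b
    simp [Matrix.one_apply, apply_ite ev]
  induction hh using Algebra.adjoin_induction with
  | mem m hm =>
    rcases hm with hm | ⟨w, hw, rfl⟩
    · exact hgen m hm
    · rw [hsc, hπs _ (trace_mem_scalarSubalgebra (word_mem_traceRing hw)), ← hπtr w
        (word_mem_traceRing hw), ← hword w hw]
      exact congrArg (· • (1 : Matrix (Fin n) (Fin n) R)) (AddMonoidHom.map_trace ev w)
  | algebraMap r =>
    have e : algebraMap ℝ (MatP n g) r = algebraMap ℝ (PolyRing n g) r • 1 := by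
      rw [Algebra.algebraMap_eq_smul_one, algebraMap_smul]
    have h1 : algebraMap ℝ (PolyRing n g) r ∈ scalarSubalgebra (traceRing n g) :=
      Subalgebra.algebraMap_mem _ r
    have h2 : π ⟨algebraMap ℝ (MatP n g) r, Subalgebra.algebraMap_mem _ r⟩ =
        π ⟨algebraMap ℝ (PolyRing n g) r • 1, mem_scalarSubalgebra.1 h1⟩ :=
      congrArg π (Subtype.ext e)
    rw [h2, hπs _ h1, e, hsc]
    congr 1
    refine Eq.trans ?_ (φ.commutes r).symm
    simp [ev, MvPolynomial.algebraMap_eq]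
  | add u v hu hv ihu ihv => rw [map_add, ihu, ihv, ← map_add]; rfl
  | mul u v hu hv ihu ihv => rw [map_mul, ihu, ihv, ← map_mul]; rfl

theorem exists_real_evaluation (hn : 0 < n) {S : Set (MatP n g)} (hSfin : S.Finite)
    (hS : ∀ s ∈ S, s ∈ traceRing n g) {R : Type*} [Field R] [LinearOrder R]
    [IsStrictOrderedRing R] [Algebra ℝ R] (hR : PolyIVT R)
    (φ : scalarSubalgebra (traceRing n g) →ₐ[ℝ] R)
    (π : traceRing n g →+* Matrix (Fin n) (Fin n) R)
    (hπT : ∀ (h) (hh : h ∈ traceRing n g), π ⟨hᵀ, transpose_mem_traceRing hh⟩ = (π ⟨h, hh⟩)ᵀ)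
    (hπtr : ∀ (h) (hh : h ∈ traceRing n g),
      (π ⟨h, hh⟩).trace = φ ⟨h.trace, trace_mem_scalarSubalgebra hh⟩)
    (hπs : ∀ (p) (hp : p ∈ scalarSubalgebra (traceRing n g)),
      π ⟨p • 1, mem_scalarSubalgebra.1 hp⟩ = φ ⟨p, hp⟩ • 1)
    (hπS : ∀ s (hs : s ∈ S), ∃ W, Wᵀ = W ∧ W * W = π ⟨s, hS s hs⟩)
    {f : PolyRing n g} (hf : f ∈ scalarSubalgebra (traceRing n g)) (hf0 : φ ⟨f, hf⟩ ≠ 0) :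
    ∃ X ∈ KSet n g S, evalMat n g X (f • 1) ≠ 0 := by
  have hgen : ∀ j, genMat n g j ∈ traceRing n g := fun j =>
    word_mem_traceRing (Submonoid.subset_closure (Or.inl ⟨j, rfl⟩))
  let x : Fin g × Fin n × Fin n → R := fun v => π ⟨genMat n g v.1, hgen v.1⟩ v.2.1 v.2.2
  have hev : ∀ h (hh : h ∈ traceRing n g),
      (MvPolynomial.eval₂Hom (algebraMap ℝ R) x).mapMatrix h = π ⟨h, hh⟩ :=
    fun h hh => map_eval₂_eq_of_representation φ π hπT hπtr hπs (fun j h => rfl) hh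
  choose W hWT hW using hπS
  let x' : (Fin g × Fin n × Fin n) ⊕ (S × Fin n × Fin n) → R :=
    Sum.elim x fun v => W v.1.1 v.1.2 v.2.1 v.2.2
  let e : S × Fin n × Fin n → MvPolynomial ((Fin g × Fin n × Fin n) ⊕ (S × Fin n × Fin n)) ℝ :=
    fun v => MvPolynomial.rename Sum.inl (v.1.1 v.2.1 v.2.2) -
      ∑ c, MvPolynomial.X (Sum.inr (v.1, v.2.1, c)) * MvPolynomial.X (Sum.inr (v.1, v.2.2, c))
  have hfin : Finite S := hSfin
  obtain ⟨y, hy, hyf⟩ := exists_real_point hR (algebraMap ℝ R) (Set.range e) (Set.finite_range e)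
    (MvPolynomial.rename Sum.inl f) x' (by
      rintro _ ⟨⟨s, a, b⟩, rfl⟩
      have h1 := congrFun (congrFun ((hev s.1 (hS s.1 s.2)).trans (hW s.1 s.2).symm) a) b
      rw [← MvPolynomial.coe_eval₂Hom, map_sub, sub_eq_zero, MvPolynomial.coe_eval₂Hom,
        MvPolynomial.eval₂_rename]
      refine h1.trans ?_
      rw [← MvPolynomial.coe_eval₂Hom, map_sum, Matrix.mul_apply]
      refine Finset.sum_congr rfl fun c _ => ?_
      rw [map_mul, MvPolynomial.coe_eval₂Hom, MvPolynomial.eval₂_X, MvPolynomial.eval₂_X]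
      change _ * W s.1 s.2 c b = _ * W s.1 s.2 b c
      rw [← congrFun (congrFun (hWT s.1 s.2) c) b, transpose_apply]
      rfl) (by
      rw [MvPolynomial.eval₂_rename]
      have h1 := (hev (f • 1) (mem_scalarSubalgebra.1 hf)).trans (hπs f hf)
      have h2 := congrFun (congrFun h1 ⟨0, hn⟩) ⟨0, hn⟩
      simp only [RingHom.mapMatrix_apply, Matrix.map_apply, Matrix.smul_apply, one_apply_eq,
        smul_eq_mul, mul_one, MvPolynomial.coe_eval₂Hom] at h2
      intro h3
      exact hf0 (h2.symm.trans h3))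
  refine ⟨fun j => Matrix.of fun a b => y (Sum.inl (j, a, b)), fun s hs => ?_, fun h0 => ?_⟩
  · let V : Matrix (Fin n) (Fin n) ℝ := Matrix.of fun a b => y (Sum.inr (⟨s, hs⟩, a, b))
    have h1 : evalMat n g (fun j => Matrix.of fun a b => y (Sum.inl (j, a, b))) s = V * Vᴴ := by
      ext a b
      have h2 := hy _ ⟨(⟨s, hs⟩, a, b), rfl⟩
      simp only [e, map_sub, sub_eq_zero, MvPolynomial.eval_rename, map_sum, map_mul,
        MvPolynomial.eval_X] at h2
      refine Eq.trans ?_ (h2.trans ?_)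
      · rfl
      · rw [Matrix.mul_apply]; rfl
    rw [h1]
    exact posSemidef_self_mul_conjTranspose V
  · rw [evalMat_smul_one] at h0
    have h2 := congrFun (congrFun h0 ⟨0, hn⟩) ⟨0, hn⟩
    simp only [Matrix.smul_apply, one_apply_eq, smul_eq_mul, mul_one, Matrix.zero_apply] at h2
    rw [MvPolynomial.eval_rename] at hyf
    exact hyf h2

theorem exists_neg_pow_smul_one_mem_TtrS (hn : 0 < n) {S : Set (MatP n g)} (hSfin : S.Finite)
    (hS : ∀ s ∈ S, s ∈ traceRing n g ∧ sᵀ = s) {f : PolyRing n g}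
    (hf : f ∈ scalarSubalgebra (traceRing n g))
    (hf0 : ∀ X ∈ KSet n g S, evalMat n g X (f • 1) = 0) :
    ∃ k : ℕ, (-f ^ (2 * k)) • (1 : MatP n g) ∈ TtrS n g S := by
  by_contra! hcon
  have hT := isCyclicPreordering_TtrS hS
  obtain ⟨R, _, _, _, φ₀, hR, hφ, hφf⟩ := exists_hom_to_ordered_field (scalarCone hT)
    (mul_self_mem_scalarCone hT) (f := ⟨f, hf⟩) fun k => hcon k
  let _ : Algebra ℝ R :=
    (φ₀.comp (algebraMap ℝ (scalarSubalgebra (traceRing n g)))).toAlgebra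
  let φ : scalarSubalgebra (traceRing n g) →ₐ[ℝ] R := { φ₀ with commutes' := fun r => rfl }
  have hpos : ∀ s (hs : s ∈ TtrS n g S) h (hh : h ∈ traceRing n g),
      0 ≤ φ ⟨(h * s * hᵀ).trace, trace_mem_scalarSubalgebra (Subalgebra.mul_mem _
        (Subalgebra.mul_mem _ hh (hT.1.1 s hs).1) (transpose_mem_traceRing hh))⟩ :=
    fun s hs h hh => hφ _ (hT.1.2.2.2.2 _ (hT.1.2.2.2.1 h hh s hs))
  obtain ⟨π, hπT, hπtr, hπs, hπW⟩ := exists_representation_of_scalar_evaluation hR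
    (fun h hh => transpose_mem_traceRing hh) (fun h hh => trace_mem_scalarSubalgebra hh) φ
    (fun h hh => by simpa only [mul_one] using hpos 1 hT.1.2.1 h hh)
  obtain ⟨X, hX, hXf⟩ := exists_real_evaluation hn hSfin (fun s hs => (hS s hs).1) hR.polyIVT φ π
    hπT hπtr hπs
    (fun s hs => hπW s (hS s hs).1 (hS s hs).2 fun h hh => hpos s (subset_TtrS hs) h hh) hf hφf
  exact hXf (hf0 X hX)

end ScalarPositivstellensatz

section RadicalIdeal

open Polynomial

variable {n g : ℕ}

theorem X_pow_mem_radical {A : Type*} [CommRing A] {J : Ideal A[X]} {c : ℕ → A}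
    (hcn : c n = 1) (hc : ∀ i < n, C (c i) ∈ J.radical)
    (hp : ∑ i ∈ Finset.range (n + 1), C (c i) * X ^ i ∈ J) : X ^ n ∈ J.radical := by
  rw [Finset.sum_range_succ, hcn, map_one, one_mul] at hp
  have h1 : ∑ i ∈ Finset.range n, C (c i) * X ^ i ∈ J.radical :=
    Ideal.sum_mem _ fun i hi => Ideal.mul_mem_right _ _ (hc i (Finset.mem_range.1 hi))
  exact (Ideal.add_mem_iff_right _ h1).1 (Ideal.le_radical hp)

theorem aeval_mem_traceRing {a : MatP n g} (haT : a ∈ traceRing n g)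
    (q : (scalarSubalgebra (traceRing n g))[X]) : aeval a q ∈ traceRing n g := by
  rw [aeval_eq_sum_range]
  exact Subalgebra.sum_mem _ fun i _ =>
    smul_mem_of_mem_scalarSubalgebra (q.coeff i).2 (Subalgebra.pow_mem _ haT i)

theorem transpose_aeval {a : MatP n g} (haSym : aᵀ = a)
    (q : (scalarSubalgebra (traceRing n g))[X]) : (aeval a q)ᵀ = aeval a q := by
  rw [aeval_eq_sum_range, transpose_sum]
  refine Finset.sum_congr rfl fun i _ => ?_
  rw [transpose_smul, transpose_pow, haSym]

/-- The polynomials `q` for which the negated square of `q(a)` lies in a cyclic preordering. -/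
def negSqIdeal {T : Set (MatP n g)} (hT : IsCyclicPreordering n g T) {a : MatP n g}
    (haT : a ∈ traceRing n g) (haSym : aᵀ = a) :
    Ideal (scalarSubalgebra (traceRing n g))[X] where
  carrier := {q | -(aeval a q) ^ 2 ∈ T}
  zero_mem' := by
    have h := hT.1.2.2.2.1 0 (Subalgebra.zero_mem _) 1 hT.1.2.1
    simpa using h
  add_mem' {p q} hp hq := by
    have h := hT.1.2.2.2.1 _ (aeval_mem_traceRing haT (p - q)) 1 hT.1.2.1
    have h2 := hT.1.2.2.1 _ (hT.1.2.2.1 _ hp _ hp) _ (hT.1.2.2.1 _ hq _ hq)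
    have h3 := hT.1.2.2.1 _ h2 _ h
    rw [transpose_aeval haSym, mul_one] at h3
    change -(aeval a (p + q)) ^ 2 ∈ T
    convert h3 using 1
    simp only [← map_pow, ← map_neg, ← map_add, ← map_mul]
    congr 1
    ring
  smul_mem' v q hq := by
    have h := hT.1.2.2.2.1 _ (aeval_mem_traceRing haT v) _ hq
    rw [transpose_aeval haSym] at h
    change -(aeval a (v * q)) ^ 2 ∈ T
    convert h using 1
    simp only [← map_pow, ← map_neg, ← map_mul]
    congr 1
    ring

theorem mem_negSqIdeal {T : Set (MatP n g)} {hT : IsCyclicPreordering n g T} {a : MatP n g}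
    {haT : a ∈ traceRing n g} {haSym : aᵀ = a} {q : (scalarSubalgebra (traceRing n g))[X]} :
    q ∈ negSqIdeal hT haT haSym ↔ -(aeval a q) ^ 2 ∈ T := Iff.rfl

theorem charpoly_coeff_mem_scalarSubalgebra {a : MatP n g} (haT : a ∈ traceRing n g) (i : ℕ) :
    a.charpoly.coeff i ∈ scalarSubalgebra (traceRing n g) :=
  charpoly_coeff_mem _ a
    (fun j => trace_mem_scalarSubalgebra (Subalgebra.pow_mem _ haT (j + 1))) i

theorem eval_charpoly_coeff_eq_zero {a : MatP n g} {X : Fin g → Matrix (Fin n) (Fin n) ℝ}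
    (h : evalMat n g X a = 0) {i : ℕ} (hi : i < n) :
    evalMat n g X (a.charpoly.coeff i • 1) = 0 := by
  rw [evalMat_smul_one]
  have h1 := Matrix.charpoly_map a (MvPolynomial.eval fun v => X v.1 v.2.1 v.2.2)
  have h2 : (a.map (MvPolynomial.eval fun v => X v.1 v.2.1 v.2.2)) = 0 := h
  rw [h2, Matrix.charpoly_zero] at h1
  have h3 := congrArg (fun q => Polynomial.coeff q i) h1
  simp only [Fintype.card_fin, coeff_X_pow, hi.ne, if_false, coeff_map] at h3
  rw [← h3, zero_smul]

theorem exists_neg_pow_mem_TtrS (hn : 0 < n) {S : Set (MatP n g)} (hSfin : S.Finite)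
    (hS : ∀ s ∈ S, s ∈ traceRing n g ∧ sᵀ = s) {a : MatP n g}
    (haT : a ∈ traceRing n g) (haSym : aᵀ = a)
    (ha0 : ∀ X ∈ KSet n g S, evalMat n g X a = 0) :
    ∃ k : ℕ, -(a ^ (2 * k)) ∈ TtrS n g S := by
  let c : ℕ → scalarSubalgebra (traceRing n g) := fun i =>
    ⟨a.charpoly.coeff i, charpoly_coeff_mem_scalarSubalgebra haT i⟩
  let J := negSqIdeal (isCyclicPreordering_TtrS hS) haT haSym
  have hc : ∀ i < n, C (c i) ∈ J.radical := by
    intro i hi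
    obtain ⟨k, hk⟩ := exists_neg_pow_smul_one_mem_TtrS hn hSfin hS
      (charpoly_coeff_mem_scalarSubalgebra haT i)
      fun X hX => eval_charpoly_coeff_eq_zero (ha0 X hX) hi
    refine ⟨k, mem_negSqIdeal.2 ?_⟩
    convert hk using 1
    have h1 : aeval a (C (c i) ^ k) = a.charpoly.coeff i ^ k • (1 : MatP n g) := by
      rw [← map_pow, aeval_C, Algebra.algebraMap_eq_smul_one]
      rfl
    rw [h1, _root_.smul_pow, one_pow, ← pow_mul, mul_comm k 2, neg_smul]
  have hdeg : a.charpoly.natDegree = n := by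
    rw [Matrix.charpoly_natDegree_eq_dim, Fintype.card_fin]
  have hp : ∑ i ∈ Finset.range (n + 1), C (c i) * X ^ i ∈ J := by
    refine mem_negSqIdeal.2 ?_
    have h1 := Matrix.aeval_self_charpoly a
    rw [aeval_eq_sum_range, hdeg] at h1
    have h2 : aeval a (∑ i ∈ Finset.range (n + 1), C (c i) * X ^ i) = 0 := by
      rw [map_sum, ← h1]
      refine Finset.sum_congr rfl fun i _ => ?_
      rw [map_mul, aeval_C, map_pow, aeval_X, ← Algebra.smul_def]
      rfl
    rw [h2, ← map_zero (aeval (R := scalarSubalgebra (traceRing n g)) a)]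
    exact mem_negSqIdeal.1 (Ideal.zero_mem J)
  have hcn : c n = 1 := by
    have h1 := (Matrix.charpoly_monic a).coeff_natDegree
    rw [hdeg] at h1
    exact Subtype.ext h1
  obtain ⟨k, hk⟩ := X_pow_mem_radical hcn hc hp
  refine ⟨n * k, ?_⟩
  have h := mem_negSqIdeal.1 hk
  have h1 : aeval a ((X ^ n) ^ k : (scalarSubalgebra (traceRing n g))[X]) = a ^ (n * k) := by
    rw [← pow_mul, aeval_X_pow]
  rwa [h1, ← pow_mul, mul_comm _ 2] at h

end RadicalIdeal

/-- Krivine-Stengle Positivstellensatz for trace polynomials, vanishing case. -/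
theorem stmt2 (n g : ℕ) (hn : 0 < n) (hg : 0 < g)
    (S : Set (MatP n g)) (hSfin : S.Finite)
    (hS : ∀ s ∈ S, s ∈ traceRing n g ∧ sᵀ = s)
    (a : MatP n g) (haT : a ∈ traceRing n g) (haSym : aᵀ = a) :
    (∀ X ∈ KSet n g S, evalMat n g X a = 0) ↔
      ∃ k : ℕ, -(a ^ (2 * k)) ∈ TtrS n g S := by
  exact ⟨exists_neg_pow_mem_TtrS hn hSfin hS haT haSym, fun ⟨_, hk⟩ _ hX =>
    evalMat_eq_zero_of_neg_pow_mem_TtrS hn hS haSym hk hX⟩
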